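/- Let Φ(·) = Σ_{i∈I} V_i (·) V_i* be a quantum operation from 𝔗(ℋ) to 𝔗(ℋ') with Kraus operators {V_i}_{i∈I} and let d_i = rank V_i. (A) If I is finite, then Φ has continuous output entropy if and only if λ*(V_i) < +∞ for every i ∈ I, which in this case is equivalent to λ*(√(Σ_{i∈I} V_i*V_i)) < +∞; in the general (countable) case, finiteness of λ*(V_i) for all i is a necessary condition for continuity of the output entropy of Φ. (B) If I = ℕ, then Φ has continuous output entropy if either (a) every d_i is finite and there is a sequence {h_i} of nonnegative numbers with ‖Σ_{i} h_i V_i*V_i‖ < +∞ and Σ_i d_i e^{−h_i} < +∞, or (b) H({Tr V_i ρ V_i*}_{i=1}^{∞}) < +∞ for all ρ ∈ 𝔖(ℋ) and λ*(√(Σ_i V_i*V_i)) < +∞. In (b) the condition λ*(√(Σ_i V_i*V_i)) < +∞ may be replaced by finiteness of Σ_i λ*(V_i) or of Σ_i log(d_i)·‖V_i‖². Moreover, (a) is necessary when the V_i are scalar multiples of mutually orthogonal projectors, and (b) is necessary when Ran V_i ⟂ Ran V_j for all i ≠ j. -/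

import Mathlib

open scoped ENNReal NNReal
open Filter Topology Classical
attribute [local instance] Classical.propDecidable

noncomputable section

namespace QIT

section Defs

variable {E F G : Type*}
variable [NormedAddCommGroup E] [InnerProductSpace ℂ E] [CompleteSpace E]
variable [NormedAddCommGroup F] [InnerProductSpace ℂ F] [CompleteSpace F]
variable [NormedAddCommGroup G] [InnerProductSpace ℂ G] [CompleteSpace G]

/-- The real part of `⟪x, A x⟫`. -/
def qf (A : E →L[ℂ] E) (x : E) : ℝ := (inner ℂ x (A x) : ℂ).re

/-- The trace of a positive operator, as the supremum of finite diagonal sums over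
finite orthonormal families.  For positive operators this coincides with the usual
trace (with value `∞` when the operator is not trace class). -/
def traceENN (A : E →L[ℂ] E) : ℝ≥0∞ :=
  ⨆ (n : ℕ) (e : Fin n → E) (_ : Orthonormal ℂ e), ∑ i, ENNReal.ofReal (qf A (e i))

/-- The trace norm `‖A‖₁`, as the supremum of `∑ |⟪e i, A (f i)⟫|` over pairs of finite
orthonormal families; it is finite exactly on trace-class operators. -/
def traceNorm (A : E →L[ℂ] E) : ℝ≥0∞ :=
  ⨆ (n : ℕ) (e : Fin n → E) (f : Fin n → E) (_ : Orthonormal ℂ e) (_ : Orthonormal ℂ f),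
    ∑ i, ENNReal.ofReal ‖(inner ℂ (e i) (A (f i)) : ℂ)‖

/-- `A` is a trace-class operator. -/
def IsTC (A : E →L[ℂ] E) : Prop := traceNorm A ≠ ∞

/-- The cone `𝔗₊(E)` of positive trace-class operators. -/
def posTC (E : Type*) [NormedAddCommGroup E] [InnerProductSpace ℂ E] [CompleteSpace E] :
    Set (E →L[ℂ] E) := {A | A.IsPositive ∧ IsTC A}

/-- The set `𝔖(E)` of states (density operators). -/
def states (E : Type*) [NormedAddCommGroup E] [InnerProductSpace ℂ E] [CompleteSpace E] :
    Set (E →L[ℂ] E) := {A | A.IsPositive ∧ traceENN A = 1}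

/-- The extended classical entropy `H({x_i}) = ∑ η(x_i) − η(∑ x_i)` of a nonnegative
summable family, written in the equivalent homogeneous form `(∑ x) · H({x_i/∑x})`. -/
def clEntropy {ι : Type*} (x : ι → ℝ) : ℝ≥0∞ :=
  ENNReal.ofReal (∑' i, x i) *
    ∑' i, ENNReal.ofReal (Real.negMulLog (x i / (∑' j, x j)))

/-- An orthonormal subset with dense span (an orthonormal basis, as a set). -/
def IsONB (s : Set E) : Prop :=
  Orthonormal ℂ ((↑) : s → E) ∧ Dense ((Submodule.span ℂ s : Submodule ℂ E) : Set E)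

/-- The quantum (von Neumann) entropy `H(A) = Tr η(A) − η(Tr A)` of a positive trace-class
operator, realized as the infimum over all orthonormal bases of the classical entropy of
the diagonal of `A` (the infimum is attained on an eigenbasis of `A`). -/
def qEntropy (A : E →L[ℂ] E) : ℝ≥0∞ :=
  ⨅ (s : Set E) (_ : IsONB s), clEntropy fun v : s => qf A v

theorem exists_isONB (E : Type*) [NormedAddCommGroup E] [InnerProductSpace ℂ E]
    [CompleteSpace E] : ∃ s : Set E, IsONB s := by
  obtain ⟨w, b, hb⟩ := exists_hilbertBasis ℂ E
  refine ⟨w, ?_, ?_⟩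
  · have h := b.orthonormal
    rwa [hb] at h
  · have h := b.dense_span
    rw [hb, Subtype.range_coe] at h
    rwa [Submodule.dense_iff_topologicalClosure_eq_top]

/-- A fixed orthonormal basis (as a set). -/
def stdONB (E : Type*) [NormedAddCommGroup E] [InnerProductSpace ℂ E] [CompleteSpace E] :
    Set E := (exists_isONB E).choose

/-- The `ℂ`-valued trace, computed in a fixed orthonormal basis; for trace-class
operators it does not depend on the choice of the basis. -/
def traceC (A : E →L[ℂ] E) : ℂ := ∑' v : stdONB E, (inner ℂ (v : E) (A v) : ℂ)

/-- Continuity (including finiteness) of an `ℝ≥0∞`-valued function on a subset of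
operators, with respect to the trace-norm distance. -/
def ContOn (f : (E →L[ℂ] E) → ℝ≥0∞) (𝒜 : Set (E →L[ℂ] E)) : Prop :=
  (∀ A ∈ 𝒜, f A ≠ ∞) ∧
  ∀ A ∈ 𝒜, ∀ ε : ℝ, 0 < ε → ∃ δ : ℝ, 0 < δ ∧
    ∀ B ∈ 𝒜, traceNorm (B - A) < ENNReal.ofReal δ → |(f B).toReal - (f A).toReal| < ε

/-- Continuity of a real-valued function on a subset of operators with respect to the
trace-norm distance. -/
def RContOn (g : (E →L[ℂ] E) → ℝ) (𝒜 : Set (E →L[ℂ] E)) : Prop :=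
  ∀ A ∈ 𝒜, ∀ ε : ℝ, 0 < ε → ∃ δ : ℝ, 0 < δ ∧
    ∀ B ∈ 𝒜, traceNorm (B - A) < ENNReal.ofReal δ → |g B - g A| < ε

/-- Boundedness of an `ℝ≥0∞`-valued function on a set. -/
def BddOn (f : (E →L[ℂ] E) → ℝ≥0∞) (𝒜 : Set (E →L[ℂ] E)) : Prop :=
  ∃ C : ℝ, ∀ A ∈ 𝒜, f A ≤ ENNReal.ofReal C

/-- Convergence of a sequence of operators in the trace norm. -/
def TendstoTN (A : ℕ → (E →L[ℂ] E)) (A₀ : E →L[ℂ] E) : Prop :=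
  ∀ ε : ℝ, 0 < ε → ∃ N : ℕ, ∀ n ≥ N, traceNorm (A n - A₀) < ENNReal.ofReal ε

/-- A positive linear map from the trace class of `E` to the trace class of `F`
(the values of `toFun` outside the trace class are irrelevant). -/
structure TraceMap (E F : Type*) [NormedAddCommGroup E] [InnerProductSpace ℂ E]
    [CompleteSpace E] [NormedAddCommGroup F] [InnerProductSpace ℂ F] [CompleteSpace F] where
  toFun : (E →L[ℂ] E) → (F →L[ℂ] F)
  map_add : ∀ A B, IsTC A → IsTC B → toFun (A + B) = toFun A + toFun B
  map_smul : ∀ (c : ℂ) A, IsTC A → toFun (c • A) = c • toFun A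
  maps_tc : ∀ A, IsTC A → IsTC (toFun A)
  pos : ∀ A, IsTC A → A.IsPositive → (toFun A).IsPositive

/-- A trace-non-increasing map. -/
def TraceMap.TNI (Φ : TraceMap E F) : Prop :=
  ∀ A, IsTC A → A.IsPositive → traceENN (Φ.toFun A) ≤ traceENN A

/-- A trace-preserving map. -/
def TraceMap.TP (Φ : TraceMap E F) : Prop :=
  ∀ A, IsTC A → A.IsPositive → traceENN (Φ.toFun A) = traceENN A

/-- A map bounded with respect to the trace norm. -/
def TraceMap.Bounded (Φ : TraceMap E F) : Prop :=
  ∃ C : ℝ≥0, ∀ A, traceNorm (Φ.toFun A) ≤ (C : ℝ≥0∞) * traceNorm A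

/-- The output entropy `H_Φ = H ∘ Φ`. -/
def outEntropy (Φ : TraceMap E F) (A : E →L[ℂ] E) : ℝ≥0∞ := qEntropy (Φ.toFun A)

/-- The rank-one operator `|x⟩⟨x|`. -/
def rankOne (x : E) : E →L[ℂ] E := (innerSL ℂ x).smulRight x

/-- The rank-one operator `|x⟩⟨y|`. -/
def rankOneM (x y : E) : E →L[ℂ] E := (innerSL ℂ y).smulRight x

end Defs

section Defs2

variable {E F G : Type*}
variable [NormedAddCommGroup E] [InnerProductSpace ℂ E] [CompleteSpace E]
variable [NormedAddCommGroup F] [InnerProductSpace ℂ F] [CompleteSpace F]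
variable [NormedAddCommGroup G] [InnerProductSpace ℂ G] [CompleteSpace G]

/-- The completely positive map `A ↦ ∑ᵢ Vᵢ A Vᵢ*` defined by a sequence of Kraus
operators. -/
def krausMap (V : ℕ → (E →L[ℂ] F)) (A : E →L[ℂ] E) : F →L[ℂ] F :=
  ∑' i, V i ∘L A ∘L ContinuousLinearMap.adjoint (V i)

/-- The Kraus condition `∑ᵢ Vᵢ* Vᵢ ≤ I` (all partial sums are dominated by `I`). -/
def KrausTNI (V : ℕ → (E →L[ℂ] F)) : Prop :=
  ∀ n : ℕ,
    ((1 : E →L[ℂ] E) - ∑ i ∈ Finset.range n, ContinuousLinearMap.adjoint (V i) ∘L V i).IsPositive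

/-- The Kraus condition `∑ᵢ Vᵢ* Vᵢ = I` (strong convergence), i.e. trace preservation. -/
def KrausTP (V : ℕ → (E →L[ℂ] F)) : Prop :=
  ∀ x : E, HasSum (fun i => (ContinuousLinearMap.adjoint (V i)) (V i x)) x

/-- `(Φ, Φt)` is a complementary pair of quantum operations: for some Kraus
representation `Φ(·) = ∑ᵢ Vᵢ (·) Vᵢ*` and some orthonormal basis `{bᵢ}` of `G`,
`Φt(A) = ∑_{i,j} Tr[Vᵢ A Vⱼ*] |bᵢ⟩⟨bⱼ|` (characterized by its matrix entries). -/
def IsComplementaryPair (Φ : TraceMap E F) (Φt : TraceMap E G) : Prop :=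
  ∃ (V : ℕ → (E →L[ℂ] F)) (b : HilbertBasis ℕ ℂ G),
    KrausTNI V ∧
    (∀ A, IsTC A → Φ.toFun A = krausMap V A) ∧
    (∀ A, IsTC A → ∀ i j : ℕ,
      (inner ℂ (b i) (Φt.toFun A (b j)) : ℂ) =
        traceC (V i ∘L A ∘L ContinuousLinearMap.adjoint (V j)))

/-- A map (on trace-class operators) preserves continuity of the entropy:
its output entropy is continuous on every subset of the positive trace-class cone on
which the von Neumann entropy is continuous. -/
def PCE (Φf : (E →L[ℂ] E) → (F →L[ℂ] F)) : Prop :=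
  ∀ 𝒜 : Set (E →L[ℂ] E), 𝒜 ⊆ posTC E → ContOn qEntropy 𝒜 →
    ContOn (fun A => qEntropy (Φf A)) 𝒜

/-- `μ` is the sequence of nonzero eigenvalues (with multiplicities, possibly padded by
zeros) of the diagonalizable positive operator `T`, every vector orthogonal to the
eigenvectors being annihilated by `T`. -/
def IsEigenSeq (T : E →L[ℂ] E) (μ : ℕ → ℝ) : Prop :=
  ∃ e : ℕ → E,
    (∀ i j, i ≠ j → (inner ℂ (e i) (e j) : ℂ) = 0) ∧
    (∀ i, (μ i ≠ 0 → ‖e i‖ = 1) ∧ (μ i = 0 → e i = 0)) ∧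
    (∀ i, T (e i) = (μ i : ℂ) • e i) ∧
    (∀ x : E, (∀ i, (inner ℂ (e i) x : ℂ) = 0) → T x = 0)

/-- `ν` is the sequence of singular values of `V` (eigenvalues of `√(V*V)`,
equivalently `ν²` are the eigenvalues of `V*V`). -/
def IsSingularValues (V : E →L[ℂ] F) (ν : ℕ → ℝ) : Prop :=
  (∀ i, 0 ≤ ν i) ∧ IsEigenSeq (ContinuousLinearMap.adjoint V ∘L V) (fun i => ν i ^ 2)

/-- `∑ᵢ e^{−l/νᵢ²}`, the sum being taken over the indices with `νᵢ ≠ 0`. -/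
def expSum (ν : ℕ → ℝ) (l : ℝ) : ℝ≥0∞ :=
  ∑' i, if ν i = 0 then 0 else ENNReal.ofReal (Real.exp (-(l / ν i ^ 2)))

/-- `λ*(V) < ∞`: `V` is compact (automatic here) and `∑ᵢ e^{−l/νᵢ²} < ∞` for some
`l > 0`, where `{νᵢ}` are the singular values of `V`. -/
def LamStarFin (V : E →L[ℂ] F) : Prop :=
  ∃ ν : ℕ → ℝ, IsSingularValues V ν ∧ ∃ l : ℝ, 0 < l ∧ expSum ν l ≠ ∞

/-- `λ*(√S) < ∞` for a positive operator `S` (the singular values of `√S` are the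
square roots of the eigenvalues of `S`). -/
def LamStarSqrtFin (S : E →L[ℂ] E) : Prop :=
  ∃ ν : ℕ → ℝ, (∀ i, 0 ≤ ν i) ∧ IsEigenSeq S (fun i => ν i ^ 2) ∧
    ∃ l : ℝ, 0 < l ∧ expSum ν l ≠ ∞

/-- The value `λ*` associated to a sequence `ν` of singular values: the unique solution
of `∑ᵢ e^{−λ/νᵢ²} = 1` if it exists, and `inf{λ > 0 | ∑ᵢ e^{−λ/νᵢ²} < ∞}` otherwise. -/
def lamStarOf (ν : ℕ → ℝ) : ℝ≥0∞ :=
  if h : ∃ l : ℝ, expSum ν l = 1 then ENNReal.ofReal h.choose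
  else ⨅ (l : ℝ) (_ : 0 < l ∧ expSum ν l ≠ ∞), ENNReal.ofReal l

/-- The parameter `λ*(V) ∈ [0,∞]` of a bounded operator `V`. -/
def lamStar (V : E →L[ℂ] F) : ℝ≥0∞ :=
  if h : ∃ ν : ℕ → ℝ, IsSingularValues V ν then lamStarOf h.choose else ∞

/-- `rank A ≤ k`. -/
def rankLE (A : E →L[ℂ] E) (k : ℕ) : Prop :=
  Module.rank ℂ (LinearMap.range (A : E →ₗ[ℂ] E)) ≤ k

/-- The set `𝔗₊ᵏ(E)` of positive (trace-class) operators of rank at most `k`. -/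
def rankCone (E : Type*) [NormedAddCommGroup E] [InnerProductSpace ℂ E] [CompleteSpace E]
    (k : ℕ) : Set (E →L[ℂ] E) := {A | A.IsPositive ∧ rankLE A k}

/-- A decomposition of `A` into a countable convex combination of positive operators of
rank at most `k`. -/
structure Decomp (k : ℕ) (A : E →L[ℂ] E) where
  π : ℕ → ℝ
  op : ℕ → (E →L[ℂ] E)
  π_nonneg : ∀ i, 0 ≤ π i
  π_sum : HasSum π 1
  op_pos : ∀ i, (op i).IsPositive
  op_rank : ∀ i, rankLE (op i) k
  sum_eq : HasSum (fun i => π i • op i) A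

/-- The `k`-order approximator `H_Φᵏ` of the output entropy of `Φ`. -/
def kApprox (Φf : (E →L[ℂ] E) → (F →L[ℂ] F)) (k : ℕ) (A : E →L[ℂ] E) : ℝ≥0∞ :=
  ⨆ d : Decomp k A, ∑' i, ENNReal.ofReal (d.π i) * qEntropy (Φf (d.op i))

/-- The set of pure states (extreme points of `𝔖(E)`). -/
def pureStates (E : Type*) [NormedAddCommGroup E] [InnerProductSpace ℂ E]
    [CompleteSpace E] : Set (E →L[ℂ] E) := {A | ∃ x : E, ‖x‖ = 1 ∧ A = rankOne x}

end Defs2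

section Tensor

variable (E F G : Type*)
variable [NormedAddCommGroup E] [InnerProductSpace ℂ E] [CompleteSpace E]
variable [NormedAddCommGroup F] [InnerProductSpace ℂ F] [CompleteSpace F]
variable [NormedAddCommGroup G] [InnerProductSpace ℂ G] [CompleteSpace G]

/-- A realization of `G` as the Hilbert tensor product `E ⊗ F`, together with the
tensor product of (bounded) operators. -/
structure TensorData where
  tmul : E → F → G
  add_left : ∀ x y z, tmul (x + y) z = tmul x z + tmul y z
  add_right : ∀ x y z, tmul x (y + z) = tmul x y + tmul x z
  smul_left : ∀ (c : ℂ) x y, tmul (c • x) y = c • tmul x y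
  smul_right : ∀ (c : ℂ) x y, tmul x (c • y) = c • tmul x y
  inner_tmul : ∀ x x' y y',
    (inner ℂ (tmul x y) (tmul x' y') : ℂ) = (inner ℂ x x' : ℂ) * (inner ℂ y y' : ℂ)
  dense_span : Dense ((Submodule.span ℂ {z | ∃ x y, z = tmul x y} : Submodule ℂ G) : Set G)
  omul : (E →L[ℂ] E) → (F →L[ℂ] F) → (G →L[ℂ] G)
  omul_tmul : ∀ A B x y, omul A B (tmul x y) = tmul (A x) (B y)

end Tensor

set_option linter.unusedSectionVars false

section Classical

/-- The function `x log (T / x)`, whose sum over a family with total mass `T` is the entropy. -/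
def phi (x T : ℝ) : ℝ := x * Real.log (T / x)

theorem phi_zero (T : ℝ) : phi 0 T = 0 := by simp [phi]

theorem phi_nonneg {x T : ℝ} (hx : 0 ≤ x) (hT : x ≤ T) : 0 ≤ phi x T := by
  rcases hx.eq_or_lt with rfl | h
  · simp [phi]
  · exact mul_nonneg hx (Real.log_nonneg ((one_le_div h).2 hT))

theorem phi_mono_right {x T U : ℝ} (hx : 0 ≤ x) (hT : x ≤ T) (hU : T ≤ U) :
    phi x T ≤ phi x U := by
  rcases hx.eq_or_lt with rfl | h
  · simp [phi]
  · unfold phi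
    have : 0 < T := h.trans_le hT
    gcongr

theorem phi_smul {c : ℝ} (hc : 0 ≤ c) (x T : ℝ) : phi (c * x) (c * T) = c * phi x T := by
  rcases hc.eq_or_lt with rfl | h
  · simp [phi]
  · unfold phi
    rw [mul_div_mul_left _ _ h.ne', mul_assoc]

theorem phi_add_le {x T y U : ℝ} (hx : 0 ≤ x) (hT : x ≤ T) (hy : 0 ≤ y) (hU : y ≤ U) :
    phi x T + phi y U ≤ phi (x + y) (T + U) := by
  rcases hx.eq_or_lt with rfl | hx'
  · simpa [phi_zero] using phi_mono_right hy hU (by linarith : U ≤ T + U)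
  rcases hy.eq_or_lt with rfl | hy'
  · simpa [phi_zero] using phi_mono_right hx hT (by linarith : T ≤ T + U)
  have hT' : 0 < T := hx'.trans_le hT
  have hU' : 0 < U := hy'.trans_le hU
  have key : ∀ {a A : ℝ}, 0 < a → 0 < A →
      a * Real.log (A / a) - a * Real.log ((T + U) / (x + y)) ≤ A * (x + y) / (T + U) - a := by
    intro a A ha hA
    have h1 : a * Real.log (A / a) - a * Real.log ((T + U) / (x + y))
        = a * Real.log ((A / a) / ((T + U) / (x + y))) := by
      rw [Real.log_div (x := A / a) (y := (T + U) / (x + y)) (by positivity) (by positivity)]; ring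
    rw [h1]
    have h2 := Real.log_le_sub_one_of_pos
      (show 0 < (A / a) / ((T + U) / (x + y)) by positivity)
    calc _ ≤ a * ((A / a) / ((T + U) / (x + y)) - 1) := by gcongr
      _ = _ := by field_simp
  have h1 := key hx' hT'
  have h2 := key hy' hU'
  have h3 : T * (x + y) / (T + U) + U * (x + y) / (T + U) = x + y := by field_simp
  unfold phi
  nlinarith

/-- The extended nonnegative version of `phi`. -/
def ePhi (x T : ℝ≥0∞) : ℝ≥0∞ := ENNReal.ofReal (phi x.toReal T.toReal)

theorem ePhi_zero (T : ℝ≥0∞) : ePhi 0 T = 0 := by simp [ePhi, phi]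

theorem ePhi_mono_right {x T U : ℝ≥0∞} (hT : x ≤ T) (hU : T ≤ U) (hU' : U ≠ ∞) :
    ePhi x T ≤ ePhi x U := by
  have hT' : T ≠ ∞ := ne_top_of_le_ne_top hU' hU
  exact ENNReal.ofReal_le_ofReal (phi_mono_right ENNReal.toReal_nonneg
    (ENNReal.toReal_mono hT' hT) (ENNReal.toReal_mono hU' hU))

theorem ePhi_smul {c : ℝ≥0∞} (x T : ℝ≥0∞) :
    ePhi (c * x) (c * T) = ENNReal.ofReal c.toReal * ePhi x T := by
  unfold ePhi
  rw [ENNReal.toReal_mul, ENNReal.toReal_mul, phi_smul ENNReal.toReal_nonneg,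
    ENNReal.ofReal_mul ENNReal.toReal_nonneg]

theorem ePhi_add_le {x T y U : ℝ≥0∞} (hT : x ≤ T) (hU : y ≤ U) (hT' : T ≠ ∞) (hU' : U ≠ ∞) :
    ePhi x T + ePhi y U ≤ ePhi (x + y) (T + U) := by
  have hx : x ≠ ∞ := ne_top_of_le_ne_top hT' hT
  have hy : y ≠ ∞ := ne_top_of_le_ne_top hU' hU
  unfold ePhi
  have h1 := ENNReal.toReal_mono hT' hT
  have h2 := ENNReal.toReal_mono hU' hU
  rw [← ENNReal.ofReal_add (phi_nonneg ENNReal.toReal_nonneg h1)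
    (phi_nonneg ENNReal.toReal_nonneg h2), ENNReal.toReal_add hx hy, ENNReal.toReal_add hT' hU']
  exact ENNReal.ofReal_le_ofReal
    (phi_add_le ENNReal.toReal_nonneg h1 ENNReal.toReal_nonneg h2)

variable {ι κ : Type*}

theorem sum_ePhi_le (s : Finset ι) {u v : ι → ℝ≥0∞} (h : ∀ i, u i ≤ v i) (hv : ∀ i, v i ≠ ∞) :
    ∑ i ∈ s, ePhi (u i) (v i) ≤ ePhi (∑ i ∈ s, u i) (∑ i ∈ s, v i) := by
  induction s using Finset.induction_on with
  | empty => simp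
  | insert a s ha ih =>
    rw [Finset.sum_insert ha, Finset.sum_insert ha, Finset.sum_insert ha]
    refine (add_le_add le_rfl ih).trans (ePhi_add_le (h a) (Finset.sum_le_sum fun i _ => h i)
      (hv a) (ENNReal.sum_ne_top.2 fun i _ => hv i))

/-- The countable log-sum inequality. -/
theorem tsum_ePhi_le {u v : ι → ℝ≥0∞} (h : ∀ i, u i ≤ v i) (hv : ∑' i, v i ≠ ∞) :
    ∑' i, ePhi (u i) (v i) ≤ ePhi (∑' i, u i) (∑' i, v i) := by
  rw [ENNReal.tsum_eq_iSup_sum]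
  refine iSup_le fun s => ?_
  have hv' : ∀ i, v i ≠ ∞ := fun i => ENNReal.ne_top_of_tsum_ne_top hv i
  refine (sum_ePhi_le s h hv').trans ?_
  have e : ∀ w : ι → ℝ≥0∞, ∑' i, w i = ∑ i ∈ s, w i + ∑' i : ↥((s : Set ι)ᶜ), w i := by
    intro w
    rw [← Finset.tsum_subtype' s w]
    exact (ENNReal.summable.tsum_add_tsum_compl (s := (s : Set ι)) ENNReal.summable).symm
  have hs : ∑ i ∈ s, v i ≠ ∞ := ENNReal.sum_ne_top.2 fun i _ => hv' i
  have hc : ∑' i : ↥((s : Set ι)ᶜ), v i ≠ ∞ := by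
    rw [e v] at hv
    exact (ENNReal.add_ne_top.1 hv).2
  rw [e u, e v]
  exact le_self_add.trans (ePhi_add_le (Finset.sum_le_sum fun i _ => h i)
    (ENNReal.tsum_le_tsum fun i => h i) hs hc)

/-- Classical entropy of a family of extended nonnegative numbers. -/
def ent (x : ι → ℝ≥0∞) : ℝ≥0∞ := clEntropy fun i => (x i).toReal

theorem ent_eq {x : ι → ℝ≥0∞} (hx : ∑' i, x i ≠ ∞) :
    ent x = ∑' i, ePhi (x i) (∑' j, x j) := by
  have hx' : ∀ i, x i ≠ ∞ := fun i => ENNReal.ne_top_of_tsum_ne_top hx i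
  unfold ent clEntropy
  rw [← ENNReal.tsum_toReal_eq hx', ← ENNReal.tsum_mul_left]
  refine tsum_congr fun i => ?_
  set T := ∑' j, x j
  rw [← ENNReal.ofReal_mul ENNReal.toReal_nonneg]
  unfold ePhi
  congr 1
  have hle : (x i).toReal ≤ T.toReal := ENNReal.toReal_mono hx (ENNReal.le_tsum i)
  rcases (ENNReal.toReal_nonneg (a := x i)).eq_or_lt with h | h
  · simp [← h, phi]
  · have hT : 0 < T.toReal := h.trans_le hle
    have hl : Real.log (T.toReal / (x i).toReal) = -Real.log ((x i).toReal / T.toReal) := by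
      rw [← Real.log_inv, inv_div]
    unfold phi Real.negMulLog
    rw [hl]
    field_simp

theorem ent_add_le {x y : ι → ℝ≥0∞} (hx : ∑' i, x i ≠ ∞) (hy : ∑' i, y i ≠ ∞) :
    ent x + ent y ≤ ent (fun i => x i + y i) := by
  have e : ∑' i, (x i + y i) = ∑' i, x i + ∑' i, y i := ENNReal.tsum_add
  rw [ent_eq hx, ent_eq hy, ent_eq (by rw [e]; exact ENNReal.add_ne_top.2 ⟨hx, hy⟩),
    ← ENNReal.tsum_add, e]
  exact ENNReal.tsum_le_tsum fun i =>
    ePhi_add_le (ENNReal.le_tsum i) (ENNReal.le_tsum i) hx hy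

theorem ent_mono {x y : ι → ℝ≥0∞} (h : ∀ i, x i ≤ y i) (hy : ∑' i, y i ≠ ∞) : ent x ≤ ent y := by
  have hx : ∑' i, x i ≠ ∞ := ne_top_of_le_ne_top hy (ENNReal.tsum_le_tsum h)
  have hz : ∑' i, (y i - x i) ≠ ∞ :=
    ne_top_of_le_ne_top hy (ENNReal.tsum_le_tsum fun i => tsub_le_self)
  have := ent_add_le (x := x) (y := fun i => y i - x i) hx hz
  simp only [add_tsub_cancel_of_le (h _)] at this
  exact le_self_add.trans this

theorem ent_smul {c : ℝ≥0∞} (hc : c ≠ ∞) {x : ι → ℝ≥0∞} (hx : ∑' i, x i ≠ ∞) :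
    ent (fun i => c * x i) = c * ent x := by
  have hcx : ∑' i, c * x i ≠ ∞ := by
    rw [ENNReal.tsum_mul_left]; exact ENNReal.mul_ne_top hc hx
  rw [ent_eq hcx, ent_eq hx]
  conv_lhs => rw [ENNReal.tsum_mul_left]
  simp only [ePhi_smul, ENNReal.ofReal_toReal hc, ENNReal.tsum_mul_left]

/-- Entropy does not decrease under a stochastic map whose column sums are at most one, and
decreases by at most `log M` if they are at most `M`. -/
theorem ent_le_of_stochastic {x : ι → ℝ≥0∞} {y : κ → ℝ≥0∞} {D : ι → κ → ℝ≥0∞} {M : ℝ}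
    (hx : ∑' i, x i ≠ ∞) (hM : 1 ≤ M) (h1 : ∀ i, x i ≠ 0 → ∑' a, D i a = 1)
    (h2 : ∀ a, ∑' i, (if x i = 0 then 0 else D i a) ≤ ENNReal.ofReal M)
    (h3 : ∀ a, y a = ∑' i, x i * D i a) :
    ent x ≤ ent y + ENNReal.ofReal (Real.log M) * ∑' i, x i := by
  set T := ∑' i, x i with hT
  have hy : ∑' a, y a = T := by
    simp_rw [h3]
    rw [ENNReal.tsum_comm]
    refine tsum_congr fun i => ?_
    rw [ENNReal.tsum_mul_left]
    rcases eq_or_ne (x i) 0 with h | h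
    · simp [h]
    · rw [h1 i h, mul_one]
  have hM0 : 0 < M := by linarith
  set D' : ι → κ → ℝ≥0∞ := fun i a => if x i = 0 then 0 else D i a with hD'
  have hD'fin : ∀ i a, D' i a ≠ ∞ := fun i a =>
    ne_top_of_le_ne_top ENNReal.ofReal_ne_top ((ENNReal.le_tsum i).trans (h2 a))
  rw [ent_eq hx, ent_eq (by rwa [hy]), hy]
  have step : ∀ a, ∑' i, D' i a * ePhi (x i) T ≤
      ePhi (y a) T + ENNReal.ofReal (Real.log M) * y a := by
    intro a
    have e1 : ∀ i, D' i a * ePhi (x i) T = ePhi (D' i a * x i) (D' i a * T) := by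
      intro i
      rw [ePhi_smul, ENNReal.ofReal_toReal (hD'fin i a)]
    have e2 : ∑' i, D' i a * x i = y a := by
      rw [h3]
      refine tsum_congr fun i => ?_
      simp only [hD']
      split_ifs with h
      · simp [h]
      · rw [mul_comm]
    have hle : ∑' i, D' i a * T ≤ ENNReal.ofReal M * T := by
      rw [ENNReal.tsum_mul_right]
      gcongr
      exact h2 a
    have hfin : ENNReal.ofReal M * T ≠ ∞ := ENNReal.mul_ne_top ENNReal.ofReal_ne_top hx
    have hyT : y a ≤ T := by rw [← hy]; exact ENNReal.le_tsum a
    calc ∑' i, D' i a * ePhi (x i) T = ∑' i, ePhi (D' i a * x i) (D' i a * T) := tsum_congr e1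
      _ ≤ ePhi (y a) (∑' i, D' i a * T) := by
        rw [← e2]
        refine tsum_ePhi_le (fun i => ?_) (ne_top_of_le_ne_top hfin hle)
        gcongr
        exact ENNReal.le_tsum i
      _ ≤ ePhi (y a) (ENNReal.ofReal M * T) := by
        refine ePhi_mono_right ?_ hle hfin
        rw [← e2]
        refine ENNReal.tsum_le_tsum fun i => ?_
        gcongr
        exact ENNReal.le_tsum i
      _ ≤ _ := by
        have hyfin : y a ≠ ∞ := ne_top_of_le_ne_top hx hyT
        have hyT' := ENNReal.toReal_mono hx hyT
        have e3 : ENNReal.ofReal (Real.log M) * y a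
            = ENNReal.ofReal (Real.log M * (y a).toReal) := by
          rw [ENNReal.ofReal_mul (Real.log_nonneg hM), ENNReal.ofReal_toReal hyfin]
        rw [e3]
        unfold ePhi
        rw [← ENNReal.ofReal_add
          (phi_nonneg ENNReal.toReal_nonneg hyT') (mul_nonneg (Real.log_nonneg hM)
          ENNReal.toReal_nonneg), ENNReal.toReal_mul, ENNReal.toReal_ofReal hM0.le]
        apply ENNReal.ofReal_le_ofReal
        rcases (ENNReal.toReal_nonneg (a := y a)).eq_or_lt with h | h
        · simp [← h, phi]
        · have : 0 < T.toReal := h.trans_le hyT'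
          unfold phi
          rw [mul_div_assoc, Real.log_mul hM0.ne' (by positivity)]
          linarith
  calc ∑' i, ePhi (x i) T = ∑' i, ∑' a, D' i a * ePhi (x i) T := by
        refine tsum_congr fun i => ?_
        rw [ENNReal.tsum_mul_right]
        rcases eq_or_ne (x i) 0 with h | h
        · simp [h, ePhi_zero]
        · simp [hD', h, h1 i h]
    _ = ∑' a, ∑' i, D' i a * ePhi (x i) T := ENNReal.tsum_comm
    _ ≤ ∑' a, (ePhi (y a) T + ENNReal.ofReal (Real.log M) * y a) := ENNReal.tsum_le_tsum step
    _ = _ := by rw [ENNReal.tsum_add, ENNReal.tsum_mul_left, hy]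

/-- The Gibbs variational upper bound for the entropy. -/
theorem ent_le_gibbs {x : ι → ℝ≥0∞} (hx : ∑' i, x i ≠ ∞) {h : ι → ℝ} {c : ℝ}
    (hh : ∀ i, x i ≠ 0 → 0 ≤ h i) (hc : 0 ≤ c)
    (hZ : ∑' i, (if x i = 0 then 0 else ENNReal.ofReal (Real.exp (-h i)))
      ≤ ENNReal.ofReal (Real.exp c)) :
    ent x ≤ ∑' i, x i * ENNReal.ofReal (h i) + ENNReal.ofReal c * ∑' i, x i := by
  set T := ∑' i, x i with hT
  rw [ent_eq hx]
  have hpt : ∀ i, ePhi (x i) T + x i ≤ (x i * ENNReal.ofReal (h i) + ENNReal.ofReal c * x i)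
      + T * ENNReal.ofReal (Real.exp (-c)) *
        (if x i = 0 then 0 else ENNReal.ofReal (Real.exp (-h i))) := by
    intro i
    rcases eq_or_ne (x i) 0 with hi | hi
    · simp [hi, ePhi_zero]
    have hle : x i ≤ T := ENNReal.le_tsum i
    have hfin : x i ≠ ∞ := ne_top_of_le_ne_top hx hle
    have hle' := ENNReal.toReal_mono hx hle
    have hpos : 0 < (x i).toReal := ENNReal.toReal_pos hi hfin
    have hTpos : 0 < T.toReal := hpos.trans_le hle'
    have hhi := hh i hi
    rw [if_neg hi]
    have e1 : ePhi (x i) T + x i = ENNReal.ofReal (phi (x i).toReal T.toReal + (x i).toReal) := by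
      rw [ENNReal.ofReal_add (phi_nonneg hpos.le hle') hpos.le, ENNReal.ofReal_toReal hfin, ePhi]
    rw [e1]
    obtain ⟨a, ha⟩ : ∃ a, a = (x i).toReal := ⟨_, rfl⟩
    obtain ⟨t, ht⟩ : ∃ t, t = T.toReal := ⟨_, rfl⟩
    rw [← ha] at hpos hle' ⊢
    rw [← ht] at hTpos hle' ⊢
    rw [show x i = ENNReal.ofReal a by rw [ha, ENNReal.ofReal_toReal hfin],
      show T = ENNReal.ofReal t by rw [ht, ENNReal.ofReal_toReal hx],
      ← ENNReal.ofReal_mul hpos.le, ← ENNReal.ofReal_mul hc, ← ENNReal.ofReal_mul hTpos.le,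
      ← ENNReal.ofReal_mul (by positivity), ← ENNReal.ofReal_add (by positivity) (by positivity),
      ← ENNReal.ofReal_add (by positivity) (by positivity)]
    apply ENNReal.ofReal_le_ofReal
    have h1 := Real.log_le_sub_one_of_pos
      (show 0 < t * Real.exp (-c) * Real.exp (-h i) / a by positivity)
    have h2 : Real.log (t * Real.exp (-c) * Real.exp (-h i) / a) = Real.log (t / a) - c - h i := by
      rw [show t * Real.exp (-c) * Real.exp (-h i) / a = t / a * Real.exp (-c) * Real.exp (-h i) by
        ring, Real.log_mul (by positivity) (by positivity), Real.log_mul (by positivity)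
        (by positivity), Real.log_exp, Real.log_exp]
      ring
    rw [h2] at h1
    have h3 := mul_le_mul_of_nonneg_left h1 hpos.le
    have h4 : a * (t * Real.exp (-c) * Real.exp (-h i) / a - 1)
        = t * Real.exp (-c) * Real.exp (-h i) - a := by field_simp
    unfold phi
    nlinarith
  have hsum := ENNReal.tsum_le_tsum hpt
  rw [ENNReal.tsum_add, ENNReal.tsum_add, ENNReal.tsum_add, ENNReal.tsum_mul_left,
    ENNReal.tsum_mul_left, ← hT] at hsum
  have hlast : T * ENNReal.ofReal (Real.exp (-c)) *
      ∑' i, (if x i = 0 then 0 else ENNReal.ofReal (Real.exp (-h i))) ≤ T := by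
    calc _ ≤ T * ENNReal.ofReal (Real.exp (-c)) * ENNReal.ofReal (Real.exp c) := by gcongr
      _ = T := by
        rw [mul_assoc, ← ENNReal.ofReal_mul (Real.exp_pos _).le, ← Real.exp_add]; simp
  exact (ENNReal.add_le_add_iff_right hx).1 (hsum.trans (by gcongr))

/-- The chain rule for the entropy. -/
theorem ent_sigma {κ : ι → Type*} {x : (Σ i, κ i) → ℝ≥0∞} (hx : ∑' p, x p ≠ ∞) :
    ent x = ent (fun i => ∑' j, x ⟨i, j⟩) + ∑' i, ent (fun j => x ⟨i, j⟩) := by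
  have hs : ∑' p, x p = ∑' i, ∑' j, x ⟨i, j⟩ := ENNReal.tsum_sigma' x
  set T := ∑' p, x p with hT
  have hfin : ∑' i, ∑' j, x ⟨i, j⟩ ≠ ∞ := hs ▸ hx
  have hfin' : ∀ i, ∑' j, x ⟨i, j⟩ ≠ ∞ := fun i => ENNReal.ne_top_of_tsum_ne_top hfin i
  rw [ent_eq hx, ent_eq hfin, ← hT, ← hs, ENNReal.tsum_sigma', ← ENNReal.tsum_add]
  refine tsum_congr fun i => ?_
  rw [ent_eq (hfin' i)]
  set t := ∑' j, x ⟨i, j⟩ with ht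
  have htT : t ≤ T := by rw [hs]; exact ENNReal.le_tsum (f := fun i => ∑' j, x ⟨i, j⟩) i
  have htT' := ENNReal.toReal_mono hx htT
  have e : ePhi t T = ∑' j, x ⟨i, j⟩ * ENNReal.ofReal (Real.log (T.toReal / t.toReal)) := by
    rw [ENNReal.tsum_mul_right, ← ht]
    unfold ePhi phi
    rw [ENNReal.ofReal_mul ENNReal.toReal_nonneg, ENNReal.ofReal_toReal (hfin' i)]
  rw [e, ← ENNReal.tsum_add]
  refine tsum_congr fun j => ?_
  have hle : x ⟨i, j⟩ ≤ t := ENNReal.le_tsum (f := fun j => x ⟨i, j⟩) j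
  have hle' : (x ⟨i, j⟩).toReal ≤ t.toReal := ENNReal.toReal_mono (hfin' i) hle
  have hxfin : x ⟨i, j⟩ ≠ ∞ := ne_top_of_le_ne_top (hfin' i) hle
  rcases eq_or_ne (x ⟨i, j⟩) 0 with h | h
  · simp [h, ePhi_zero]
  have hpos := ENNReal.toReal_pos h hxfin
  have htpos : 0 < t.toReal := hpos.trans_le hle'
  have hTpos := htpos.trans_le htT'
  have hlog : 0 ≤ Real.log (T.toReal / t.toReal) := Real.log_nonneg ((one_le_div htpos).2 htT')
  have e1 : x ⟨i, j⟩ * ENNReal.ofReal (Real.log (T.toReal / t.toReal))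
      = ENNReal.ofReal ((x ⟨i, j⟩).toReal * Real.log (T.toReal / t.toReal)) := by
    rw [ENNReal.ofReal_mul hpos.le, ENNReal.ofReal_toReal hxfin]
  rw [e1]
  unfold ePhi
  rw [← ENNReal.ofReal_add (by positivity) (phi_nonneg hpos.le hle')]
  congr 1
  unfold phi
  rw [← mul_add, ← Real.log_mul (by positivity) (by positivity)]
  congr 2
  field_simp

theorem tsum_ent_le {x : ι → κ → ℝ≥0∞} (hx : ∑' i, ∑' j, x i j ≠ ∞) :
    ∑' i, ent (x i) ≤ ent (fun j => ∑' i, x i j) := by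
  have hfin' : ∀ i, ∑' j, x i j ≠ ∞ := fun i => ENNReal.ne_top_of_tsum_ne_top hx i
  have hc : ∑' j, ∑' i, x i j = ∑' i, ∑' j, x i j := ENNReal.tsum_comm
  rw [ent_eq (by rwa [hc]), hc, tsum_congr fun i => ent_eq (hfin' i), ENNReal.tsum_comm]
  exact ENNReal.tsum_le_tsum fun j => tsum_ePhi_le (fun i => ENNReal.le_tsum j) hx

/-- Subadditivity of the entropy of a joint distribution. -/
theorem ent_sigma_le {x : (Σ _ : ι, κ) → ℝ≥0∞} (hx : ∑' p, x p ≠ ∞) :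
    ent x ≤ ent (fun i => ∑' j, x ⟨i, j⟩) + ent (fun j => ∑' i, x ⟨i, j⟩) := by
  rw [ent_sigma hx]
  gcongr
  rw [ENNReal.tsum_sigma' x] at hx
  exact tsum_ent_le hx

/-- A family with at most `n` nonzero members has entropy at most `log n` times its mass. -/
theorem ent_le_log_card {x : ι → ℝ≥0∞} (hx : ∑' i, x i ≠ ∞) (s : Finset ι) {n : ℕ} (hn : s.card ≤ n)
    (hs : ∀ i, i ∉ s → x i = 0) : ent x ≤ ENNReal.ofReal (Real.log n) * ∑' i, x i := by
  rcases Nat.eq_zero_or_pos n with rfl | hn0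
  · have h0 : s = ∅ := Finset.card_eq_zero.1 (by omega)
    have : ∀ i, x i = 0 := fun i => hs i (by simp [h0])
    rw [ent_eq hx]
    simp [this, ePhi_zero]
  have := ent_le_gibbs hx (h := fun _ => 0) (c := Real.log n) (fun _ _ => le_rfl)
    (Real.log_natCast_nonneg n) ?_
  · simpa using this
  · rw [tsum_eq_sum (s := s) (fun i hi => by simp [hs i hi]), Real.exp_log (by exact_mod_cast hn0)]
    calc _ ≤ ∑ i ∈ s, (1 : ℝ≥0∞) := by
          refine Finset.sum_le_sum fun i _ => ?_
          split_ifs <;> simp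
      _ ≤ _ := by simpa using hn

/-- The entropy of a two-point family is small if one of the two masses is small. -/
theorem ent_pair_le {x : Bool → ℝ≥0∞} {a b : ℝ} (ha : x false ≤ ENNReal.ofReal a)
    (hb : x true ≤ ENNReal.ofReal b) (ha0 : 0 ≤ a) (hb0 : 0 ≤ b) :
    ent x ≤ ENNReal.ofReal (b + 2 * √(a * b)) := by
  set y : Bool → ℝ≥0∞ := fun i => if i then ENNReal.ofReal b else ENNReal.ofReal a with hy
  have hsum : ∑' i, y i = ENNReal.ofReal (a + b) := by
    rw [tsum_bool]; simp [hy, ENNReal.ofReal_add ha0 hb0]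
  have hxy : ∀ i, x i ≤ y i := by
    intro i; cases i
    · simpa [hy] using ha
    · simpa [hy] using hb
  refine (ent_mono hxy (by rw [hsum]; exact ENNReal.ofReal_ne_top)).trans ?_
  rw [ent_eq (by rw [hsum]; exact ENNReal.ofReal_ne_top), hsum, tsum_bool]
  simp only [hy, ePhi, Bool.false_eq_true, if_false, if_true]
  rw [ENNReal.toReal_ofReal ha0, ENNReal.toReal_ofReal hb0, ENNReal.toReal_ofReal (by linarith),
    ← ENNReal.ofReal_add (phi_nonneg ha0 (by linarith)) (phi_nonneg hb0 (by linarith))]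
  apply ENNReal.ofReal_le_ofReal
  have h1 : phi a (a + b) ≤ b := by
    rcases ha0.eq_or_lt with rfl | h
    · simpa [phi] using hb0
    · have := Real.log_le_sub_one_of_pos (show 0 < (a + b) / a by positivity)
      calc a * Real.log ((a + b) / a) ≤ a * ((a + b) / a - 1) := by gcongr
        _ = b := by field_simp; ring
  have h2 : phi b (a + b) ≤ 2 * √(a * b) := by
    rcases hb0.eq_or_lt with rfl | h
    · simp [phi]
    · have hq : 0 ≤ a / b := by positivity
      have e1 : (a + b) / b ≤ (1 + √(a / b)) ^ 2 := by
        have : (1 + √(a / b)) ^ 2 = 1 + 2 * √(a / b) + a / b := by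
          rw [add_sq, Real.sq_sqrt hq]; ring
        rw [this, add_div, div_self h.ne']
        have := Real.sqrt_nonneg (a / b)
        linarith
      have e2 : Real.log ((a + b) / b) ≤ 2 * √(a / b) := by
        calc _ ≤ Real.log ((1 + √(a / b)) ^ 2) := Real.log_le_log (by positivity) e1
          _ = 2 * Real.log (1 + √(a / b)) := by rw [Real.log_pow]; norm_cast
          _ ≤ 2 * √(a / b) := by
            have := Real.log_le_sub_one_of_pos (show 0 < 1 + √(a / b) by positivity)
            linarith
      calc b * Real.log ((a + b) / b) ≤ b * (2 * √(a / b)) := by gcongr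
        _ = 2 * √(a * b) := by
          rw [show a * b = (a / b) * b ^ 2 by field_simp, Real.sqrt_mul hq, Real.sqrt_sq h.le]; ring
  linarith

/-- Dominated convergence to zero for the entropy. -/
theorem tendsto_ent_zero {β : Type*} {l : Filter β} {x : ι → ℝ≥0∞} (hx : ∑' i, x i ≠ ∞)
    (hH : ent x ≠ ∞) {y : β → ι → ℝ≥0∞} (hyx : ∀ b i, y b i ≤ x i)
    (hy : ∀ i, Tendsto (fun b => y b i) l (𝓝 0)) : Tendsto (fun b => ent (y b)) l (𝓝 0) := by
  set T := ∑' i, x i with hT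
  set h : ι → ℝ := fun i => Real.log (T.toReal / (x i).toReal) with hh
  have hxfin : ∀ i, x i ≠ ∞ := fun i => ENNReal.ne_top_of_tsum_ne_top hx i
  have hHe : ent x = ∑' i, x i * ENNReal.ofReal (h i) := by
    rw [ent_eq hx]
    refine tsum_congr fun i => ?_
    unfold ePhi phi
    rw [ENNReal.ofReal_mul ENNReal.toReal_nonneg, ENNReal.ofReal_toReal (hxfin i)]
  have hbound : ∀ b, ent (y b) ≤ ∑' i, y b i * ENNReal.ofReal (h i) := by
    intro b
    have hyfin : ∑' i, y b i ≠ ∞ := ne_top_of_le_ne_top hx (ENNReal.tsum_le_tsum (hyx b))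
    have hpos : ∀ i, y b i ≠ 0 → 0 < (x i).toReal := fun i hi =>
      ENNReal.toReal_pos (fun h0 => hi (le_antisymm (h0 ▸ hyx b i) zero_le)) (hxfin i)
    have hle : ∀ i, (x i).toReal ≤ T.toReal := fun i => ENNReal.toReal_mono hx (ENNReal.le_tsum i)
    have := ent_le_gibbs hyfin (h := h) (c := 0)
      (fun i hi => Real.log_nonneg ((one_le_div (hpos i hi)).2 (hle i))) le_rfl ?_
    · simpa using this
    · rw [Real.exp_zero, ENNReal.ofReal_one]
      calc _ ≤ ∑' i, x i * T⁻¹ := by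
            refine ENNReal.tsum_le_tsum fun i => ?_
            split_ifs with hi
            · simp
            · have h1 := hpos i hi
              have h2 := h1.trans_le (hle i)
              rw [hh, ← Real.log_inv, inv_div, Real.exp_log (by positivity),
                ENNReal.ofReal_div_of_pos h2, ENNReal.ofReal_toReal (hxfin i),
                ENNReal.ofReal_toReal hx, div_eq_mul_inv]
        _ ≤ 1 := by
          rw [ENNReal.tsum_mul_right, ← hT, ← div_eq_mul_inv]
          exact ENNReal.div_self_le_one
  refine tendsto_of_tendsto_of_tendsto_of_le_of_le tendsto_const_nhds ?_ (fun b => zero_le) hbound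
  have hfin : ∑' i, x i * ENNReal.ofReal (h i) ≠ ∞ := hHe ▸ hH
  have hfin' : ∀ i, x i * ENNReal.ofReal (h i) ≠ ∞ :=
    fun i => ENNReal.ne_top_of_tsum_ne_top hfin i
  have hyle : ∀ b i, y b i * ENNReal.ofReal (h i) ≤ x i * ENNReal.ofReal (h i) := fun b i => by
    gcongr; exact hyx b i
  have hyfin : ∀ b i, y b i * ENNReal.ofReal (h i) ≠ ∞ := fun b i =>
    ne_top_of_le_ne_top (hfin' i) (hyle b i)
  have key : Tendsto (fun b => ∑' i, (y b i * ENNReal.ofReal (h i)).toReal) l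
      (𝓝 (∑' _ : ι, (0 : ℝ))) := by
    refine tendsto_tsum_of_dominated_convergence
      (bound := fun i => (x i * ENNReal.ofReal (h i)).toReal) (ENNReal.summable_toReal hfin) ?_ ?_
    · intro i
      have : Tendsto (fun b => y b i * ENNReal.ofReal (h i)) l (𝓝 (0 * ENNReal.ofReal (h i))) :=
        ENNReal.Tendsto.mul_const (hy i) (Or.inr ENNReal.ofReal_ne_top)
      rw [zero_mul] at this
      have h2 := (ENNReal.tendsto_toReal ENNReal.zero_ne_top).comp this
      rw [ENNReal.toReal_zero] at h2
      exact h2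
    · refine Eventually.of_forall fun b i => ?_
      rw [Real.norm_of_nonneg ENNReal.toReal_nonneg]
      exact ENNReal.toReal_mono (hfin' i) (hyle b i)
  rw [tsum_zero] at key
  have h2 := (ENNReal.continuous_ofReal.tendsto 0).comp key
  rw [ENNReal.ofReal_zero] at h2
  refine h2.congr fun b => ?_
  simp only [Function.comp]
  rw [← ENNReal.tsum_toReal_eq (hyfin b), ENNReal.ofReal_toReal
    (ne_top_of_le_ne_top hfin (ENNReal.tsum_le_tsum (hyle b)))]

end Classical

section Operators

open ContinuousLinearMap (adjoint)

variable {E F ι κ : Type*}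
variable [NormedAddCommGroup E] [InnerProductSpace ℂ E]
variable [NormedAddCommGroup F] [InnerProductSpace ℂ F]

/-- The squared modulus of the inner product. -/
def ip (x y : E) : ℝ≥0∞ := ‖(inner ℂ x y : ℂ)‖ₑ ^ 2

/-- The squared norm. -/
def nsq (x : E) : ℝ≥0∞ := ‖x‖ₑ ^ 2

theorem ip_eq (x y : E) : ip x y = ENNReal.ofReal (‖(inner ℂ x y : ℂ)‖ ^ 2) := by
  rw [ip, ← ofReal_norm, ENNReal.ofReal_pow (norm_nonneg _)]

theorem nsq_eq (x : E) : nsq x = ENNReal.ofReal (‖x‖ ^ 2) := by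
  rw [nsq, ← ofReal_norm, ENNReal.ofReal_pow (norm_nonneg _)]

theorem nsq_ne_top (x : E) : nsq x ≠ ∞ := by rw [nsq_eq]; exact ENNReal.ofReal_ne_top

theorem nsq_eq_zero {x : E} : nsq x = 0 ↔ x = 0 := by simp [nsq]

theorem ip_comm (x y : E) : ip x y = ip y x := by
  rw [ip_eq, ip_eq, norm_inner_symm]

theorem ip_le (x y : E) : ip x y ≤ nsq x * nsq y := by
  rw [ip_eq, nsq_eq, nsq_eq, ← ENNReal.ofReal_mul (by positivity)]
  apply ENNReal.ofReal_le_ofReal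
  rw [← mul_pow]
  gcongr
  exact norm_inner_le_norm x y

theorem nsq_smul (c : ℂ) (x : E) : nsq (c • x) = ENNReal.ofReal (‖c‖ ^ 2) * nsq x := by
  rw [nsq_eq, nsq_eq, norm_smul, mul_pow, ENNReal.ofReal_mul (by positivity)]

theorem ip_smul_right (c : ℂ) (x y : E) : ip x (c • y) = ENNReal.ofReal (‖c‖ ^ 2) * ip x y := by
  rw [ip_eq, ip_eq, inner_smul_right, norm_mul, mul_pow, ENNReal.ofReal_mul (by positivity)]

theorem ip_smul_left (c : ℂ) (x y : E) : ip (c • x) y = ENNReal.ofReal (‖c‖ ^ 2) * ip x y := by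
  rw [ip_comm, ip_smul_right, ip_comm]

theorem parseval (b : HilbertBasis ι ℂ E) (x : E) : ∑' i, ip (b i) x = nsq x := by
  have h := b.hasSum_inner_mul_inner x x
  have h2 : HasSum (fun i => ‖(inner ℂ (b i) x : ℂ)‖ ^ 2) (‖x‖ ^ 2) := by
    rw [← Complex.hasSum_ofReal]
    have e1 : (fun i => ((‖(inner ℂ (b i) x : ℂ)‖ ^ 2 : ℝ) : ℂ))
        = fun i => inner ℂ x (b i) * inner ℂ (b i) x := by
      funext i
      rw [← inner_conj_symm x (b i), ← Complex.normSq_eq_conj_mul_self, Complex.normSq_eq_norm_sq]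
    have e2 : ((‖x‖ ^ 2 : ℝ) : ℂ) = inner ℂ x x := by
      rw [inner_self_eq_norm_sq_to_K]; push_cast; rfl
    rw [e1, e2]
    exact h
  simp_rw [ip_eq]
  rw [nsq_eq, ← h2.tsum_eq, ENNReal.ofReal_tsum_of_nonneg (fun _ => by positivity) h2.summable]

theorem bessel {e : ι → E} (he : Orthonormal ℂ e) (x : E) : ∑' i, ip (e i) x ≤ nsq x := by
  simp_rw [ip_eq]
  rw [nsq_eq, ← ENNReal.ofReal_tsum_of_nonneg (fun _ => by positivity)
    (he.inner_products_summable x)]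
  exact ENNReal.ofReal_le_ofReal (he.tsum_inner_products_le x)

theorem qf_nonneg {A : E →L[ℂ] E} (hA : A.IsPositive) (x : E) : 0 ≤ qf A x := by
  have := hA.2 x
  rwa [ContinuousLinearMap.reApplyInnerSelf_apply, inner_re_symm] at this

theorem qf_add (A B : E →L[ℂ] E) (x : E) : qf (A + B) x = qf A x + qf B x := by
  simp [qf]

theorem qf_sub (A B : E →L[ℂ] E) (x : E) : qf (A - B) x = qf A x - qf B x := by
  simp [qf]

theorem qf_smul (c : ℝ) (A : E →L[ℂ] E) (x : E) : qf ((c : ℂ) • A) x = c * qf A x := by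
  simp [qf]

theorem qf_smul_right (A : E →L[ℂ] E) (c : ℂ) (x : E) : qf A (c • x) = ‖c‖ ^ 2 * qf A x := by
  unfold qf
  rw [map_smul, inner_smul_left, inner_smul_right, ← mul_assoc, ← Complex.normSq_eq_conj_mul_self,
    Complex.re_ofReal_mul, Complex.normSq_eq_norm_sq]

theorem qf_one (x : E) : qf (1 : E →L[ℂ] E) x = ‖x‖ ^ 2 := by
  unfold qf
  rw [one_apply_eq_self, inner_self_eq_norm_sq_to_K]
  norm_cast

theorem qf_le (A : E →L[ℂ] E) (x : E) : qf A x ≤ ‖A‖ * ‖x‖ ^ 2 := by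
  calc qf A x ≤ ‖(inner ℂ x (A x) : ℂ)‖ := Complex.re_le_norm _
    _ ≤ ‖x‖ * ‖A x‖ := norm_inner_le_norm _ _
    _ ≤ ‖x‖ * (‖A‖ * ‖x‖) := by gcongr; exact A.le_opNorm x
    _ = _ := by ring

theorem inner_eq_zero_of_qf {A : E →L[ℂ] E} (hA : A.IsPositive) (x y : E) :
    (inner ℂ x (A y) : ℂ) = inner ℂ (A x) y := (hA.1 x y).symm

theorem inner_self_eq_qf {A : E →L[ℂ] E} (hA : A.IsPositive) (x : E) :
    (inner ℂ x (A x) : ℂ) = qf A x := by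
  have h : (starRingEnd ℂ) (inner ℂ x (A x) : ℂ) = inner ℂ x (A x) := by
    rw [inner_conj_symm]; exact hA.1 x x
  exact (Complex.conj_eq_iff_re.1 h).symm

variable [CompleteSpace E] [CompleteSpace F]

theorem ip_adjoint_left (V : E →L[ℂ] F) (f : F) (x : E) : ip (adjoint V f) x = ip f (V x) := by
  rw [ip, ip, ContinuousLinearMap.adjoint_inner_left]

theorem ip_adjoint_right (V : E →L[ℂ] F) (f : F) (x : E) : ip x (adjoint V f) = ip (V x) f := by
  rw [ip, ip, ContinuousLinearMap.adjoint_inner_right]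

theorem qf_conj (V : E →L[ℂ] F) (A : E →L[ℂ] E) (f : F) :
    qf (V ∘L A ∘L adjoint V) f = qf A (adjoint V f) := by
  simp [qf, ContinuousLinearMap.adjoint_inner_left]

theorem qf_adjoint_comp_self (V : E →L[ℂ] F) (x : E) : qf (adjoint V ∘L V) x = ‖V x‖ ^ 2 := by
  unfold qf
  rw [ContinuousLinearMap.comp_apply, ContinuousLinearMap.adjoint_inner_right,
    inner_self_eq_norm_sq_to_K]
  norm_cast

/-- A positive operator has a self-adjoint square root. -/
theorem exists_sqrt {A : E →L[ℂ] E} (hA : A.IsPositive) :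
    ∃ R : E →L[ℂ] E, R.IsPositive ∧ R ∘L R = A ∧ adjoint R = R := by
  have h0 : 0 ≤ A := (ContinuousLinearMap.nonneg_iff_isPositive A).2 hA
  have hR := (ContinuousLinearMap.nonneg_iff_isPositive _).1 (CFC.sqrt_nonneg A)
  exact ⟨CFC.sqrt A, hR, CFC.sqrt_mul_sqrt_self A h0,
    ContinuousLinearMap.isSelfAdjoint_iff'.1 hR.isSelfAdjoint⟩

theorem qf_eq_norm_sqrt {R : E →L[ℂ] E} (hR : adjoint R = R) (x : E) :
    qf (R ∘L R) x = ‖R x‖ ^ 2 := by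
  have := qf_adjoint_comp_self R x
  rwa [hR] at this

/-- `A = ∑ₐ |y a⟩⟨y a|` as quadratic forms. -/
structure Rep (A : E →L[ℂ] E) (y : ι → E) : Prop where
  pos : A.IsPositive
  eq : ∀ f, ENNReal.ofReal (qf A f) = ∑' a, ip (y a) f

theorem Rep.of_sqrt {R : E →L[ℂ] E} (hR : adjoint R = R) (hp : (R ∘L R).IsPositive)
    (b : HilbertBasis ι ℂ E) : Rep (R ∘L R) (fun i => R (b i)) := by
  refine ⟨hp, fun f => ?_⟩
  rw [qf_eq_norm_sqrt hR, ← nsq_eq, ← parseval b]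
  refine tsum_congr fun i => ?_
  rw [← ip_adjoint_left, hR]

theorem exists_rep {A : E →L[ℂ] E} (hA : A.IsPositive) :
    ∃ (s : Set E) (y : s → E), Rep A y := by
  obtain ⟨R, -, rfl, hR⟩ := exists_sqrt hA
  obtain ⟨w, b, -⟩ := exists_hilbertBasis ℂ E
  exact ⟨w, _, Rep.of_sqrt hR hA b⟩

theorem Rep.tsum_basis {A : E →L[ℂ] E} {y : ι → E} (h : Rep A y) (b : HilbertBasis κ ℂ E) :
    ∑' k, ENNReal.ofReal (qf A (b k)) = ∑' a, nsq (y a) := by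
  simp_rw [h.eq]
  rw [ENNReal.tsum_comm]
  refine tsum_congr fun a => ?_
  rw [← parseval b]
  exact tsum_congr fun k => ip_comm _ _

theorem Rep.trace {A : E →L[ℂ] E} {y : ι → E} (h : Rep A y) : traceENN A = ∑' a, nsq (y a) := by
  apply le_antisymm
  · refine iSup_le fun n => iSup_le fun e => iSup_le fun he => ?_
    simp_rw [h.eq]
    rw [← Summable.tsum_finsetSum (fun _ _ => ENNReal.summable)]
    refine ENNReal.tsum_le_tsum fun a => ?_
    simp_rw [ip_comm (y a)]
    rw [← tsum_fintype (L := SummationFilter.unconditional _)]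
    exact bessel he (y a)
  · obtain ⟨w, b, -⟩ := exists_hilbertBasis ℂ E
    rw [← h.tsum_basis b, ENNReal.tsum_eq_iSup_sum]
    refine iSup_le fun s => ?_
    let φ := s.equivFin
    have ho : Orthonormal ℂ (fun i : Fin s.card => b (φ.symm i)) :=
      b.orthonormal.comp _ (Subtype.val_injective.comp φ.symm.injective)
    refine le_trans ?_ (le_iSup_of_le s.card (le_iSup_of_le _ (le_iSup_of_le ho le_rfl)))
    rw [Equiv.sum_comp φ.symm (fun i : s => ENNReal.ofReal (qf A (b i))),
      Finset.sum_coe_sort s (fun i => ENNReal.ofReal (qf A (b i)))]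

theorem trace_eq {A : E →L[ℂ] E} (hA : A.IsPositive) (b : HilbertBasis κ ℂ E) :
    traceENN A = ∑' k, ENNReal.ofReal (qf A (b k)) := by
  obtain ⟨s, y, h⟩ := exists_rep hA
  rw [h.trace, h.tsum_basis b]

theorem sum_qf_le_trace {A : E →L[ℂ] E} {n : ℕ} {e : Fin n → E} (he : Orthonormal ℂ e) :
    ∑ i, ENNReal.ofReal (qf A (e i)) ≤ traceENN A :=
  le_iSup_of_le n (le_iSup_of_le e (le_iSup_of_le he le_rfl))

theorem norm_sq_le_qf {A : E →L[ℂ] E} (hA : A.IsPositive) :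
    ∃ K : ℝ, 0 ≤ K ∧ ∀ x, ‖A x‖ ^ 2 ≤ K * qf A x := by
  obtain ⟨R, -, rfl, hR⟩ := exists_sqrt hA
  refine ⟨‖R‖ ^ 2, by positivity, fun x => ?_⟩
  rw [qf_eq_norm_sqrt hR, ← mul_pow]
  gcongr
  exact R.le_opNorm _

end Operators

section Spectral

open ContinuousLinearMap (adjoint)

variable {E F ι κ : Type*}
variable [NormedAddCommGroup E] [InnerProductSpace ℂ E] [CompleteSpace E]
variable [NormedAddCommGroup F] [InnerProductSpace ℂ F] [CompleteSpace F]

/-- A positive operator is compact if, for every `ε > 0`, the size of the orthonormal families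
which diagonalize it with diagonal at least `ε` is bounded. -/
theorem isCompactOperator_of_bounded_families {A : E →L[ℂ] E} (hA : A.IsPositive)
    (h : ∀ ε : ℝ, 0 < ε → ∃ N : ℕ, ∀ (n : ℕ) (e : Fin n → E), Orthonormal ℂ e →
      (∀ i j, i ≠ j → (inner ℂ (e i) (A (e j)) : ℂ) = 0) → (∀ i, ε ≤ qf A (e i)) → n ≤ N) :
    IsCompactOperator A := by
  obtain ⟨K, hK0, hK⟩ := norm_sq_le_qf hA
  have hcl := isClosed_setOfPred_isCompactOperator (σ₁₂ := RingHom.id ℂ) (M₁ := E) (M₂ := E)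
  suffices A ∈ closure {f : E →L[ℂ] E | IsCompactOperator f} by rwa [hcl.closure_eq] at this
  refine Metric.mem_closure_iff.2 fun δ hδ => ?_
  set ε : ℝ := (δ / 2) ^ 2 / (K + 1) with hε
  have hε0 : 0 < ε := by positivity
  obtain ⟨N, hN⟩ := h ε hε0
  let P : ℕ → Prop := fun n => ∃ e : Fin n → E, Orthonormal ℂ e ∧
      (∀ i j, i ≠ j → (inner ℂ (e i) (A (e j)) : ℂ) = 0) ∧ (∀ i, ε ≤ qf A (e i))
  have hP0 : P 0 := ⟨Fin.elim0, ⟨fun i => i.elim0, fun i => i.elim0⟩, fun i => i.elim0,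
    fun i => i.elim0⟩
  set n := Nat.findGreatest P N with hn
  have hPn : P n := Nat.findGreatest_spec (Nat.zero_le N) hP0
  have hPn1 : ¬ P (n + 1) := by
    intro hP
    obtain ⟨e, h1, h2, h3⟩ := hP
    have := Nat.le_findGreatest (hN _ e h1 h2 h3) (show P (n + 1) from ⟨e, h1, h2, h3⟩)
    omega
  obtain ⟨e, he1, he2, he3⟩ := hPn
  let U : Submodule ℂ E := Submodule.span ℂ (Set.range e ∪ Set.range fun i => A (e i))
  have : FiniteDimensional ℂ U :=
    FiniteDimensional.span_of_finite ℂ ((Set.finite_range _).union (Set.finite_range _))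
  have hU : ∀ x ∈ Uᗮ, qf A x ≤ ε * ‖x‖ ^ 2 := by
    intro x hx
    by_contra! hlt
    have hx0 : x ≠ 0 := by rintro rfl; simp [qf] at hlt
    have hxe : ∀ i, (inner ℂ (e i) x : ℂ) = 0 := fun i =>
      (Submodule.mem_orthogonal _ _).1 hx _ (Submodule.subset_span (Or.inl ⟨i, rfl⟩))
    have hxA : ∀ i, (inner ℂ (A (e i)) x : ℂ) = 0 := fun i =>
      (Submodule.mem_orthogonal _ _).1 hx _ (Submodule.subset_span (Or.inr ⟨i, rfl⟩))
    have hnx : 0 < ‖x‖ := norm_pos_iff.2 hx0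
    set u : E := ((‖x‖⁻¹ : ℝ) : ℂ) • x with hu
    have hun : ‖u‖ = 1 := by
      rw [hu, norm_smul, Complex.norm_real, Real.norm_of_nonneg (by positivity)]
      field_simp
    have hue : ∀ i, (inner ℂ (e i) u : ℂ) = 0 := fun i => by
      rw [hu, inner_smul_right, hxe, mul_zero]
    have hue' : ∀ i, (inner ℂ u (e i) : ℂ) = 0 := fun i => inner_eq_zero_symm.1 (hue i)
    have huA : ∀ i, (inner ℂ (e i) (A u) : ℂ) = 0 := fun i => by
      rw [inner_eq_zero_of_qf hA, hu, inner_smul_right, hxA, mul_zero]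
    have huA' : ∀ i, (inner ℂ u (A (e i)) : ℂ) = 0 := fun i => by
      rw [inner_eq_zero_of_qf hA]; exact inner_eq_zero_symm.1 (huA i)
    refine hPn1 ⟨Fin.cons u e, ⟨?_, ?_⟩, ?_, ?_⟩
    · refine Fin.cases ?_ fun i => ?_
      · simpa using hun
      · simpa using he1.1 i
    · intro i j
      refine Fin.cases ?_ (fun i => ?_) i <;> refine Fin.cases ?_ (fun j => ?_) j
      · simp
      · intro _; simpa using hue' j
      · intro _; simpa using hue i
      · intro hij; simpa using he1.2 (fun h => hij (by rw [h]))
    · intro i j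
      refine Fin.cases ?_ (fun i => ?_) i <;> refine Fin.cases ?_ (fun j => ?_) j
      · simp
      · intro _; simpa using huA' j
      · intro _; simpa using huA i
      · intro hij; simpa using he2 i j (fun h => hij (by rw [h]))
    · refine Fin.cases ?_ fun i => ?_
      · simp only [Fin.cons_zero]
        rw [hu, qf_smul_right, Complex.norm_real, Real.norm_of_nonneg (by positivity), inv_pow,
          inv_mul_eq_div, le_div_iff₀ (by positivity)]
        exact hlt.le
      · simpa using he3 i
  refine ⟨A ∘L U.starProjection, ?_, ?_⟩
  · exact (isCompactOperator_of_locallyCompactSpace_dom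
      (U.orthogonalProjectionOnto)).clm_comp (A ∘L U.subtypeL)
  · rw [dist_eq_norm]
    refine lt_of_le_of_lt (ContinuousLinearMap.opNorm_le_bound _ (by positivity : 0 ≤ δ / 2)
      fun x => ?_) (by linarith)
    set z := x - U.starProjection x with hz
    have hzx : ‖z‖ ≤ ‖x‖ := by
      rw [hz, ← Submodule.starProjection_orthogonal_val]
      exact Submodule.norm_starProjection_apply_le _ _
    have e1 : (A - A ∘L U.starProjection) x = A z := by simp [hz]
    rw [e1]
    refine le_of_sq_le_sq ?_ (by positivity)
    calc ‖A z‖ ^ 2 ≤ K * qf A z := hK z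
      _ ≤ K * (ε * ‖z‖ ^ 2) := by
        gcongr; exact hU z (Submodule.sub_starProjection_mem_orthogonal x)
      _ ≤ (K + 1) * (ε * ‖x‖ ^ 2) := by gcongr; linarith
      _ = (δ / 2 * ‖x‖) ^ 2 := by rw [hε]; field_simp

theorem exists_set_hilbertBasis (b : HilbertBasis ι ℂ E) :
    ∃ (s : Set E) (c : HilbertBasis s ℂ E), (∀ i, c i = i) ∧ s = Set.range b := by
  have ho : Orthonormal ℂ ((↑) : Set.range b → E) := b.orthonormal.toSubtypeRange
  refine ⟨Set.range b, HilbertBasis.mk ho ?_, fun i => by rw [HilbertBasis.coe_mk], rfl⟩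
  rw [Subtype.range_coe, b.dense_span]

/-- A compact positive operator has an orthonormal eigenbasis. -/
theorem exists_eigenbasis {A : E →L[ℂ] E} (hA : A.IsPositive) (hc : IsCompactOperator A) :
    ∃ (s : Set E) (b : HilbertBasis s ℂ E), ∀ i, A (b i) = (qf A (b i) : ℂ) • b i := by
  have hsymm : (A : E →ₗ[ℂ] E).IsSymmetric := hA.1
  let G : ℂ → Submodule ℂ E := fun μ => Module.End.eigenspace (A : E →ₗ[ℂ] E) μ
  have hG : ∀ μ x, x ∈ G μ ↔ A x = μ • x := fun μ x => Module.End.mem_eigenspace_iff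
  have : ∀ μ, CompleteSpace (G μ) := fun μ => by
    have : IsClosed (G μ : Set E) := by
      have e : (G μ : Set E) = {x | A x = μ • x} := by ext x; exact hG μ x
      rw [e]
      exact isClosed_eq A.continuous (continuous_const_smul μ)
    exact this.completeSpace_coe
  choose w b hb using fun μ => exists_hilbertBasis ℂ (G μ)
  have ho : Orthonormal ℂ (fun a : Σ μ, w μ => ((b a.1 a.2 : G a.1) : E)) :=
    hsymm.orthogonalFamily_eigenspaces.orthonormal_sigma_orthonormal
      (fun μ => (b μ).orthonormal)
  have hbot : (Submodule.span ℂ (Set.range fun a : Σ μ, w μ => ((b a.1 a.2 : G a.1) : E)))ᗮ =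
      ⊥ := by
    rw [eq_bot_iff, ← ContinuousLinearMap.orthogonalComplement_iSup_eigenspaces_eq_bot hc hsymm]
    intro x hx
    rw [← Submodule.iInf_orthogonal, Submodule.mem_iInf]
    intro μ
    rw [Submodule.mem_orthogonal']
    intro y hy
    have hs := (b μ).hasSum_repr ⟨y, hy⟩
    have hs2 := hs.mapL ((innerSL ℂ x) ∘L (G μ).subtypeL)
    have h0 : ∀ i, (innerSL ℂ x ∘L (G μ).subtypeL) ((b μ).repr ⟨y, hy⟩ i • b μ i) = 0 := by
      intro i
      have : (inner ℂ x (b μ i : E) : ℂ) = 0 :=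
        (Submodule.mem_orthogonal' _ _).1 hx _ (Submodule.subset_span ⟨⟨μ, i⟩, rfl⟩)
      rw [map_smul]
      simp [this]
    simp only [h0] at hs2
    exact hs2.unique hasSum_zero
  obtain ⟨s, c, hcs, hs⟩ := exists_set_hilbertBasis (HilbertBasis.mkOfOrthogonalEqBot ho hbot)
  refine ⟨s, c, fun i => ?_⟩
  have hi : (i : E) ∈ Set.range (HilbertBasis.mkOfOrthogonalEqBot ho hbot) := hs ▸ i.2
  rw [HilbertBasis.coe_mkOfOrthogonalEqBot] at hi
  obtain ⟨⟨μ, j⟩, hj⟩ := hi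
  have hμ : A (c i) = μ • c i := by
    rw [hcs, ← hj]
    exact (hG μ _).1 (b μ j).2
  have h2 := inner_self_eq_qf hA (c i)
  rw [hμ, inner_smul_right, inner_self_eq_norm_sq_to_K, c.orthonormal.1 i] at h2
  rw [hμ, ← h2]
  simp

theorem isCompactOperator_of_trace {A : E →L[ℂ] E} (hA : A.IsPositive) (ht : traceENN A ≠ ∞) :
    IsCompactOperator A := by
  refine isCompactOperator_of_bounded_families hA fun ε hε => ?_
  obtain ⟨N, hN⟩ := exists_nat_ge ((traceENN A).toReal / ε)
  refine ⟨N, fun n e he _ hge => ?_⟩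
  have h1 : ENNReal.ofReal (n * ε) ≤ traceENN A := by
    refine le_trans ?_ (sum_qf_le_trace he)
    calc ENNReal.ofReal (n * ε) = ∑ _i : Fin n, ENNReal.ofReal ε := by
          simp [ENNReal.ofReal_mul]
      _ ≤ _ := Finset.sum_le_sum fun i _ => ENNReal.ofReal_le_ofReal (hge i)
  rw [ENNReal.ofReal_le_iff_le_toReal ht, ← le_div_iff₀ hε] at h1
  exact_mod_cast h1.trans hN

/-- A positive trace-class operator is a sum of rank-one operators of orthogonal vectors. -/
theorem exists_orthogonal_rep {A : E →L[ℂ] E} (hA : A.IsPositive) (ht : traceENN A ≠ ∞) :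
    ∃ (s : Set E) (b : HilbertBasis s ℂ E), (∀ i, A (b i) = (qf A (b i) : ℂ) • b i) ∧
      Rep A (fun i => ((√(qf A (b i)) : ℝ) : ℂ) • b i) := by
  obtain ⟨s, b, hb⟩ := exists_eigenbasis hA (isCompactOperator_of_trace hA ht)
  obtain ⟨R, hRp, hRR, hR⟩ := exists_sqrt hA
  refine ⟨s, b, hb, hA, fun f => ?_⟩
  have h1 : ENNReal.ofReal (qf A f) = ∑' i, ENNReal.ofReal (qf A (b i)) * ip (b i) f := by
    have hs : HasSum (fun i => (inner ℂ f (b i) : ℂ) * inner ℂ (b i) (A f)) (inner ℂ f (A f)) :=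
      b.hasSum_inner_mul_inner f (A f)
    have e : ∀ i, (inner ℂ f (b i) : ℂ) * inner ℂ (b i) (A f)
        = ((qf A (b i) * ‖(inner ℂ (b i) f : ℂ)‖ ^ 2 : ℝ) : ℂ) := by
      intro i
      rw [inner_eq_zero_of_qf hA, hb i, inner_smul_left, Complex.conj_ofReal,
        ← inner_conj_symm f (b i), mul_left_comm, ← Complex.normSq_eq_conj_mul_self,
        Complex.normSq_eq_norm_sq]
      push_cast; rfl
    simp only [e, inner_self_eq_qf hA] at hs
    rw [Complex.hasSum_ofReal] at hs
    rw [← hs.tsum_eq, ENNReal.ofReal_tsum_of_nonneg _ hs.summable]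
    · refine tsum_congr fun i => ?_
      rw [ENNReal.ofReal_mul (qf_nonneg hA _), ip_eq]
    · exact fun i => mul_nonneg (qf_nonneg hA _) (by positivity)
  rw [h1]
  refine tsum_congr fun i => ?_
  rw [ip_smul_left, Complex.norm_real, Real.norm_of_nonneg (Real.sqrt_nonneg _),
    Real.sq_sqrt (qf_nonneg hA _)]

end Spectral

section Entropy

open ContinuousLinearMap (adjoint)

variable {E F ι κ : Type*}
variable [NormedAddCommGroup E] [InnerProductSpace ℂ E] [CompleteSpace E]
variable [NormedAddCommGroup F] [InnerProductSpace ℂ F] [CompleteSpace F]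

theorem clEntropy_comp {g : κ → ι} (hg : Function.Injective g) {x : ι → ℝ}
    (hx : ∀ i, i ∉ Set.range g → x i = 0) : clEntropy (fun k => x (g k)) = clEntropy x := by
  unfold clEntropy
  have h1 : ∑' k, x (g k) = ∑' i, x i := hg.tsum_eq (f := x) fun i hi => by
    by_contra h; exact hi (hx i h)
  rw [h1]
  congr 1
  refine hg.tsum_eq (f := fun i => ENNReal.ofReal (Real.negMulLog (x i / ∑' j, x j))) fun i hi => ?_
  by_contra h
  exact hi (by simp [hx i h])

theorem ent_comp {g : κ → ι} (hg : Function.Injective g) {x : ι → ℝ≥0∞}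
    (hx : ∀ i, i ∉ Set.range g → x i = 0) : ent (fun k => x (g k)) = ent x :=
  clEntropy_comp hg (x := fun i => (x i).toReal) fun i hi => by simp [hx i hi]

theorem ent_ofReal {x : ι → ℝ} (hx : ∀ i, 0 ≤ x i) :
    ent (fun i => ENNReal.ofReal (x i)) = clEntropy x := by
  unfold ent
  simp_rw [ENNReal.toReal_ofReal (hx _)]

theorem qEntropy_le {A : E →L[ℂ] E} (hA : A.IsPositive) (b : HilbertBasis ι ℂ E) :
    qEntropy A ≤ ent fun i => ENNReal.ofReal (qf A (b i)) := by
  have hs : IsONB (Set.range b) := ⟨b.orthonormal.toSubtypeRange, by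
    rw [Submodule.dense_iff_topologicalClosure_eq_top, b.dense_span]⟩
  refine (iInf₂_le _ hs).trans_eq ?_
  rw [ent_ofReal fun i => qf_nonneg hA _]
  have := clEntropy_comp (g := Set.rangeFactorization b) (x := fun v : Set.range b => qf A v)
    (fun i j hij => b.orthonormal.linearIndependent.injective (congrArg Subtype.val hij))
    (fun i hi => (hi (Set.rangeFactorization_surjective i)).elim)
  exact this.symm

theorem le_qEntropy {A : E →L[ℂ] E} (hA : A.IsPositive) {c : ℝ≥0∞}
    (h : ∀ (s : Set E) (b : HilbertBasis s ℂ E), c ≤ ent fun i => ENNReal.ofReal (qf A (b i))) :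
    c ≤ qEntropy A := by
  refine le_iInf₂ fun s hs => ?_
  have htop : ⊤ ≤ (Submodule.span ℂ (Set.range ((↑) : s → E))).topologicalClosure := by
    rw [Subtype.range_coe, Submodule.dense_iff_topologicalClosure_eq_top.1 hs.2]
  have := h s (HilbertBasis.mk hs.1 htop)
  rw [ent_ofReal fun i => qf_nonneg hA _] at this
  simpa only [HilbertBasis.coe_mk] using this

theorem sum_sq_div_le_one (J : Finset ι) {u : ι → ℂ} {s : ι → ℝ} (hs : ∀ j ∈ J, 0 < s j)
    (h : ∀ c : ι → ℂ, ‖∑ j ∈ J, c j * u j‖ ^ 2 ≤ ∑ j ∈ J, ‖c j‖ ^ 2 * s j) :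
    ∑ j ∈ J, ‖u j‖ ^ 2 / s j ≤ 1 := by
  have h1 := h fun j => (starRingEnd ℂ) (u j) / (s j : ℂ)
  set t := ∑ j ∈ J, ‖u j‖ ^ 2 / s j with ht
  have e1 : ∑ j ∈ J, (starRingEnd ℂ) (u j) / (s j : ℂ) * u j = (t : ℂ) := by
    rw [ht]
    push_cast
    refine Finset.sum_congr rfl fun j _ => ?_
    rw [div_mul_eq_mul_div, ← Complex.normSq_eq_conj_mul_self, Complex.normSq_eq_norm_sq]
    push_cast; rfl
  have e2 : ∑ j ∈ J, ‖(starRingEnd ℂ) (u j) / (s j : ℂ)‖ ^ 2 * s j = t := by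
    refine Finset.sum_congr rfl fun j hj => ?_
    have := hs j hj
    rw [norm_div, RCLike.norm_conj, Complex.norm_real, Real.norm_of_nonneg this.le]
    field_simp
  rw [e1, e2, Complex.norm_real, Real.norm_eq_abs, sq_abs] at h1
  nlinarith

theorem tsum_sq_div_le_one {u : ι → ℂ} {s : ι → ℝ}
    (h : ∀ (J : Finset ι) (c : ι → ℂ), ‖∑ j ∈ J, c j * u j‖ ^ 2 ≤ ∑ j ∈ J, ‖c j‖ ^ 2 * s j) :
    ∑' j, (if ENNReal.ofReal (s j) = 0 then 0
      else ENNReal.ofReal (‖u j‖ ^ 2) / ENNReal.ofReal (s j)) ≤ 1 := by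
  rw [ENNReal.tsum_eq_iSup_sum]
  refine iSup_le fun J => ?_
  have hpos : ∀ j ∈ J.filter (fun j => 0 < s j), 0 < s j := fun j hj => (Finset.mem_filter.1 hj).2
  have := sum_sq_div_le_one (J.filter fun j => 0 < s j) hpos (h _)
  calc _ = ∑ j ∈ J.filter (fun j => 0 < s j), ENNReal.ofReal (‖u j‖ ^ 2 / s j) := by
        rw [Finset.sum_filter]
        refine Finset.sum_congr rfl fun j _ => ?_
        by_cases hj : 0 < s j
        · rw [if_neg (by simpa using hj), if_pos hj, ENNReal.ofReal_div_of_pos hj]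
        · rw [if_pos (by simpa using hj), if_neg hj]
    _ = ENNReal.ofReal (∑ j ∈ J.filter (fun j => 0 < s j), ‖u j‖ ^ 2 / s j) :=
        (ENNReal.ofReal_sum_of_nonneg fun j hj => div_nonneg (by positivity) (hpos j hj).le).symm
    _ ≤ 1 := by rw [← ENNReal.ofReal_one]; exact ENNReal.ofReal_le_ofReal this

theorem ent_le_of_ip {u : ι → κ → ℂ} {s : ι → ℝ}
    (hsum : ∑' j, ENNReal.ofReal (s j) ≠ ∞)
    (hrow : ∀ j, ∑' a, ENNReal.ofReal (‖u j a‖ ^ 2) = ENNReal.ofReal (s j))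
    (hcol : ∀ a (J : Finset ι) (c : ι → ℂ),
      ‖∑ j ∈ J, c j * u j a‖ ^ 2 ≤ ∑ j ∈ J, ‖c j‖ ^ 2 * s j) :
    ent (fun j => ENNReal.ofReal (s j))
      ≤ ent (fun a => ∑' j, ENNReal.ofReal (‖u j a‖ ^ 2)) := by
  have := ent_le_of_stochastic (x := fun j => ENNReal.ofReal (s j))
    (y := fun a => ∑' j, ENNReal.ofReal (‖u j a‖ ^ 2))
    (D := fun j a => ENNReal.ofReal (‖u j a‖ ^ 2) / ENNReal.ofReal (s j)) (M := 1) hsum le_rfl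
    (fun j hj => ?_) (fun a => ?_) (fun a => ?_)
  · simpa using this
  · simp_rw [div_eq_mul_inv]
    rw [ENNReal.tsum_mul_right, hrow]
    exact ENNReal.mul_inv_cancel hj ENNReal.ofReal_ne_top
  · rw [ENNReal.ofReal_one]
    exact tsum_sq_div_le_one (hcol a)
  · refine tsum_congr fun j => ?_
    rcases eq_or_ne (ENNReal.ofReal (s j)) 0 with h | h
    · have h2 := hrow j
      rw [h] at h2
      have := (ENNReal.tsum_eq_zero.1 h2) a
      simp only [h, this]; simp
    · rw [ENNReal.mul_div_cancel h ENNReal.ofReal_ne_top]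

theorem norm_sum_smul_sq {y : ι → E} (ho : ∀ i j, i ≠ j → (inner ℂ (y i) (y j) : ℂ) = 0)
    (J : Finset ι) (c : ι → ℂ) : ‖∑ j ∈ J, c j • y j‖ ^ 2 = ∑ j ∈ J, ‖c j‖ ^ 2 * ‖y j‖ ^ 2 := by
  induction J using Finset.induction_on with
  | empty => simp
  | insert a J ha ih =>
    rw [Finset.sum_insert ha, Finset.sum_insert ha, ← ih]
    have : (inner ℂ (c a • y a) (∑ j ∈ J, c j • y j) : ℂ) = 0 := by
      rw [inner_sum]
      refine Finset.sum_eq_zero fun j hj => ?_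
      rw [inner_smul_left, inner_smul_right, ho a j (fun h => ha (h ▸ hj))]
      simp
    have h2 := norm_add_sq_eq_norm_sq_add_norm_sq_of_inner_eq_zero _ _ this
    rw [← mul_pow, ← norm_smul]
    nlinarith

theorem qf_sum_smul {A : E →L[ℂ] E} (hA : A.IsPositive) {e : ι → E}
    (ho : ∀ i j, i ≠ j → (inner ℂ (e i) (A (e j)) : ℂ) = 0)
    (J : Finset ι) (c : ι → ℂ) : qf A (∑ j ∈ J, c j • e j) = ∑ j ∈ J, ‖c j‖ ^ 2 * qf A (e j) := by
  obtain ⟨R, -, rfl, hR⟩ := exists_sqrt hA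
  have hi : ∀ x y : E, (inner ℂ (R x) (R y) : ℂ) = inner ℂ x ((R ∘L R) y) := fun x y => by
    conv_lhs => rw [← ContinuousLinearMap.adjoint_inner_right, hR]
    rfl
  simp_rw [qf_eq_norm_sqrt hR]
  rw [map_sum]
  simp_rw [map_smul]
  exact norm_sum_smul_sq (fun i j hij => by rw [hi]; exact ho i j hij) J c

theorem Rep.norm_inner_sq_le {A : E →L[ℂ] E} {y : ι → E} (h : Rep A y) (a : ι) (z : E) :
    ‖(inner ℂ (y a) z : ℂ)‖ ^ 2 ≤ qf A z := by
  have h1 : ip (y a) z ≤ ENNReal.ofReal (qf A z) := by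
    rw [h.eq]; exact ENNReal.le_tsum (f := fun a => ip (y a) z) a
  rw [ip_eq] at h1
  exact (ENNReal.ofReal_le_ofReal_iff (qf_nonneg h.pos z)).1 h1

/-- The entropy of an operator is at most that of any of its pure-state decompositions. -/
theorem Rep.qEntropy_le {A : E →L[ℂ] E} {y : ι → E} (h : Rep A y) (ht : traceENN A ≠ ∞) :
    qEntropy A ≤ ent fun a => nsq (y a) := by
  obtain ⟨s, b, hb⟩ := exists_eigenbasis h.pos (isCompactOperator_of_trace h.pos ht)
  refine (QIT.qEntropy_le h.pos b).trans ?_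
  have := ent_le_of_ip (u := fun j a => (inner ℂ (y a) (b j) : ℂ)) (s := fun j => qf A (b j))
    (by rwa [← trace_eq h.pos b]) (fun j => ?_) (fun a J c => ?_)
  · refine this.trans_eq ?_
    congr 1
    funext a
    rw [← parseval b]
    refine tsum_congr fun j => ?_
    rw [← ip_eq, ip_comm]
  · simp_rw [← ip_eq]
    rw [h.eq]
  · have hd : ∀ i j, i ≠ j → (inner ℂ (b i) (A (b j)) : ℂ) = 0 := fun i j hij => by
      rw [hb, inner_smul_right, b.orthonormal.2 hij, mul_zero]
    rw [← qf_sum_smul h.pos hd]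
    refine le_trans (le_of_eq ?_) (h.norm_inner_sq_le a _)
    rw [inner_sum]
    simp_rw [inner_smul_right]

theorem Rep.ent_le_qEntropy {A : E →L[ℂ] E} {y : ι → E} (h : Rep A y) (ht : traceENN A ≠ ∞)
    (ho : ∀ i j, i ≠ j → (inner ℂ (y i) (y j) : ℂ) = 0) :
    ent (fun a => nsq (y a)) ≤ qEntropy A := by
  refine le_qEntropy h.pos fun s b => ?_
  have := ent_le_of_ip (u := fun j a => (inner ℂ (b a) (y j) : ℂ)) (s := fun j => ‖y j‖ ^ 2)
    (by simp_rw [← nsq_eq]; rwa [← h.trace]) (fun j => ?_)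
    (fun a J c => ?_)
  · simp_rw [← nsq_eq] at this
    refine this.trans_eq ?_
    congr 1
    funext a
    rw [h.eq]
    refine tsum_congr fun j => ?_
    rw [ip_comm]
    rfl
  · simp_rw [← ip_eq]
    rw [parseval b, nsq_eq]
  · rw [← norm_sum_smul_sq ho]
    have h1 : ∑ j ∈ J, c j * (inner ℂ (b a) (y j) : ℂ) = inner ℂ (b a) (∑ j ∈ J, c j • y j) := by
      rw [inner_sum]
      simp_rw [inner_smul_right]
    rw [h1]
    gcongr
    refine (norm_inner_le_norm _ _).trans ?_
    rw [b.orthonormal.1 a, one_mul]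

/-- The spectral decomposition of a positive trace-class operator. -/
theorem exists_spectral_rep {A : E →L[ℂ] E} (hA : A.IsPositive) (ht : traceENN A ≠ ∞) :
    ∃ (s : Set E) (y : s → E), Rep A y ∧ (∀ i j, i ≠ j → (inner ℂ (y i) (y j) : ℂ) = 0) ∧
      ent (fun i => nsq (y i)) = qEntropy A ∧ ∀ i, ∃ z, y i = A z := by
  obtain ⟨s, b, hb, hrep⟩ := exists_orthogonal_rep hA ht
  have ho : ∀ i j, i ≠ j → (inner ℂ (((√(qf A (b i)) : ℝ) : ℂ) • b i)
      (((√(qf A (b j)) : ℝ) : ℂ) • b j) : ℂ) = 0 := fun i j hij => by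
    rw [inner_smul_left, inner_smul_right, b.orthonormal.2 hij]; simp
  refine ⟨s, _, hrep, ho, le_antisymm (hrep.ent_le_qEntropy ht ho) (hrep.qEntropy_le ht),
    fun i => ?_⟩
  rcases eq_or_ne (qf A (b i)) 0 with h0 | h0
  · exact ⟨0, by simp [h0]⟩
  · refine ⟨(((√(qf A (b i)) : ℝ) : ℂ) / (qf A (b i) : ℂ)) • b i, ?_⟩
    rw [map_smul, hb i, smul_smul, div_mul_cancel₀ _ (by exact_mod_cast h0)]

end Entropy

section EntropyToolkit

open ContinuousLinearMap (adjoint)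

variable {E F ι κ : Type*}
variable [NormedAddCommGroup E] [InnerProductSpace ℂ E] [CompleteSpace E]
variable [NormedAddCommGroup F] [InnerProductSpace ℂ F] [CompleteSpace F]

theorem isPositive_of_qf {A : E →L[ℂ] E} (hA : adjoint A = A) (h : ∀ x, 0 ≤ qf A x) :
    A.IsPositive := by
  rw [ContinuousLinearMap.isPositive_iff_complex]
  intro x
  have h1 : (inner ℂ (A x) x : ℂ) = inner ℂ x (A x) := by
    conv_lhs => rw [← ContinuousLinearMap.adjoint_inner_right, hA]
  have h2 : (starRingEnd ℂ) (inner ℂ x (A x) : ℂ) = inner ℂ x (A x) := by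
    rw [inner_conj_symm, h1]
  rw [h1]
  refine ⟨?_, h x⟩
  exact Complex.conj_eq_iff_re.1 h2

theorem isPositive_conj {A : E →L[ℂ] E} (hA : A.IsPositive) (X : E →L[ℂ] F) :
    (X ∘L A ∘L adjoint X).IsPositive := hA.conj_adjoint X

theorem isPositive_smul {A : E →L[ℂ] E} (hA : A.IsPositive) {c : ℝ} (hc : 0 ≤ c) :
    ((c : ℂ) • A).IsPositive :=
  hA.smul_of_nonneg (by exact_mod_cast hc)

theorem trace_mono {A B : E →L[ℂ] E} (h : ∀ f, qf A f ≤ qf B f) : traceENN A ≤ traceENN B :=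
  iSup_mono fun _ => iSup_mono fun _ => iSup_mono fun _ =>
    Finset.sum_le_sum fun _ _ => ENNReal.ofReal_le_ofReal (h _)

theorem trace_tsum {A : ι → E →L[ℂ] E} (hA : ∀ i, (A i).IsPositive) {B : E →L[ℂ] E}
    (hB : B.IsPositive) (h : ∀ f, ENNReal.ofReal (qf B f) = ∑' i, ENNReal.ofReal (qf (A i) f)) :
    traceENN B = ∑' i, traceENN (A i) := by
  obtain ⟨w, b, -⟩ := exists_hilbertBasis ℂ E
  simp_rw [trace_eq hB b, trace_eq (hA _) b, h]
  exact ENNReal.tsum_comm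

theorem trace_add {A B : E →L[ℂ] E} (hA : A.IsPositive) (hB : B.IsPositive) :
    traceENN (A + B) = traceENN A + traceENN B := by
  obtain ⟨w, b, -⟩ := exists_hilbertBasis ℂ E
  simp_rw [trace_eq (hA.add hB) b, trace_eq hA b, trace_eq hB b, qf_add,
    ENNReal.ofReal_add (qf_nonneg hA _) (qf_nonneg hB _)]
  exact ENNReal.tsum_add

theorem trace_smul {A : E →L[ℂ] E} (hA : A.IsPositive) {c : ℝ} (hc : 0 ≤ c) :
    traceENN ((c : ℂ) • A) = ENNReal.ofReal c * traceENN A := by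
  obtain ⟨w, b, -⟩ := exists_hilbertBasis ℂ E
  simp_rw [trace_eq (isPositive_smul hA hc) b, trace_eq hA b, qf_smul, ENNReal.ofReal_mul hc]
  exact ENNReal.tsum_mul_left

theorem tsum_qf_le_trace {A : E →L[ℂ] E} (hA : A.IsPositive) {g : κ → E} (hg : Orthonormal ℂ g) :
    ∑' k, ENNReal.ofReal (qf A (g k)) ≤ traceENN A := by
  obtain ⟨s, y, h⟩ := exists_rep hA
  simp_rw [h.eq, h.trace]
  rw [ENNReal.tsum_comm]
  refine ENNReal.tsum_le_tsum fun a => ?_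
  simp_rw [ip_comm (y a)]
  exact bessel hg _

theorem qEntropy_mono {A B : E →L[ℂ] E} (hA : A.IsPositive) (hB : B.IsPositive)
    (h : ∀ f, qf A f ≤ qf B f) (ht : traceENN B ≠ ∞) : qEntropy A ≤ qEntropy B := by
  refine le_qEntropy hB fun s b => (qEntropy_le hA b).trans ?_
  exact ent_mono (fun i => ENNReal.ofReal_le_ofReal (h _)) (by rwa [← trace_eq hB b])

theorem Rep.smul {A : E →L[ℂ] E} {y : ι → E} (h : Rep A y) {c : ℝ} (hc : 0 ≤ c) :
    Rep ((c : ℂ) • A) (fun i => ((√c : ℝ) : ℂ) • y i) := by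
  refine ⟨isPositive_smul h.pos hc, fun f => ?_⟩
  simp_rw [ip_smul_left]
  rw [qf_smul, ENNReal.ofReal_mul hc, h.eq, ENNReal.tsum_mul_left, Complex.norm_real,
    Real.norm_eq_abs, sq_abs, Real.sq_sqrt hc]

theorem qEntropy_smul_le {A : E →L[ℂ] E} (hA : A.IsPositive) (ht : traceENN A ≠ ∞) {c : ℝ}
    (hc : 0 ≤ c) : qEntropy ((c : ℂ) • A) ≤ ENNReal.ofReal c * qEntropy A := by
  obtain ⟨s, y, h, -, he, -⟩ := exists_spectral_rep hA ht
  refine ((h.smul hc).qEntropy_le ?_).trans_eq ?_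
  · rw [trace_smul hA hc]; exact ENNReal.mul_ne_top ENNReal.ofReal_ne_top ht
  · simp_rw [nsq_smul]
    rw [Complex.norm_real, Real.norm_eq_abs, sq_abs, Real.sq_sqrt hc,
      ent_smul ENNReal.ofReal_ne_top (by rwa [← h.trace]), he]

theorem qEntropy_tsum_le {A : ι → E →L[ℂ] E} (hA : ∀ i, (A i).IsPositive) {B : E →L[ℂ] E}
    (hB : B.IsPositive) (h : ∀ f, ENNReal.ofReal (qf B f) = ∑' i, ENNReal.ofReal (qf (A i) f))
    (ht : traceENN B ≠ ∞) :
    qEntropy B ≤ ent (fun i => traceENN (A i)) + ∑' i, qEntropy (A i) := by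
  have htr := trace_tsum hA hB h
  have htA : ∀ i, traceENN (A i) ≠ ∞ := fun i => ne_top_of_le_ne_top ht
    (htr ▸ ENNReal.le_tsum i)
  choose s y hy _ he _ using fun i => exists_spectral_rep (hA i) (htA i)
  have hrep : Rep B (fun p : Σ i, s i => y p.1 p.2) := ⟨hB, fun f => by
    rw [h, ENNReal.tsum_sigma']
    simp_rw [(hy _).eq]⟩
  refine (hrep.qEntropy_le ht).trans_eq ?_
  rw [ent_sigma (by rwa [← hrep.trace])]
  simp_rw [(hy _).trace, he]

theorem qEntropy_add_le {A B : E →L[ℂ] E} (hA : A.IsPositive) (hB : B.IsPositive)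
    (htA : traceENN A ≠ ∞) (htB : traceENN B ≠ ∞) {a b : ℝ} (ha : traceENN A ≤ ENNReal.ofReal a)
    (hb : traceENN B ≤ ENNReal.ofReal b) (ha0 : 0 ≤ a) (hb0 : 0 ≤ b) :
    qEntropy (A + B) ≤ qEntropy A + qEntropy B + ENNReal.ofReal (b + 2 * √(a * b)) := by
  have h := qEntropy_tsum_le (A := fun i : Bool => if i then B else A) (B := A + B)
    (fun i => by cases i <;> simp [hA, hB]) (hA.add hB) (fun f => by
      rw [tsum_bool, qf_add, ENNReal.ofReal_add (qf_nonneg hA _) (qf_nonneg hB _)]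
      simp) (by rw [trace_add hA hB]; exact ENNReal.add_ne_top.2 ⟨htA, htB⟩)
  refine h.trans ?_
  rw [tsum_bool, add_comm]
  simp only [Bool.false_eq_true, if_true, if_false]
  gcongr
  exact ent_pair_le (by simpa using ha) (by simpa using hb) ha0 hb0

theorem Rep.conj {A : E →L[ℂ] E} {y : ι → E} (h : Rep A y) (X : E →L[ℂ] F) :
    Rep (X ∘L A ∘L adjoint X) (fun i => X (y i)) :=
  ⟨isPositive_conj h.pos X, fun f => by rw [qf_conj, h.eq]; simp_rw [ip_adjoint_right]⟩

theorem nsq_apply_le (X : E →L[ℂ] F) (x : E) : nsq (X x) ≤ ENNReal.ofReal (‖X‖ ^ 2) * nsq x := by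
  rw [nsq_eq, nsq_eq, ← ENNReal.ofReal_mul (by positivity), ← mul_pow]
  gcongr
  exact X.le_opNorm x

theorem trace_conj_le {A : E →L[ℂ] E} (hA : A.IsPositive) (X : E →L[ℂ] F) :
    traceENN (X ∘L A ∘L adjoint X) ≤ ENNReal.ofReal (‖X‖ ^ 2) * traceENN A := by
  obtain ⟨s, y, h⟩ := exists_rep hA
  rw [(h.conj X).trace, h.trace, ← ENNReal.tsum_mul_left]
  exact ENNReal.tsum_le_tsum fun i => nsq_apply_le X _

theorem trace_conj_ne_top {A : E →L[ℂ] E} (hA : A.IsPositive) (ht : traceENN A ≠ ∞)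
    (X : E →L[ℂ] F) : traceENN (X ∘L A ∘L adjoint X) ≠ ∞ :=
  ne_top_of_le_ne_top (ENNReal.mul_ne_top ENNReal.ofReal_ne_top ht) (trace_conj_le hA X)

theorem qEntropy_conj_le {A : E →L[ℂ] E} (hA : A.IsPositive) (ht : traceENN A ≠ ∞)
    {X : E →L[ℂ] F} (hX : ‖X‖ ≤ 1) : qEntropy (X ∘L A ∘L adjoint X) ≤ qEntropy A := by
  obtain ⟨s, y, h, -, he, -⟩ := exists_spectral_rep hA ht
  refine ((h.conj X).qEntropy_le (trace_conj_ne_top hA ht X)).trans (he ▸ ?_)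
  refine ent_mono (fun i => (nsq_apply_le X _).trans ?_) (by rwa [← h.trace])
  refine mul_le_of_le_one_left' ?_
  rw [← ENNReal.ofReal_one]
  exact ENNReal.ofReal_le_ofReal (pow_le_one₀ (norm_nonneg _) hX)

theorem qEntropy_le_orthonormal {A : E →L[ℂ] E} (hA : A.IsPositive) {g : κ → E}
    (hg : Orthonormal ℂ g) (h0 : ∀ f, (∀ k, (inner ℂ (g k) f : ℂ) = 0) → qf A f = 0) :
    qEntropy A ≤ ent fun k => ENNReal.ofReal (qf A (g k)) := by
  obtain ⟨w, b, hw, hb⟩ := hg.toSubtypeRange.exists_hilbertBasis_extension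
  refine (qEntropy_le hA b).trans_eq ?_
  have hmem : ∀ k, g k ∈ w := fun k => hw ⟨k, rfl⟩
  have := ent_comp (g := fun k => (⟨g k, hmem k⟩ : w))
    (x := fun i => ENNReal.ofReal (qf A (b i)))
    (fun i j hij => hg.linearIndependent.injective (congrArg Subtype.val hij)) (fun i hi => ?_)
  · rw [← this, hb]
  · rw [h0, ENNReal.ofReal_zero]
    intro k
    have hne : (⟨g k, hmem k⟩ : w) ≠ i := fun h => hi ⟨k, h⟩
    have := b.orthonormal.2 hne
    rwa [hb] at this ⊢

theorem qEntropy_le_log_card [Fintype κ] {A : E →L[ℂ] E} (hA : A.IsPositive)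
    (ht : traceENN A ≠ ∞) {g : κ → E}
    (hg : Orthonormal ℂ g) (h0 : ∀ f, (∀ k, (inner ℂ (g k) f : ℂ) = 0) → qf A f = 0)
    {n : ℕ} (hn : Fintype.card κ ≤ n) :
    qEntropy A ≤ ENNReal.ofReal (Real.log n) * traceENN A := by
  have h1 := tsum_qf_le_trace hA hg
  refine (qEntropy_le_orthonormal hA hg h0).trans ?_
  refine (ent_le_log_card (ne_top_of_le_ne_top ht h1) Finset.univ hn (by simp)).trans ?_
  gcongr

theorem qEntropy_conj_le_log_rank (V : E →L[ℂ] F) {A : E →L[ℂ] E} (hA : A.IsPositive)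
    (ht : traceENN A ≠ ∞) (hfd : FiniteDimensional ℂ (LinearMap.range (V : E →ₗ[ℂ] F))) :
    qEntropy (V ∘L A ∘L adjoint V) ≤
      ENNReal.ofReal (Real.log (Module.finrank ℂ (LinearMap.range (V : E →ₗ[ℂ] F)))) *
        traceENN (V ∘L A ∘L adjoint V) := by
  set U := LinearMap.range (V : E →ₗ[ℂ] F)
  let u := stdOrthonormalBasis ℂ U
  refine qEntropy_le_log_card (isPositive_conj hA V) (trace_conj_ne_top hA ht V)
    (g := fun k => ((u k : U) : F)) (u.orthonormal.comp_linearIsometry U.subtypeₗᵢ) (fun f hf => ?_)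
    (by simp)
  rw [qf_conj]
  have : adjoint V f = 0 := by
    refine ext_inner_left ℂ fun x => ?_
    rw [ContinuousLinearMap.adjoint_inner_right, inner_zero_right]
    have hx : V x = ((⟨V x, ⟨x, rfl⟩⟩ : U) : F) := rfl
    rw [hx, ← u.sum_repr ⟨V x, ⟨x, rfl⟩⟩]
    push_cast
    rw [sum_inner]
    refine Finset.sum_eq_zero fun k _ => ?_
    rw [inner_smul_left, hf k, mul_zero]
  rw [this]
  simp [qf]

end EntropyToolkit

section Kraus

open ContinuousLinearMap (adjoint)

variable {E F ι κ : Type*}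
variable [NormedAddCommGroup E] [InnerProductSpace ℂ E] [CompleteSpace E]
variable [NormedAddCommGroup F] [InnerProductSpace ℂ F] [CompleteSpace F]

theorem qf_le_trace {A : E →L[ℂ] E} (hA : A.IsPositive) (f : E) :
    ENNReal.ofReal (qf A f) ≤ traceENN A * nsq f := by
  obtain ⟨s, y, h⟩ := exists_rep hA
  rw [h.eq, h.trace, ← ENNReal.tsum_mul_right]
  exact ENNReal.tsum_le_tsum fun a => ip_le _ _

theorem norm_le_trace {A : E →L[ℂ] E} (hA : A.IsPositive) (ht : traceENN A ≠ ∞) :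
    ‖A‖ ≤ (traceENN A).toReal := by
  set t := (traceENN A).toReal with htdef
  have hq : ∀ f, qf A f ≤ t * ‖f‖ ^ 2 := fun f => by
    have := ENNReal.toReal_mono (ENNReal.mul_ne_top ht (nsq_ne_top f)) (qf_le_trace hA f)
    rwa [ENNReal.toReal_ofReal (qf_nonneg hA f), ENNReal.toReal_mul, nsq_eq,
      ENNReal.toReal_ofReal (by positivity)] at this
  obtain ⟨R, -, hRA, hR⟩ := exists_sqrt hA
  have ht0 : 0 ≤ t := ENNReal.toReal_nonneg
  have hRn : ‖R‖ ≤ √t := R.opNorm_le_bound (Real.sqrt_nonneg _) fun x => by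
    have := hq x
    rw [← hRA, qf_eq_norm_sqrt hR] at this
    refine abs_le_of_sq_le_sq' ?_ (by positivity) |>.2
    rwa [mul_pow, Real.sq_sqrt ht0]
  calc ‖A‖ = ‖R ∘L R‖ := by rw [hRA]
    _ ≤ ‖R‖ * ‖R‖ := R.opNorm_comp_le R
    _ ≤ √t * √t := by gcongr
    _ = t := Real.mul_self_sqrt ht0

theorem eq_zero_of_trace {A : E →L[ℂ] E} (hA : A.IsPositive) (ht : traceENN A = 0) : A = 0 := by
  have := norm_le_trace hA (by simp [ht])
  rw [ht, ENNReal.toReal_zero] at this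
  exact norm_le_zero_iff.1 this

/-- A family of positive operators with summable traces is summable in the operator norm. -/
theorem summable_of_trace {A : ι → E →L[ℂ] E} (hA : ∀ i, (A i).IsPositive)
    (ht : ∑' i, traceENN (A i) ≠ ∞) : Summable A := by
  refine Summable.of_norm_bounded (ENNReal.summable_toReal ht) fun i => ?_
  exact norm_le_trace (hA i) (ENNReal.ne_top_of_tsum_ne_top ht i)

theorem hasSum_inner {A : ι → E →L[ℂ] E} (hA : ∀ i, (A i).IsPositive) (hs : Summable A) (f : E) :
    HasSum (fun i => qf (A i) f) (qf (∑' i, A i) f) ∧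
      (inner ℂ f ((∑' i, A i) f) : ℂ) = qf (∑' i, A i) f := by
  have h := (hs.hasSum.mapL (ContinuousLinearMap.apply ℂ E f)).mapL (innerSL ℂ f)
  have h2 : HasSum (fun i => ((qf (A i) f : ℝ) : ℂ)) (inner ℂ f ((∑' i, A i) f)) := by
    simp_rw [← inner_self_eq_qf (hA _) f]
    exact h
  obtain ⟨h3, h4⟩ := (Complex.hasSum_iff _ _).1 h2
  refine ⟨h3, ?_⟩
  simp only [Complex.ofReal_im] at h4
  exact Complex.ext rfl (h4.unique hasSum_zero)

theorem isPositive_tsum {A : ι → E →L[ℂ] E} (hA : ∀ i, (A i).IsPositive) (hs : Summable A) :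
    (∑' i, A i).IsPositive := by
  rw [ContinuousLinearMap.isPositive_iff_complex]
  intro x
  obtain ⟨h1, h2⟩ := hasSum_inner hA hs x
  have h3 : (inner ℂ ((∑' i, A i) x) x : ℂ) = qf (∑' i, A i) x := by
    rw [← inner_conj_symm, h2, Complex.conj_ofReal]
  rw [h3]
  exact ⟨rfl, h1.nonneg fun i => qf_nonneg (hA i) x⟩

theorem ofReal_qf_tsum {A : ι → E →L[ℂ] E} (hA : ∀ i, (A i).IsPositive) (hs : Summable A) (f : E) :
    ENNReal.ofReal (qf (∑' i, A i) f) = ∑' i, ENNReal.ofReal (qf (A i) f) := by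
  obtain ⟨h1, -⟩ := hasSum_inner hA hs f
  rw [← h1.tsum_eq, ENNReal.ofReal_tsum_of_nonneg (fun i => qf_nonneg (hA i) f) h1.summable]

variable {V : ℕ → (E →L[ℂ] F)}

theorem KrausTNI.sum_norm_sq_le (hV : KrausTNI V) (n : ℕ) (x : E) :
    ∑ i ∈ Finset.range n, ‖V i x‖ ^ 2 ≤ ‖x‖ ^ 2 := by
  have h := qf_nonneg (hV n) x
  rw [qf_sub, qf_one] at h
  have h2 : qf (∑ i ∈ Finset.range n, adjoint (V i) ∘L V i) x
      = ∑ i ∈ Finset.range n, ‖V i x‖ ^ 2 := by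
    simp_rw [← qf_adjoint_comp_self]
    simp only [qf, _root_.sum_apply, inner_sum, Complex.re_sum]
  linarith

theorem KrausTNI.tsum_nsq_le (hV : KrausTNI V) (x : E) : ∑' i, nsq (V i x) ≤ nsq x := by
  refine ENNReal.tsum_le_of_sum_range_le fun n => ?_
  simp_rw [nsq_eq]
  rw [← ENNReal.ofReal_sum_of_nonneg fun i _ => by positivity]
  exact ENNReal.ofReal_le_ofReal (hV.sum_norm_sq_le n x)

theorem KrausTNI.tsum_trace_le (hV : KrausTNI V) {σ : E →L[ℂ] E} (hσ : σ.IsPositive) :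
    ∑' i, traceENN (V i ∘L σ ∘L adjoint (V i)) ≤ traceENN σ := by
  obtain ⟨s, y, h⟩ := exists_rep hσ
  simp_rw [(h.conj _).trace]
  rw [h.trace, ENNReal.tsum_comm]
  exact ENNReal.tsum_le_tsum fun a => hV.tsum_nsq_le _

theorem KrausTNI.tsum_trace_ne_top (hV : KrausTNI V) {σ : E →L[ℂ] E} (hσ : σ.IsPositive)
    (ht : traceENN σ ≠ ∞) : ∑' i, traceENN (V i ∘L σ ∘L adjoint (V i)) ≠ ∞ :=
  ne_top_of_le_ne_top ht (hV.tsum_trace_le hσ)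

theorem KrausTNI.summable (hV : KrausTNI V) {σ : E →L[ℂ] E} (hσ : σ.IsPositive)
    (ht : traceENN σ ≠ ∞) : Summable fun i => V i ∘L σ ∘L adjoint (V i) :=
  summable_of_trace (fun i => isPositive_conj hσ (V i)) (hV.tsum_trace_ne_top hσ ht)

theorem KrausTNI.pos (hV : KrausTNI V) {σ : E →L[ℂ] E} (hσ : σ.IsPositive)
    (ht : traceENN σ ≠ ∞) : (krausMap V σ).IsPositive :=
  isPositive_tsum (fun i => isPositive_conj hσ (V i)) (hV.summable hσ ht)

theorem KrausTNI.qf_eq (hV : KrausTNI V) {σ : E →L[ℂ] E} (hσ : σ.IsPositive)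
    (ht : traceENN σ ≠ ∞) (f : F) : ENNReal.ofReal (qf (krausMap V σ) f)
      = ∑' i, ENNReal.ofReal (qf (V i ∘L σ ∘L adjoint (V i)) f) :=
  ofReal_qf_tsum (fun i => isPositive_conj hσ (V i)) (hV.summable hσ ht) f

theorem KrausTNI.trace_eq (hV : KrausTNI V) {σ : E →L[ℂ] E} (hσ : σ.IsPositive)
    (ht : traceENN σ ≠ ∞) :
    traceENN (krausMap V σ) = ∑' i, traceENN (V i ∘L σ ∘L adjoint (V i)) :=
  trace_tsum (fun i => isPositive_conj hσ (V i)) (hV.pos hσ ht) (hV.qf_eq hσ ht)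

theorem KrausTNI.trace_le (hV : KrausTNI V) {σ : E →L[ℂ] E} (hσ : σ.IsPositive)
    (ht : traceENN σ ≠ ∞) : traceENN (krausMap V σ) ≤ traceENN σ :=
  (hV.trace_eq hσ ht).trans_le (hV.tsum_trace_le hσ)

theorem KrausTNI.trace_ne_top (hV : KrausTNI V) {σ : E →L[ℂ] E} (hσ : σ.IsPositive)
    (ht : traceENN σ ≠ ∞) : traceENN (krausMap V σ) ≠ ∞ :=
  ne_top_of_le_ne_top ht (hV.trace_le hσ ht)

theorem KrausTNI.map_add (hV : KrausTNI V) {σ τ : E →L[ℂ] E} (hσ : σ.IsPositive)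
    (hσt : traceENN σ ≠ ∞) (hτ : τ.IsPositive) (hτt : traceENN τ ≠ ∞) :
    krausMap V (σ + τ) = krausMap V σ + krausMap V τ := by
  unfold krausMap
  rw [← (hV.summable hσ hσt).tsum_add (hV.summable hτ hτt)]
  simp only [ContinuousLinearMap.add_comp, ContinuousLinearMap.comp_add]

theorem krausMap_smul (V : ℕ → (E →L[ℂ] F)) (c : ℂ) (σ : E →L[ℂ] E) :
    krausMap V (c • σ) = c • krausMap V σ := by
  unfold krausMap
  simp only [ContinuousLinearMap.smul_comp, ContinuousLinearMap.comp_smul]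
  exact tsum_const_smul'' c

theorem KrausTNI.mono (hV : KrausTNI V) {σ τ : E →L[ℂ] E} (hσ : σ.IsPositive)
    (hτ : τ.IsPositive) (hτt : traceENN τ ≠ ∞) (h : ∀ x, qf σ x ≤ qf τ x) (f : F) :
    qf (krausMap V σ) f ≤ qf (krausMap V τ) f := by
  have hσt : traceENN σ ≠ ∞ := ne_top_of_le_ne_top hτt (trace_mono h)
  refine (ENNReal.ofReal_le_ofReal_iff (qf_nonneg (hV.pos hτ hτt) f)).1 ?_
  rw [hV.qf_eq hσ hσt, hV.qf_eq hτ hτt]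
  refine ENNReal.tsum_le_tsum fun i => ENNReal.ofReal_le_ofReal ?_
  rw [qf_conj, qf_conj]
  exact h _

theorem KrausTNI.rep (hV : KrausTNI V) {σ : E →L[ℂ] E} {x : ι → E} (h : Rep σ x)
    (ht : traceENN σ ≠ ∞) :
    Rep (krausMap V σ) (fun p : Σ _ : ℕ, ι => V p.1 (x p.2)) := by
  refine ⟨hV.pos h.pos ht, fun f => ?_⟩
  rw [hV.qf_eq h.pos ht, ENNReal.tsum_sigma']
  simp_rw [(h.conj _).eq]

theorem KrausTNI.qEntropy_mono (hV : KrausTNI V) {σ τ : E →L[ℂ] E} (hσ : σ.IsPositive)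
    (hτ : τ.IsPositive) (hτt : traceENN τ ≠ ∞) (h : ∀ x, qf σ x ≤ qf τ x) :
    qEntropy (krausMap V σ) ≤ qEntropy (krausMap V τ) :=
  QIT.qEntropy_mono (hV.pos hσ (ne_top_of_le_ne_top hτt (trace_mono h))) (hV.pos hτ hτt)
    (hV.mono hσ hτ hτt h) (hV.trace_ne_top hτ hτt)

theorem KrausTNI.qEntropy_smul_le (hV : KrausTNI V) {σ : E →L[ℂ] E} (hσ : σ.IsPositive)
    (ht : traceENN σ ≠ ∞) {c : ℝ} (hc : 0 ≤ c) :
    qEntropy (krausMap V ((c : ℂ) • σ)) ≤ ENNReal.ofReal c * qEntropy (krausMap V σ) := by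
  rw [krausMap_smul]
  exact QIT.qEntropy_smul_le (hV.pos hσ ht) (hV.trace_ne_top hσ ht) hc

theorem states_mixture {ρ : ℕ → E →L[ℂ] E} (hρ : ∀ n, ρ n ∈ states E) :
    ∃ τ ∈ states E, ∀ n f, qf (ρ n) f ≤ 2 ^ (n + 1) * qf τ f := by
  have h0 : ∀ n : ℕ, (0 : ℝ) ≤ (1 / 2) ^ n / 2 := fun n => by positivity
  set A : ℕ → E →L[ℂ] E := fun n => (((1 / 2 : ℝ) ^ n / 2 : ℝ) : ℂ) • ρ n with hAdef
  have hA : ∀ n, (A n).IsPositive := fun n => isPositive_smul (hρ n).1 (h0 n)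
  have htr : ∑' n, traceENN (A n) = 1 := by
    simp_rw [hAdef, fun n => trace_smul (hρ n).1 (h0 n), (hρ _).2, mul_one]
    have hg : HasSum (fun n : ℕ => (1 / 2 : ℝ) ^ n / 2) 1 := by
      simpa using hasSum_geometric_two.div_const 2
    rw [← ENNReal.ofReal_tsum_of_nonneg h0 hg.summable, hg.tsum_eq, ENNReal.ofReal_one]
  have hs := summable_of_trace hA (by simp [htr])
  refine ⟨∑' n, A n, ⟨isPositive_tsum hA hs, ?_⟩, fun n f => ?_⟩
  · rw [trace_tsum hA (isPositive_tsum hA hs) (ofReal_qf_tsum hA hs), htr]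
  · have := le_hasSum (hasSum_inner hA hs f).1 n fun m _ => qf_nonneg (hA m) f
    rw [hAdef, qf_smul] at this
    have h2 : (2 : ℝ) ^ (n + 1) * ((1 / 2) ^ n / 2 * qf (ρ n) f) = qf (ρ n) f := by
      rw [pow_succ, div_pow, one_pow]; field_simp
    rw [← h2]
    gcongr

theorem KrausTNI.exists_bound (hV : KrausTNI V)
    (h : ∀ ρ ∈ states E, qEntropy (krausMap V ρ) ≠ ∞) :
    ∃ K : ℝ, 0 ≤ K ∧ ∀ σ : E →L[ℂ] E, σ.IsPositive → traceENN σ ≠ ∞ →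
      qEntropy (krausMap V σ) ≤ ENNReal.ofReal K * traceENN σ := by
  have key : ∃ K : ℝ, 0 ≤ K ∧ ∀ ρ ∈ states E, qEntropy (krausMap V ρ) ≤ ENNReal.ofReal K := by
    by_contra! hcon
    choose ρ hρ hlt using fun n : ℕ => hcon (2 ^ (n + 1) * n) (by positivity)
    obtain ⟨τ, hτ, hle⟩ := states_mixture hρ
    obtain ⟨n, hn⟩ := exists_nat_gt (qEntropy (krausMap V τ)).toReal
    have htop : traceENN τ ≠ ∞ := by simp [hτ.2]
    have h2 : (0 : ℝ) ≤ 2 ^ (n + 1) := by positivity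
    have h1 := hV.qEntropy_mono (hρ n).1 (isPositive_smul hτ.1 h2)
      (by rw [trace_smul hτ.1 h2]; exact ENNReal.mul_ne_top ENNReal.ofReal_ne_top htop)
      (fun f => by rw [qf_smul]; exact hle n f)
    have h3 := (hlt n).trans_le (h1.trans (hV.qEntropy_smul_le hτ.1 htop h2))
    rw [ENNReal.ofReal_mul h2] at h3
    refine absurd h3 (not_lt.2 ?_)
    gcongr
    rw [← ENNReal.ofReal_toReal (h τ hτ)]
    exact ENNReal.ofReal_le_ofReal hn.le
  obtain ⟨K, hK, hb⟩ := key
  refine ⟨K, hK, fun σ hσ ht => ?_⟩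
  have ht0 : 0 ≤ (traceENN σ).toReal := ENNReal.toReal_nonneg
  rcases eq_or_ne (traceENN σ) 0 with h0 | h0
  · have := hV.qEntropy_smul_le hσ ht le_rfl
    rw [eq_zero_of_trace hσ h0] at this ⊢
    refine le_trans ?_ bot_le
    simpa using this
  · have hpos : 0 < (traceENN σ).toReal := ENNReal.toReal_pos h0 ht
    have hst : (((traceENN σ).toReal⁻¹ : ℝ) : ℂ) • σ ∈ states E := by
      refine ⟨isPositive_smul hσ (inv_nonneg.2 ht0), ?_⟩
      rw [trace_smul hσ (inv_nonneg.2 ht0), ENNReal.ofReal_inv_of_pos hpos,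
        ENNReal.ofReal_toReal ht,
        ENNReal.inv_mul_cancel h0 ht]
    have h1 := hV.qEntropy_smul_le hst.1 (by rw [hst.2]; exact ENNReal.one_ne_top) ht0
    rw [smul_smul, ← Complex.ofReal_mul, mul_inv_cancel₀ hpos.ne', Complex.ofReal_one, one_smul,
      ENNReal.ofReal_toReal ht] at h1
    refine h1.trans ?_
    rw [mul_comm]
    gcongr
    exact hb _ hst

end Kraus

section Approximation

open ContinuousLinearMap (adjoint)

variable {E F ι κ : Type*}
variable [NormedAddCommGroup E] [InnerProductSpace ℂ E] [CompleteSpace E]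
variable [NormedAddCommGroup F] [InnerProductSpace ℂ F] [CompleteSpace F]

theorem trace_eq_orthonormal {A : E →L[ℂ] E} (hA : A.IsPositive) {g : κ → E}
    (hg : Orthonormal ℂ g) (h0 : ∀ f, (∀ k, (inner ℂ (g k) f : ℂ) = 0) → qf A f = 0) :
    traceENN A = ∑' k, ENNReal.ofReal (qf A (g k)) := by
  obtain ⟨w, b, hw, hb⟩ := hg.toSubtypeRange.exists_hilbertBasis_extension
  rw [trace_eq hA b]
  have hmem : ∀ k, g k ∈ w := fun k => hw ⟨k, rfl⟩
  have hinj : Function.Injective fun k => (⟨g k, hmem k⟩ : w) :=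
    fun i j hij => hg.linearIndependent.injective (congrArg Subtype.val hij)
  rw [← hinj.tsum_eq (f := fun i => ENNReal.ofReal (qf A (b i)))]
  · rw [hb]
  · intro i hi
    by_contra h
    refine hi ?_
    simp only
    rw [h0, ENNReal.ofReal_zero]
    intro k
    have hne : (⟨g k, hmem k⟩ : w) ≠ i := fun hki => h ⟨k, hki⟩
    have := b.orthonormal.2 hne
    rwa [hb] at this ⊢

theorem tsum_le_traceNorm (D : E →L[ℂ] E) {g : κ → E} (hg : Orthonormal ℂ g) :
    ∑' k, ENNReal.ofReal ‖(inner ℂ (g k) (D (g k)) : ℂ)‖ ≤ traceNorm D := by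
  rw [ENNReal.tsum_eq_iSup_sum]
  refine iSup_le fun t => ?_
  have he : Orthonormal ℂ fun i : Fin t.card => g (t.equivFin.symm i) :=
    hg.comp _ (Subtype.val_injective.comp t.equivFin.symm.injective)
  refine le_trans (le_of_eq ?_) (le_iSup₂_of_le t.card (fun i => g (t.equivFin.symm i))
    (le_iSup₂_of_le (fun i => g (t.equivFin.symm i)) he (le_iSup_of_le he le_rfl)))
  rw [← Finset.sum_coe_sort]
  exact (Equiv.sum_comp t.equivFin.symm
    fun i : t => ENNReal.ofReal ‖(inner ℂ (g i) (D (g i)) : ℂ)‖).symm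

theorem traceNorm_sub_comm (A B : E →L[ℂ] E) : traceNorm (A - B) = traceNorm (B - A) := by
  rw [← neg_sub]
  simp only [traceNorm, _root_.neg_apply, inner_neg_right, norm_neg]

theorem trace_le_traceNorm_sub {P N : E →L[ℂ] E} (hP : P.IsPositive) (hNP : N ∘L P = 0) :
    traceENN P ≤ traceNorm (P - N) := by
  set U := (LinearMap.range (P : E →ₗ[ℂ] E)).topologicalClosure with hU
  have hPU : ∀ x, P x ∈ U := fun x => Submodule.le_topologicalClosure _ ⟨x, rfl⟩
  have hNU : ∀ x ∈ U, N x = 0 := by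
    intro x hx
    have hcl : IsClosed {x | N x = 0} := isClosed_eq N.continuous continuous_const
    have : closure (LinearMap.range (P : E →ₗ[ℂ] E) : Set E) ⊆ {x | N x = 0} := by
      refine closure_minimal ?_ hcl
      rintro _ ⟨y, rfl⟩
      exact DFunLike.congr_fun hNP y
    exact this hx
  obtain ⟨w, b, -⟩ := exists_hilbertBasis ℂ U
  have hg : Orthonormal ℂ fun i => ((b i : U) : E) := b.orthonormal.comp_linearIsometry U.subtypeₗᵢ
  rw [trace_eq_orthonormal hP hg]
  · refine le_trans (ENNReal.tsum_le_tsum fun k => ENNReal.ofReal_le_ofReal ?_)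
      (tsum_le_traceNorm (P - N) hg)
    rw [_root_.sub_apply, hNU _ (b k).2, sub_zero]
    exact Complex.re_le_norm _
  · intro f hf
    have hz : U.orthogonalProjectionOnto f = 0 := by
      rw [← nsq_eq_zero, ← parseval b, ENNReal.tsum_eq_zero]
      intro i
      have h1 : (inner ℂ (b i) (U.orthogonalProjectionOnto f) : ℂ) = inner ℂ ((b i : U) : E) f := by
        rw [Submodule.inner_orthogonalProjectionOnto_eq_of_mem_left]
      rw [ip, h1, hf i]
      simp
    have h2 : (inner ℂ (⟨P f, hPU f⟩ : U) (U.orthogonalProjectionOnto f) : ℂ) =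
        inner ℂ (P f) f := by
      rw [Submodule.inner_orthogonalProjectionOnto_eq_of_mem_left]
    rw [hz, inner_zero_right] at h2
    rw [qf, inner_eq_zero_of_qf hP, ← h2]
    rfl

/-- Jordan decomposition of a difference of positive operators. -/
theorem exists_jordan {A B : E →L[ℂ] E} (hA : A.IsPositive) (hB : B.IsPositive) :
    ∃ P N : E →L[ℂ] E, P.IsPositive ∧ N.IsPositive ∧ B + N = A + P ∧
      traceENN P ≤ traceNorm (B - A) ∧ traceENN N ≤ traceNorm (B - A) := by
  set D := B - A with hD
  have hsa : IsSelfAdjoint D := hB.isSelfAdjoint.sub hA.isSelfAdjoint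
  have h1 : D⁺ - D⁻ = D := CFC.posPart_sub_negPart D hsa
  have hP : (D⁺).IsPositive :=
    (ContinuousLinearMap.nonneg_iff_isPositive _).1 (CFC.posPart_nonneg D)
  have hN : (D⁻).IsPositive :=
    (ContinuousLinearMap.nonneg_iff_isPositive _).1 (CFC.negPart_nonneg D)
  have hNP : D⁻ ∘L D⁺ = 0 := CFC.negPart_mul_posPart D
  have hPN : D⁺ ∘L D⁻ = 0 := CFC.posPart_mul_negPart D
  refine ⟨D⁺, D⁻, hP, hN, ?_, ?_, ?_⟩
  · have : B - A = D⁺ - D⁻ := h1.symm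
    rw [sub_eq_sub_iff_add_eq_add] at this
    rw [this, add_comm]
  · simpa [h1] using trace_le_traceNorm_sub hP hNP
  · have := trace_le_traceNorm_sub hN hPN
    rwa [traceNorm_sub_comm, h1] at this

/-- The orthogonal projection onto the span of finitely many basis vectors. -/
def bproj (b : HilbertBasis ι ℂ E) (t : Finset ι) : E →L[ℂ] E := ∑ i ∈ t, rankOne (b i)

theorem bproj_apply (b : HilbertBasis ι ℂ E) (t : Finset ι) (x : E) :
    bproj b t x = ∑ i ∈ t, (inner ℂ (b i) x : ℂ) • b i := by
  simp [bproj, rankOne, _root_.sum_apply]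

theorem inner_bproj (b : HilbertBasis ι ℂ E) (t : Finset ι) (i : ι) (x : E) :
    (inner ℂ (b i) (bproj b t x) : ℂ) = if i ∈ t then inner ℂ (b i) x else 0 := by
  rw [bproj_apply, inner_sum]
  simp_rw [inner_smul_right, orthonormal_iff_ite.1 b.orthonormal i]
  simp

theorem bproj_adjoint (b : HilbertBasis ι ℂ E) (t : Finset ι) :
    adjoint (bproj b t) = bproj b t := by
  refine ContinuousLinearMap.ext fun y => ext_inner_left ℂ fun x => ?_
  rw [ContinuousLinearMap.adjoint_inner_right, bproj_apply, bproj_apply, sum_inner, inner_sum]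
  refine Finset.sum_congr rfl fun i _ => ?_
  rw [inner_smul_left, inner_smul_right, inner_conj_symm, mul_comm]

theorem bproj_comp_self (b : HilbertBasis ι ℂ E) (t : Finset ι) :
    bproj b t ∘L bproj b t = bproj b t := by
  refine ContinuousLinearMap.ext fun x => ?_
  rw [ContinuousLinearMap.comp_apply, bproj_apply b t (bproj b t x), bproj_apply b t x]
  refine Finset.sum_congr rfl fun i hi => ?_
  rw [← bproj_apply, inner_bproj, if_pos hi]

theorem norm_sq_of_projection {P : E →L[ℂ] E} (hP : adjoint P = P) (hPP : P ∘L P = P) (x : E) :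
    qf P x = ‖P x‖ ^ 2 := by
  conv_lhs => rw [← hPP]
  exact qf_eq_norm_sqrt hP x

theorem norm_le_one_of_projection {P : E →L[ℂ] E} (hP : adjoint P = P) (hPP : P ∘L P = P) :
    ‖P‖ ≤ 1 := by
  refine P.opNorm_le_bound zero_le_one fun x => ?_
  have h1 := norm_sq_of_projection hP hPP x
  have h2 : qf P x ≤ ‖x‖ * ‖P x‖ := (Complex.re_le_norm _).trans (norm_inner_le_norm _ _)
  rw [one_mul]
  rcases (norm_nonneg (P x)).eq_or_lt with h | h
  · rw [← h]; exact norm_nonneg _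
  · nlinarith

theorem adjoint_one_sub {P : E →L[ℂ] E} (hP : adjoint P = P) : adjoint (1 - P) = 1 - P := by
  rw [map_sub, hP]
  congr 1
  exact ContinuousLinearMap.adjoint_id

theorem norm_one_sub_le_one_of_projection {P : E →L[ℂ] E} (hP : adjoint P = P)
    (hPP : P ∘L P = P) : ‖1 - P‖ ≤ 1 := by
  refine norm_le_one_of_projection (adjoint_one_sub hP) ?_
  have h : P * P = P := hPP
  change (1 - P) * (1 - P) = 1 - P
  rw [mul_sub, sub_mul, sub_mul, h]; simp

theorem nsq_one_sub_bproj (b : HilbertBasis ι ℂ E) (t : Finset ι) (x : E) :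
    nsq ((1 - bproj b t) x) = ∑' i : {i // i ∉ t}, ip (b i) x := by
  rw [← parseval b, ← tsum_subtype_eq_of_support_subset (s := {i | i ∉ t})]
  · refine tsum_congr fun i => ?_
    rw [ip, ip, _root_.sub_apply, inner_sub_right, inner_bproj, if_neg i.2]
    simp
  · intro i hi hit
    refine hi ?_
    simp only
    rw [ip, _root_.sub_apply, inner_sub_right, inner_bproj, if_pos hit]
    simp

theorem tendsto_nsq_one_sub_bproj (b : HilbertBasis ι ℂ E) (x : E) :
    Tendsto (fun t => nsq ((1 - bproj b t) x)) atTop (𝓝 0) := by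
  simp_rw [nsq_one_sub_bproj]
  exact ENNReal.tendsto_tsum_compl_atTop_zero (by rw [parseval b]; exact nsq_ne_top x)

theorem tendsto_trace_one_sub_bproj {A : E →L[ℂ] E} (hA : A.IsPositive) (ht : traceENN A ≠ ∞)
    (b : HilbertBasis ι ℂ E) :
    Tendsto (fun t => traceENN ((1 - bproj b t) ∘L A ∘L adjoint (1 - bproj b t)))
      atTop (𝓝 0) := by
  obtain ⟨s, y, h⟩ := exists_rep hA
  have h1 : ∀ t, traceENN ((1 - bproj b t) ∘L A ∘L adjoint (1 - bproj b t))
      = ∑' i : {i // i ∉ t}, ENNReal.ofReal (qf A (b i)) := fun t => by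
    rw [(h.conj _).trace]
    simp_rw [nsq_one_sub_bproj, h.eq]
    rw [ENNReal.tsum_comm]
    simp_rw [ip_comm]
  simp_rw [h1]
  exact ENNReal.tendsto_tsum_compl_atTop_zero (by rwa [← trace_eq hA b])

theorem tendsto_qEntropy_one_sub_bproj {A : E →L[ℂ] E} (hA : A.IsPositive) (ht : traceENN A ≠ ∞)
    (hH : qEntropy A ≠ ∞) (b : HilbertBasis ι ℂ E) :
    Tendsto (fun t => qEntropy ((1 - bproj b t) ∘L A ∘L adjoint (1 - bproj b t)))
      atTop (𝓝 0) := by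
  obtain ⟨s, y, h, -, he, -⟩ := exists_spectral_rep hA ht
  refine tendsto_of_tendsto_of_tendsto_of_le_of_le tendsto_const_nhds
    (tendsto_ent_zero (x := fun i => nsq (y i)) (y := fun t i => nsq ((1 - bproj b t) (y i)))
      (by rwa [← h.trace]) (by rwa [he]) (fun t i => ?_)
      fun i => tendsto_nsq_one_sub_bproj b (y i))
    (fun t => bot_le) (fun t => (h.conj _).qEntropy_le (trace_conj_ne_top hA ht _))
  refine (nsq_apply_le _ _).trans (mul_le_of_le_one_left' ?_)
  rw [← ENNReal.ofReal_one]
  exact ENNReal.ofReal_le_ofReal (pow_le_one₀ (norm_nonneg _)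
    (norm_one_sub_le_one_of_projection (bproj_adjoint b t) (bproj_comp_self b t)))

theorem isPositive_bproj (b : HilbertBasis ι ℂ E) (t : Finset ι) : (bproj b t).IsPositive :=
  isPositive_of_qf (bproj_adjoint b t) fun x => by
    rw [norm_sq_of_projection (bproj_adjoint b t) (bproj_comp_self b t)]; positivity

theorem trace_bproj_ne_top (b : HilbertBasis ι ℂ E) (t : Finset ι) :
    traceENN (bproj b t) ≠ ∞ := by
  rw [trace_eq (isPositive_bproj b t) b, tsum_eq_sum (s := t)]
  · exact ENNReal.sum_ne_top.2 fun _ _ => ENNReal.ofReal_ne_top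
  · intro i hi
    simp [qf, inner_bproj, hi]

theorem qEntropy_bproj_le (b : HilbertBasis ι ℂ E) (t : Finset ι) {A : E →L[ℂ] E}
    (hA : A.IsPositive) (ht : traceENN A ≠ ∞) :
    qEntropy (bproj b t ∘L A ∘L adjoint (bproj b t)) ≤
      ENNReal.ofReal (Real.log t.card) * traceENN A := by
  refine (qEntropy_le_log_card (κ := t) (g := fun k => b k) (isPositive_conj hA _)
    (trace_conj_ne_top hA ht _) (b.orthonormal.comp _ Subtype.val_injective) (fun f hf => ?_)
    (n := t.card) (by simp)).trans ?_
  · rw [qf_conj, bproj_adjoint, bproj_apply, Finset.sum_eq_zero]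
    · simp [qf]
    · intro i hi
      rw [hf ⟨i, hi⟩, zero_smul]
  · gcongr
    refine (trace_conj_le hA _).trans (mul_le_of_le_one_left' ?_)
    rw [← ENNReal.ofReal_one]
    exact ENNReal.ofReal_le_ofReal (pow_le_one₀ (norm_nonneg _)
      (norm_le_one_of_projection (bproj_adjoint b t) (bproj_comp_self b t)))

end Approximation

section Continuity

open ContinuousLinearMap (adjoint)

variable {E F ι κ : Type*}
variable [NormedAddCommGroup E] [InnerProductSpace ℂ E] [CompleteSpace E]
variable [NormedAddCommGroup F] [InnerProductSpace ℂ F] [CompleteSpace F]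

theorem qf_add_vec_le {A : E →L[ℂ] E} (hA : A.IsPositive) {ε : ℝ} (hε : 0 < ε) (x y : E) :
    qf A (x + y) ≤ (1 + ε) * qf A x + (1 + 1 / ε) * qf A y := by
  obtain ⟨R, -, rfl, hR⟩ := exists_sqrt hA
  simp_rw [qf_eq_norm_sqrt hR, map_add]
  have h1 := norm_add_le (R x) (R y)
  have h2 : ‖R x + R y‖ ^ 2 ≤ (‖R x‖ + ‖R y‖) ^ 2 := by gcongr
  refine h2.trans ?_
  have h3 : 0 ≤ (ε * ‖R x‖ - ‖R y‖) ^ 2 / ε := by positivity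
  have h4 : (ε * ‖R x‖ - ‖R y‖) ^ 2 / ε
      = ε * ‖R x‖ ^ 2 - 2 * ‖R x‖ * ‖R y‖ + 1 / ε * ‖R y‖ ^ 2 := by
    field_simp
    ring
  nlinarith

/-- Pinching inequality for quadratic forms. -/
theorem qf_pinch_le {A : E →L[ℂ] E} (hA : A.IsPositive) {Q : E →L[ℂ] E} (hQ : adjoint Q = Q)
    {ε : ℝ} (hε : 0 < ε) (x : E) :
    qf A x ≤ (1 + ε) * qf (Q ∘L A ∘L adjoint Q) x
      + (1 + 1 / ε) * qf ((1 - Q) ∘L A ∘L adjoint (1 - Q)) x := by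
  rw [qf_conj, qf_conj, adjoint_one_sub hQ, hQ]
  have h : x = Q x + (1 - Q) x := by simp
  conv_lhs => rw [h]
  exact qf_add_vec_le hA hε _ _

theorem qEntropy_le_split {A Q : E →L[ℂ] E} (hA : A.IsPositive) (hA1 : traceENN A ≤ 1)
    (hQ : adjoint Q = Q) (hQQ : Q ∘L Q = Q) {ε β : ℝ} (hε : 0 < ε) (hβ : 0 ≤ β)
    (ht : traceENN ((1 - Q) ∘L A ∘L adjoint (1 - Q)) ≤ ENNReal.ofReal β) :
    qEntropy A ≤ ENNReal.ofReal (1 + ε) * qEntropy (Q ∘L A ∘L adjoint Q)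
      + ENNReal.ofReal (1 + 1 / ε) * qEntropy ((1 - Q) ∘L A ∘L adjoint (1 - Q))
      + ENNReal.ofReal ((1 + 1 / ε) * β + 2 * √((1 + ε) * ((1 + 1 / ε) * β))) := by
  have hAt : traceENN A ≠ ∞ := ne_top_of_le_ne_top ENNReal.one_ne_top hA1
  set B := Q ∘L A ∘L adjoint Q
  set C := (1 - Q) ∘L A ∘L adjoint (1 - Q)
  have hB : B.IsPositive := isPositive_conj hA Q
  have hC : C.IsPositive := isPositive_conj hA (1 - Q)
  have hBt : traceENN B ≠ ∞ := trace_conj_ne_top hA hAt Q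
  have hCt : traceENN C ≠ ∞ := trace_conj_ne_top hA hAt (1 - Q)
  have hB1 : traceENN B ≤ 1 := by
    refine (trace_conj_le hA Q).trans (mul_le_one' ?_ hA1)
    rw [← ENNReal.ofReal_one]
    exact ENNReal.ofReal_le_ofReal (pow_le_one₀ (norm_nonneg _) (norm_le_one_of_projection hQ hQQ))
  have h1 : 0 ≤ 1 + ε := by positivity
  have h2 : 0 ≤ 1 + 1 / ε := by positivity
  have hcB := trace_smul hB h1
  have hcC := trace_smul hC h2
  have hcBt : traceENN (((1 + ε : ℝ) : ℂ) • B) ≠ ∞ := by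
    rw [hcB]; exact ENNReal.mul_ne_top ENNReal.ofReal_ne_top hBt
  have hcCt : traceENN (((1 + 1 / ε : ℝ) : ℂ) • C) ≠ ∞ := by
    rw [hcC]; exact ENNReal.mul_ne_top ENNReal.ofReal_ne_top hCt
  have hmono : qEntropy A ≤ qEntropy (((1 + ε : ℝ) : ℂ) • B + ((1 + 1 / ε : ℝ) : ℂ) • C) := by
    refine qEntropy_mono hA ((isPositive_smul hB h1).add (isPositive_smul hC h2)) (fun f => ?_) ?_
    · rw [qf_add, qf_smul, qf_smul]
      exact qf_pinch_le hA hQ hε f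
    · rw [trace_add (isPositive_smul hB h1) (isPositive_smul hC h2)]
      exact ENNReal.add_ne_top.2 ⟨hcBt, hcCt⟩
  refine hmono.trans ((qEntropy_add_le (isPositive_smul hB h1) (isPositive_smul hC h2) hcBt hcCt
    (a := 1 + ε) (b := (1 + 1 / ε) * β) ?_ ?_ h1 (by positivity)).trans ?_)
  · rw [hcB]; exact mul_le_of_le_one_right' hB1
  · rw [hcC, ENNReal.ofReal_mul h2]; gcongr
  · gcongr
    · exact qEntropy_smul_le hB hBt h1
    · exact qEntropy_smul_le hC hCt h2

variable {V : ℕ → (E →L[ℂ] F)}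

theorem qf_state_le {σ : E →L[ℂ] E} (hσ : σ ∈ states E) (x : E) : qf σ x ≤ ‖x‖ ^ 2 := by
  have := qf_le_trace hσ.1 x
  rw [hσ.2, one_mul, nsq_eq] at this
  exact (ENNReal.ofReal_le_ofReal_iff (by positivity)).1 this

/-- A state with small tail outside a finite-rank projection `P` has an output dominated by
`2 (Φ(P) + Φ(P̄ σ P̄))`. -/
theorem qf_state_le_pinch {σ P : E →L[ℂ] E} (hσ : σ ∈ states E) (hP : adjoint P = P)
    (hPP : P ∘L P = P) (x : E) :
    qf σ x ≤ 2 * (qf P x + qf ((1 - P) ∘L σ ∘L adjoint (1 - P)) x) := by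
  have h := qf_pinch_le hσ.1 hP one_pos x
  have h2 : qf (P ∘L σ ∘L adjoint P) x ≤ qf P x := by
    rw [qf_conj, norm_sq_of_projection hP hPP, hP]
    exact qf_state_le hσ _
  linarith

theorem KrausTNI.qEntropy_tail_le (hV : KrausTNI V) {K : ℝ} (hK0 : 0 ≤ K)
    (hK : ∀ σ : E →L[ℂ] E, σ.IsPositive → traceENN σ ≠ ∞ →
      qEntropy (krausMap V σ) ≤ ENNReal.ofReal K * traceENN σ)
    {P : E →L[ℂ] E} {R : F →L[ℂ] F} (hP : adjoint P = P) (hPP : P ∘L P = P)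
    (hPpos : P.IsPositive) (hPt : traceENN P ≠ ∞) (hR : ‖R‖ ≤ 1) {c : ℝ} (hc : 0 ≤ c)
    (h1 : traceENN (R ∘L krausMap V P ∘L adjoint R) ≤ ENNReal.ofReal c)
    (h2 : qEntropy (R ∘L krausMap V P ∘L adjoint R) ≤ ENNReal.ofReal c)
    {σ : E →L[ℂ] E} (hσ : σ ∈ states E)
    (h3 : traceENN ((1 - P) ∘L σ ∘L adjoint (1 - P)) ≤ ENNReal.ofReal (2 * c)) :
    traceENN (R ∘L krausMap V σ ∘L adjoint R) ≤ ENNReal.ofReal (6 * c) ∧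
    qEntropy (R ∘L krausMap V σ ∘L adjoint R) ≤ ENNReal.ofReal ((4 * K + 14) * c) := by
  have hσt : traceENN σ ≠ ∞ := by rw [hσ.2]; exact ENNReal.one_ne_top
  set T := (1 - P) ∘L σ ∘L adjoint (1 - P)
  have hT : T.IsPositive := isPositive_conj hσ.1 _
  have hTt : traceENN T ≠ ∞ := trace_conj_ne_top hσ.1 hσt _
  have hpos := hV.pos hPpos hPt
  have hTpos := hV.pos hT hTt
  set X := R ∘L krausMap V P ∘L adjoint R
  set Y := R ∘L krausMap V T ∘L adjoint R
  have hX : X.IsPositive := isPositive_conj hpos R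
  have hY : Y.IsPositive := isPositive_conj hTpos R
  have hXt : traceENN X ≠ ∞ := ne_top_of_le_ne_top ENNReal.ofReal_ne_top h1
  have hR2 : ENNReal.ofReal (‖R‖ ^ 2) ≤ 1 := by
    rw [← ENNReal.ofReal_one]
    exact ENNReal.ofReal_le_ofReal (pow_le_one₀ (norm_nonneg _) hR)
  have hY2 : traceENN Y ≤ ENNReal.ofReal (2 * c) :=
    (trace_conj_le hTpos R).trans
      ((mul_le_of_le_one_left' hR2).trans ((hV.trace_le hT hTt).trans h3))
  have hYt : traceENN Y ≠ ∞ := ne_top_of_le_ne_top ENNReal.ofReal_ne_top hY2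
  have hXYt : traceENN (X + Y) ≠ ∞ := by
    rw [trace_add hX hY]; exact ENNReal.add_ne_top.2 ⟨hXt, hYt⟩
  have hle : ∀ f, qf (R ∘L krausMap V σ ∘L adjoint R) f ≤ qf (((2 : ℝ) : ℂ) • (X + Y)) f := by
    intro f
    rw [qf_smul, qf_add, qf_conj, qf_conj, qf_conj]
    have hPT : traceENN (P + T) ≠ ∞ := by
      rw [trace_add hPpos hT]; exact ENNReal.add_ne_top.2 ⟨hPt, hTt⟩
    have := hV.mono hσ.1 (isPositive_smul (hPpos.add hT) zero_le_two)
      (by rw [trace_smul (hPpos.add hT) zero_le_two]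
          exact ENNReal.mul_ne_top ENNReal.ofReal_ne_top hPT)
      (fun x => by rw [qf_smul, qf_add]; exact qf_state_le_pinch hσ hP hPP x) (adjoint R f)
    rwa [krausMap_smul, hV.map_add hPpos hPt hT hTt, qf_smul, qf_add] at this
  have h2XYt : traceENN (((2 : ℝ) : ℂ) • (X + Y)) ≠ ∞ := by
    rw [trace_smul (hX.add hY) zero_le_two]
    exact ENNReal.mul_ne_top ENNReal.ofReal_ne_top hXYt
  constructor
  · refine (trace_mono hle).trans ?_
    rw [trace_smul (hX.add hY) zero_le_two, trace_add hX hY]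
    calc _ ≤ ENNReal.ofReal 2 * (ENNReal.ofReal c + ENNReal.ofReal (2 * c)) := by gcongr
      _ = ENNReal.ofReal (6 * c) := by
        rw [← ENNReal.ofReal_add hc (by positivity), ← ENNReal.ofReal_mul zero_le_two]
        congr 1; ring
  · refine (QIT.qEntropy_mono (isPositive_conj (hV.pos hσ.1 hσt) R)
      (isPositive_smul (hX.add hY) zero_le_two) hle h2XYt).trans ?_
    refine (QIT.qEntropy_smul_le (hX.add hY) hXYt zero_le_two).trans ?_
    have hYH : qEntropy Y ≤ ENNReal.ofReal (K * (2 * c)) := by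
      refine (qEntropy_conj_le hTpos (hV.trace_ne_top hT hTt) hR).trans ((hK T hT hTt).trans ?_)
      rw [ENNReal.ofReal_mul hK0]
      gcongr
    have := qEntropy_add_le hX hY hXt hYt h1 hY2 hc (by positivity)
    calc _ ≤ ENNReal.ofReal 2 * (ENNReal.ofReal c + ENNReal.ofReal (K * (2 * c))
          + ENNReal.ofReal (2 * c + 2 * √(c * (2 * c)))) := by
          gcongr
          exact this.trans (by gcongr)
      _ = ENNReal.ofReal (2 * (c + K * (2 * c) + (2 * c + 2 * √(c * (2 * c))))) := by
        rw [← ENNReal.ofReal_add hc (by positivity), ← ENNReal.ofReal_add (by positivity)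
          (by positivity), ← ENNReal.ofReal_mul zero_le_two]
      _ ≤ _ := by
        refine ENNReal.ofReal_le_ofReal ?_
        have hs : √(c * (2 * c)) ≤ 2 * c := by
          rw [Real.sqrt_le_left (by positivity)]
          nlinarith
        nlinarith

theorem KrausTNI.qEntropy_bproj_le (hV : KrausTNI V) (b : HilbertBasis ι ℂ F) (t : Finset ι)
    {σ τ : E →L[ℂ] E} (hσ : σ ∈ states E) (hτ : τ ∈ states E) {δ : ℝ} (hδ : 0 ≤ δ)
    (hd : traceNorm (σ - τ) ≤ ENNReal.ofReal δ) :
    qEntropy (bproj b t ∘L krausMap V σ ∘L adjoint (bproj b t)) ≤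
      qEntropy (krausMap V τ) + ENNReal.ofReal (Real.log t.card * δ + (δ + 2 * √δ)) := by
  have hσt : traceENN σ ≠ ∞ := by rw [hσ.2]; exact ENNReal.one_ne_top
  have hτt : traceENN τ ≠ ∞ := by rw [hτ.2]; exact ENNReal.one_ne_top
  obtain ⟨P, N, hP, hN, heq, hPt, -⟩ := exists_jordan hτ.1 hσ.1
  have hPδ := hPt.trans hd
  have hPt' : traceENN P ≠ ∞ := ne_top_of_le_ne_top ENNReal.ofReal_ne_top hPδ
  set R := bproj b t with hRdef
  have hR : ‖R‖ ≤ 1 := norm_le_one_of_projection (bproj_adjoint b t) (bproj_comp_self b t)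
  have hR2 : ENNReal.ofReal (‖R‖ ^ 2) ≤ 1 := by
    rw [← ENNReal.ofReal_one]
    exact ENNReal.ofReal_le_ofReal (pow_le_one₀ (norm_nonneg _) hR)
  have hτp := hV.pos hτ.1 hτt
  have hPp := hV.pos hP hPt'
  set X := R ∘L krausMap V τ ∘L adjoint R
  set Y := R ∘L krausMap V P ∘L adjoint R
  have hX : X.IsPositive := isPositive_conj hτp R
  have hY : Y.IsPositive := isPositive_conj hPp R
  have hX1 : traceENN X ≤ ENNReal.ofReal 1 := by
    refine (trace_conj_le hτp R).trans ((mul_le_of_le_one_left' hR2).trans ?_)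
    rw [ENNReal.ofReal_one, ← hτ.2]
    exact hV.trace_le hτ.1 hτt
  have hY1 : traceENN Y ≤ ENNReal.ofReal δ :=
    (trace_conj_le hPp R).trans ((mul_le_of_le_one_left' hR2).trans
      ((hV.trace_le hP hPt').trans hPδ))
  have hXt : traceENN X ≠ ∞ := ne_top_of_le_ne_top ENNReal.ofReal_ne_top hX1
  have hYt : traceENN Y ≠ ∞ := ne_top_of_le_ne_top ENNReal.ofReal_ne_top hY1
  have hle : ∀ f, qf (R ∘L krausMap V σ ∘L adjoint R) f ≤ qf (X + Y) f := by
    intro f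
    rw [qf_add, qf_conj, qf_conj, qf_conj]
    have := hV.mono hσ.1 (hτ.1.add hP)
      (by rw [trace_add hτ.1 hP]; exact ENNReal.add_ne_top.2 ⟨hτt, hPt'⟩)
      (fun x => by
        have h1 := qf_nonneg hN x
        have h2 := qf_add σ N x
        rw [heq] at h2
        linarith) (adjoint R f)
    rwa [hV.map_add hτ.1 hτt hP hPt', qf_add] at this
  refine (QIT.qEntropy_mono (isPositive_conj (hV.pos hσ.1 hσt) R) (hX.add hY) hle
    (by rw [trace_add hX hY]; exact ENNReal.add_ne_top.2 ⟨hXt, hYt⟩)).trans ?_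
  refine (qEntropy_add_le hX hY hXt hYt hX1 hY1 zero_le_one hδ).trans ?_
  have hlog : 0 ≤ Real.log t.card := Real.log_natCast_nonneg _
  rw [one_mul, ENNReal.ofReal_add (p := Real.log t.card * δ) (by positivity) (by positivity),
    ← add_assoc]
  gcongr ?_ + ?_ + _
  · exact qEntropy_conj_le hτp (hV.trace_ne_top hτ.1 hτt) hR
  · rw [ENNReal.ofReal_mul hlog]
    refine (QIT.qEntropy_bproj_le b t hPp (hV.trace_ne_top hP hPt')).trans ?_
    gcongr
    exact (hV.trace_le hP hPt').trans hPδ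

theorem exists_pos_lt {f : ℝ → ℝ} (hf : Continuous f) (h0 : f 0 = 0) {η r : ℝ} (hη : 0 < η)
    (hr : 0 < r) : ∃ c > 0, f c < η ∧ c < r := by
  have h1 : ∀ᶠ c in 𝓝[>] (0 : ℝ), f c < η :=
    ((hf.tendsto 0).mono_left nhdsWithin_le_nhds).eventually_lt_const (by rwa [h0])
  obtain ⟨c, hc, hc0⟩ := (h1.and (Ioo_mem_nhdsGT hr)).exists
  exact ⟨c, hc0.1, hc, hc0.2⟩

theorem trace_conj_le_of_traceNorm {σ ρ X : E →L[ℂ] E} (hσ : σ.IsPositive) (hρ : ρ.IsPositive)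
    (hX : ‖X‖ ≤ 1) : traceENN (X ∘L σ ∘L adjoint X) ≤
      traceENN (X ∘L ρ ∘L adjoint X) + traceNorm (σ - ρ) := by
  obtain ⟨P, N, hP, hN, heq, hPt, -⟩ := exists_jordan hρ hσ
  calc _ ≤ traceENN (X ∘L ρ ∘L adjoint X + X ∘L P ∘L adjoint X) := trace_mono fun f => by
        rw [qf_add, qf_conj, qf_conj, qf_conj]
        have h1 := qf_nonneg hN (adjoint X f)
        have h2 := qf_add σ N (adjoint X f)
        rw [heq, qf_add] at h2
        linarith
    _ = traceENN (X ∘L ρ ∘L adjoint X) + traceENN (X ∘L P ∘L adjoint X) :=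
        trace_add (isPositive_conj hρ X) (isPositive_conj hP X)
    _ ≤ _ := by
        gcongr
        refine (trace_conj_le hP X).trans ((mul_le_of_le_one_left' ?_).trans hPt)
        rw [← ENNReal.ofReal_one]
        exact ENNReal.ofReal_le_ofReal (pow_le_one₀ (norm_nonneg _) hX)

/-- Finiteness of the output entropy on all states implies its continuity. -/
theorem KrausTNI.contOn (hV : KrausTNI V) (h : ∀ ρ ∈ states E, qEntropy (krausMap V ρ) ≠ ∞) :
    ContOn (fun ρ => qEntropy (krausMap V ρ)) (states E) := by
  refine ⟨h, fun ρ hρ ε₀ hε₀ => ?_⟩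
  obtain ⟨K, hK0, hK⟩ := hV.exists_bound h
  obtain ⟨_, bE, -⟩ := exists_hilbertBasis ℂ E
  obtain ⟨_, bF, -⟩ := exists_hilbertBasis ℂ F
  obtain ⟨ε, hε, hεK, -⟩ := exists_pos_lt (f := fun ε => ε * K) (by fun_prop) (by simp)
    (show 0 < ε₀ / 4 by positivity) one_pos
  obtain ⟨c, hc, hfc, -⟩ := exists_pos_lt
    (f := fun c => (1 + 1 / ε) * ((4 * K + 14) * c) +
      ((1 + 1 / ε) * (6 * c) + 2 * √((1 + ε) * ((1 + 1 / ε) * (6 * c)))))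
    (by fun_prop) (by simp) (show 0 < ε₀ / 4 by positivity) one_pos
  have hcpos : (0 : ℝ≥0∞) < ENNReal.ofReal c := ENNReal.ofReal_pos.2 hc
  have hρt : traceENN ρ ≠ ∞ := by rw [hρ.2]; exact ENNReal.one_ne_top
  obtain ⟨t, ht⟩ := ((tendsto_trace_one_sub_bproj hρ.1 hρt bE).eventually_lt_const hcpos).exists
  set P := bproj bE t
  have hP : adjoint P = P := bproj_adjoint bE t
  have hPP : P ∘L P = P := bproj_comp_self bE t
  have hPpos : P.IsPositive := isPositive_bproj bE t
  have hPt : traceENN P ≠ ∞ := trace_bproj_ne_top bE t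
  have hΦP := hV.pos hPpos hPt
  have hΦPt := hV.trace_ne_top hPpos hPt
  have hΦPH : qEntropy (krausMap V P) ≠ ∞ := ne_top_of_le_ne_top
    (ENNReal.mul_ne_top ENNReal.ofReal_ne_top hPt) (hK P hPpos hPt)
  obtain ⟨s, hs1, hs2⟩ := (((tendsto_trace_one_sub_bproj hΦP hΦPt bF).eventually_lt_const
    hcpos).and ((tendsto_qEntropy_one_sub_bproj hΦP hΦPt hΦPH bF).eventually_lt_const
    hcpos)).exists
  set Q := bproj bF s
  have hQ : adjoint Q = Q := bproj_adjoint bF s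
  have hQQ : Q ∘L Q = Q := bproj_comp_self bF s
  obtain ⟨δ, hδ, hgδ, hδc⟩ := exists_pos_lt
    (f := fun δ => (1 + ε) * (Real.log s.card * δ + (δ + 2 * √δ)))
    (by fun_prop) (by simp) (show 0 < ε₀ / 4 by positivity) hc
  have hlog : 0 ≤ Real.log s.card := Real.log_natCast_nonneg _
  have key : ∀ σ ∈ states E, ∀ τ ∈ states E, traceNorm (σ - τ) ≤ ENNReal.ofReal δ →
      traceENN ((1 - P) ∘L σ ∘L adjoint (1 - P)) ≤ ENNReal.ofReal (2 * c) →
      (qEntropy (krausMap V σ)).toReal < (qEntropy (krausMap V τ)).toReal + ε₀ := by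
    intro σ hσ τ hτ hd htail
    have hσt : traceENN σ ≠ ∞ := by rw [hσ.2]; exact ENNReal.one_ne_top
    obtain ⟨h1, h2⟩ := hV.qEntropy_tail_le hK0 hK hP hPP hPpos hPt
      (norm_one_sub_le_one_of_projection hQ hQQ) hc.le hs1.le hs2.le hσ htail
    have h3 := hV.qEntropy_bproj_le bF s hσ hτ hδ.le hd
    have h4 := qEntropy_le_split (hV.pos hσ.1 hσt) ((hV.trace_le hσ.1 hσt).trans_eq hσ.2) hQ hQQ hε
      (by positivity) h1
    have hτK := hK τ hτ.1 (by rw [hτ.2]; exact ENNReal.one_ne_top)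
    rw [hτ.2, mul_one] at hτK
    have hτK' := ENNReal.toReal_le_of_le_ofReal hK0 hτK
    set x := (qEntropy (krausMap V τ)).toReal with hx
    have hx0 : 0 ≤ x := ENNReal.toReal_nonneg
    rw [← ENNReal.ofReal_toReal (h τ hτ), ← hx, ← ENNReal.ofReal_add hx0 (by positivity)] at h3
    have h5 : qEntropy (krausMap V σ) ≤ ENNReal.ofReal
        ((1 + ε) * (x + (Real.log s.card * δ + (δ + 2 * √δ))) +
          (1 + 1 / ε) * ((4 * K + 14) * c) +
          ((1 + 1 / ε) * (6 * c) + 2 * √((1 + ε) * ((1 + 1 / ε) * (6 * c))))) := by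
      refine h4.trans ?_
      rw [ENNReal.ofReal_add (p := (1 + ε) * (x + (Real.log s.card * δ + (δ + 2 * √δ))) +
          (1 + 1 / ε) * ((4 * K + 14) * c)) (by positivity) (by positivity),
        ENNReal.ofReal_add (p := (1 + ε) * (x + (Real.log s.card * δ + (δ + 2 * √δ))))
          (by positivity) (by positivity),
        ENNReal.ofReal_mul (p := 1 + ε) (q := x + (Real.log s.card * δ + (δ + 2 * √δ)))
          (by positivity),
        ENNReal.ofReal_mul (p := 1 + 1 / ε) (q := (4 * K + 14) * c) (by positivity)]
      gcongr
    have h6 := ENNReal.toReal_le_of_le_ofReal (by positivity) h5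
    have h7 : ε * x ≤ ε * K := by gcongr
    linarith
  refine ⟨δ, hδ, fun σ hσ hd => ?_⟩
  have hP1 := norm_one_sub_le_one_of_projection hP hPP
  have htail : traceENN ((1 - P) ∘L σ ∘L adjoint (1 - P)) ≤ ENNReal.ofReal (2 * c) := by
    refine (trace_conj_le_of_traceNorm hσ.1 hρ.1 hP1).trans ?_
    rw [two_mul, ENNReal.ofReal_add hc.le hc.le]
    gcongr
    exact hd.le.trans (ENNReal.ofReal_le_ofReal hδc.le)
  have k1 := key σ hσ ρ hρ hd.le htail
  have k2 := key ρ hρ σ hσ (by rw [traceNorm_sub_comm]; exact hd.le)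
    (ht.le.trans (ENNReal.ofReal_le_ofReal (by linarith)))
  rw [abs_lt]
  constructor <;> linarith

end Continuity

section ExponentialSums

open ContinuousLinearMap (adjoint)

variable {E F ι : Type*}
variable [NormedAddCommGroup E] [InnerProductSpace ℂ E] [CompleteSpace E]
variable [NormedAddCommGroup F] [InnerProductSpace ℂ F] [CompleteSpace F]

/-- The Gibbs variational bound for the entropy of `V σ V*`. -/
theorem IsSingularValues.qEntropy_conj_le {V : E →L[ℂ] F} {ν : ℕ → ℝ} (hν : IsSingularValues V ν)
    {l c : ℝ} (hl : 0 ≤ l) (hc : 0 ≤ c) (hZ : expSum ν l ≤ ENNReal.ofReal (Real.exp c))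
    {σ : E →L[ℂ] E} (hσ : σ.IsPositive) (ht : traceENN σ ≠ ∞) :
    qEntropy (V ∘L σ ∘L adjoint V) ≤
      ENNReal.ofReal l * traceENN σ + ENNReal.ofReal c * traceENN (V ∘L σ ∘L adjoint V) := by
  obtain ⟨hν0, e, ho, hn, hT, hk⟩ := hν
  have hT' : ∀ i, adjoint V (V (e i)) = ((ν i ^ 2 : ℝ) : ℂ) • e i := fun i => hT i
  have hVo : ∀ i j, i ≠ j → (inner ℂ (V (e i)) (V (e j)) : ℂ) = 0 := fun i j hij => by
    rw [← ContinuousLinearMap.adjoint_inner_right, hT', inner_smul_right, ho i j hij, mul_zero]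
  have hVn : ∀ i, ν i ≠ 0 → ‖V (e i)‖ = ν i := fun i hi => by
    have h1 : ‖V (e i)‖ ^ 2 = ν i ^ 2 := by
      rw [← qf_adjoint_comp_self]
      unfold qf
      rw [ContinuousLinearMap.comp_apply, hT', inner_smul_right, inner_self_eq_norm_sq_to_K,
        (hn i).1 (pow_ne_zero 2 hi)]
      simp [-Complex.ofReal_pow]
    exact (pow_left_inj₀ (norm_nonneg _) (hν0 i) two_ne_zero).1 h1
  set g : {k // ν k ≠ 0} → F := fun k => ((ν k)⁻¹ : ℂ) • V (e k) with hgdef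
  have hg : Orthonormal ℂ g := by
    refine ⟨fun k => ?_, fun k k' hkk => ?_⟩
    · rw [hgdef]
      simp only
      rw [norm_smul, hVn k k.2, norm_inv, Complex.norm_real, Real.norm_of_nonneg (hν0 k),
        inv_mul_cancel₀ k.2]
    · rw [hgdef]
      simp only
      rw [inner_smul_left, inner_smul_right, hVo _ _ fun h => hkk (Subtype.ext h), mul_zero,
        mul_zero]
  have hqg : ∀ k, qf (V ∘L σ ∘L adjoint V) (g k) = ν k ^ 2 * qf σ (e k) := fun k => by
    rw [qf_conj, hgdef]
    simp only
    rw [map_smul, hT', smul_smul, qf_smul_right]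
    congr 1
    rw [norm_mul, norm_inv, Complex.norm_real, Complex.norm_real, Real.norm_of_nonneg (hν0 k),
      Real.norm_of_nonneg (by positivity)]
    have := k.2
    field_simp
  have heo : Orthonormal ℂ fun k : {k // ν k ≠ 0} => e k :=
    ⟨fun k => (hn k).1 (pow_ne_zero 2 k.2), fun k k' hkk => ho _ _ fun h => hkk (Subtype.ext h)⟩
  have hVσ := isPositive_conj hσ V
  refine (qEntropy_le_orthonormal hVσ hg fun f hf => ?_).trans ?_
  · rw [qf_conj]
    have h1 : adjoint V (V (adjoint V f)) = 0 := hk _ fun i => by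
      by_cases hi : ν i = 0
      · rw [(hn i).2 (by simp [hi]), inner_zero_left]
      · have := hf ⟨i, hi⟩
        rw [hgdef] at this
        simp only at this
        rw [inner_smul_left, mul_eq_zero] at this
        rw [ContinuousLinearMap.adjoint_inner_right]
        exact this.resolve_left (by simpa using hi)
    have h2 : V (adjoint V f) = 0 := by
      rw [← inner_self_eq_zero (𝕜 := ℂ), ← ContinuousLinearMap.adjoint_inner_right, h1,
        inner_zero_right]
    have h3 : adjoint V f = 0 := by
      rw [← inner_self_eq_zero (𝕜 := ℂ), ContinuousLinearMap.adjoint_inner_left, h2,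
        inner_zero_right]
    simp [h3, qf]
  · have hle := tsum_qf_le_trace hVσ hg
    have h1 := ent_le_gibbs (x := fun k => ENNReal.ofReal (qf (V ∘L σ ∘L adjoint V) (g k)))
      (ne_top_of_le_ne_top (trace_conj_ne_top hσ ht V) hle)
      (h := fun k : {k // ν k ≠ 0} => l / ν k ^ 2) (c := c)
      (fun k _ => by positivity) hc ?_
    · refine h1.trans (add_le_add ?_ (by gcongr))
      calc _ = ∑' k : {k // ν k ≠ 0}, ENNReal.ofReal l * ENNReal.ofReal (qf σ (e k)) := by
            refine tsum_congr fun k => ?_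
            have := k.2
            rw [hqg, ← ENNReal.ofReal_mul (mul_nonneg (by positivity) (qf_nonneg hσ _)),
              ← ENNReal.ofReal_mul hl]
            congr 1
            field_simp
        _ = ENNReal.ofReal l * ∑' k : {k // ν k ≠ 0}, ENNReal.ofReal (qf σ (e k)) :=
            ENNReal.tsum_mul_left
        _ ≤ _ := by gcongr; exact tsum_qf_le_trace hσ heo
    · refine le_trans ?_ hZ
      calc _ ≤ ∑' k : {k // ν k ≠ 0}, (if ν k = 0 then 0
              else ENNReal.ofReal (Real.exp (-(l / ν k ^ 2)))) := by
            refine ENNReal.tsum_le_tsum fun k => ?_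
            rw [if_neg k.2]
            split_ifs <;> simp
        _ ≤ expSum ν l := ENNReal.tsum_comp_le_tsum_of_injective Subtype.val_injective _

/-- If all distributions `{p_k s_k}` have entropy at most `C`, then `∑ e^{-C/s_k} ≤ 1`. -/
theorem sum_exp_le_one_of_ent_le [Fintype ι] {s : ι → ℝ} (hs : ∀ k, 0 < s k) {C : ℝ} (hC : 0 ≤ C)
    (h : ∀ p : ι → ℝ, (∀ k, 0 ≤ p k) → ∑ k, p k = 1 →
      ent (fun k => ENNReal.ofReal (p k * s k)) ≤ ENNReal.ofReal C) :
    ∑ k, Real.exp (-(C / s k)) ≤ 1 := by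
  by_contra! hcon
  set f : ℝ → ℝ := fun t => ∑ k, Real.exp (-(t / s k)) with hf
  have hfc : Continuous f := by rw [hf]; fun_prop
  have hlim : Tendsto f atTop (𝓝 0) := by
    rw [← Finset.sum_const_zero (ι := ι) (s := Finset.univ)]
    refine tendsto_finsetSum _ fun k _ => ?_
    exact Real.tendsto_exp_atBot.comp (tendsto_neg_atTop_atBot.comp
      (tendsto_id.atTop_div_const (hs k)))
  obtain ⟨b, hb1, hbC⟩ := ((hlim.eventually_lt_const one_pos).and (eventually_ge_atTop C)).exists
  obtain ⟨t, ⟨htC, -⟩, ht⟩ := intermediate_value_Icc' hbC hfc.continuousOn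
    (show (1 : ℝ) ∈ Set.Icc (f b) (f C) from ⟨hb1.le, hcon.le⟩)
  have htC' : C < t := lt_of_le_of_ne htC fun h => by rw [h] at hcon; exact hcon.ne' ht
  have ht' : ∑ k, Real.exp (-(t / s k)) = 1 := ht
  set Z := ∑ k, Real.exp (-(t / s k)) / s k with hZ
  have hne : (Finset.univ : Finset ι).Nonempty := by
    by_contra hne
    rw [Finset.not_nonempty_iff_eq_empty] at hne
    rw [hne] at ht'
    simp at ht'
  have hZ0 : 0 < Z := Finset.sum_pos (fun k _ => div_pos (Real.exp_pos _) (hs k)) hne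
  have hp := h (fun k => Real.exp (-(t / s k)) / s k / Z)
    (fun k => div_nonneg (div_nonneg (Real.exp_pos _).le (hs k).le) hZ0.le)
    (by rw [← Finset.sum_div]; exact div_self hZ0.ne')
  have hx : ∀ k, Real.exp (-(t / s k)) / s k / Z * s k = Real.exp (-(t / s k)) / Z := fun k => by
    have := (hs k).ne'
    field_simp
  simp_rw [hx] at hp
  rw [ent_ofReal fun k => div_nonneg (Real.exp_pos _).le hZ0.le] at hp
  unfold clEntropy at hp
  have hsum : ∑' k, Real.exp (-(t / s k)) / Z = 1 / Z := by
    rw [tsum_fintype, ← Finset.sum_div, ht']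
  rw [hsum, tsum_fintype, ← ENNReal.ofReal_sum_of_nonneg,
    ← ENNReal.ofReal_mul (by positivity)] at hp
  · have hval : ∀ k, Real.negMulLog (Real.exp (-(t / s k)) / Z / (1 / Z)) =
        t * (Real.exp (-(t / s k)) / s k) := fun k => by
      have : Real.exp (-(t / s k)) / Z / (1 / Z) = Real.exp (-(t / s k)) := by field_simp
      rw [this, Real.negMulLog, Real.log_exp]
      ring
    simp_rw [hval] at hp
    rw [← Finset.mul_sum, ← hZ] at hp
    have h2 : 1 / Z * (t * Z) = t := by field_simp
    rw [h2] at hp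
    exact absurd ((ENNReal.ofReal_le_ofReal_iff hC).1 hp) (not_le.2 htC')
  · intro k _
    have : Real.exp (-(t / s k)) / Z / (1 / Z) = Real.exp (-(t / s k)) := by field_simp
    rw [this]
    exact Real.negMulLog_nonneg (Real.exp_pos _).le
      (Real.exp_le_one_iff.2 (neg_nonpos.2 (div_nonneg (hC.trans htC) (hs k).le)))

/-- The bound `∑ e^{-C/s_k} ≤ 1` for the diagonal values `s_k` of `S` on all finite orthonormal
families in which the compression of `S` is diagonal. -/
def ExpBound (S : E →L[ℂ] E) (C : ℝ) : Prop :=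
  ∀ (n : ℕ) (e : Fin n → E), Orthonormal ℂ e → (∀ i j, i ≠ j → (inner ℂ (e i) (S (e j)) : ℂ) = 0) →
    (∀ i, 0 < qf S (e i)) → ∑ i, Real.exp (-(C / qf S (e i))) ≤ 1

theorem ExpBound.tsum_le {S : E →L[ℂ] E} {C : ℝ} (h : ExpBound S C) {e : ι → E}
    (he : Orthonormal ℂ e) (ho : ∀ i j, i ≠ j → (inner ℂ (e i) (S (e j)) : ℂ) = 0)
    (hs : ∀ i, 0 < qf S (e i)) : ∑' i, ENNReal.ofReal (Real.exp (-(C / qf S (e i)))) ≤ 1 := by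
  rw [ENNReal.tsum_eq_iSup_sum]
  refine iSup_le fun J => ?_
  have hi : Function.Injective fun k : Fin J.card => (J.equivFin.symm k : ι) :=
    Subtype.val_injective.comp J.equivFin.symm.injective
  have h1 := h J.card (fun k => e (J.equivFin.symm k)) (he.comp _ hi)
    (fun i j hij => ho _ _ (hi.ne hij)) (fun i => hs _)
  rw [← ENNReal.ofReal_sum_of_nonneg fun i _ => (Real.exp_pos _).le, ← ENNReal.ofReal_one]
  refine ENNReal.ofReal_le_ofReal (le_trans (le_of_eq ?_) h1)
  rw [← Finset.sum_coe_sort J, ← J.equivFin.symm.sum_comp]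

theorem countable_of_orthonormal [TopologicalSpace.SeparableSpace E] {e : ι → E}
    (he : Orthonormal ℂ e) : Countable ι := by
  refine Pairwise.countable_of_isOpen_disjoint (s := fun i => Metric.ball (e i) (1 / 2))
    (fun i j hij => Metric.ball_disjoint_ball ?_) (fun i => Metric.isOpen_ball)
    (fun i => ⟨e i, Metric.mem_ball_self (by norm_num)⟩)
  rw [dist_eq_norm]
  have h1 : ‖e i - e j‖ ^ 2 = 2 := by
    rw [@norm_sub_sq ℂ, he.2 hij, he.1, he.1]
    norm_num
  nlinarith [norm_nonneg (e i - e j)]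

theorem ExpBound.isCompactOperator {S : E →L[ℂ] E} (hS : S.IsPositive) {C : ℝ} (hC : 0 ≤ C)
    (h : ExpBound S C) : IsCompactOperator S := by
  refine isCompactOperator_of_bounded_families hS fun ε hε => ?_
  refine ⟨⌈Real.exp (C / ε)⌉₊, fun n e he ho hq => ?_⟩
  have h1 := h n e he ho fun i => hε.trans_le (hq i)
  have h2 : ∑ _i : Fin n, Real.exp (-(C / ε)) ≤ ∑ i, Real.exp (-(C / qf S (e i))) := by
    refine Finset.sum_le_sum fun i _ => Real.exp_le_exp.2 (neg_le_neg ?_)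
    exact div_le_div_of_nonneg_left hC hε (hq i)
  rw [Finset.sum_const, Finset.card_univ, Fintype.card_fin, nsmul_eq_mul, Real.exp_neg] at h2
  have h3 : (n : ℝ) ≤ Real.exp (C / ε) := by
    have := h2.trans h1
    rwa [← div_eq_mul_inv, div_le_one (Real.exp_pos _)] at this
  exact_mod_cast h3.trans (Nat.le_ceil _)

theorem ExpBound.lamStarSqrtFin [TopologicalSpace.SeparableSpace E] {S : E →L[ℂ] E}
    (hS : S.IsPositive) {C : ℝ} (hC : 0 ≤ C) (h : ExpBound S C) : LamStarSqrtFin S := by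
  obtain ⟨s, b, hb⟩ := exists_eigenbasis hS (h.isCompactOperator hS hC)
  have := countable_of_orthonormal b.orthonormal
  obtain ⟨g, hg⟩ := exists_injective_nat s
  have hq : ∀ i, 0 ≤ qf S (b i) := fun i => qf_nonneg hS _
  set ν : ℕ → ℝ := Function.extend g (fun i => √(qf S (b i))) 0 with hν
  set e : ℕ → E := Function.extend g (fun i => if qf S (b i) = 0 then 0 else b i) 0 with he
  have hνg : ∀ i, ν (g i) = √(qf S (b i)) := fun i => hg.extend_apply _ _ i
  have heg : ∀ i, e (g i) = if qf S (b i) = 0 then 0 else b i := fun i => hg.extend_apply _ _ i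
  have hν0 : ∀ n, n ∉ Set.range g → ν n = 0 := fun n hn => Function.extend_apply' _ _ _ hn
  have he0 : ∀ n, n ∉ Set.range g → e n = 0 := fun n hn => Function.extend_apply' _ _ _ hn
  refine ⟨ν, fun n => ?_, ⟨e, fun n m hnm => ?_, fun n => ?_, fun n => ?_, fun x hx => ?_⟩,
    C + 1, by positivity, ?_⟩
  · by_cases hn : n ∈ Set.range g
    · obtain ⟨i, rfl⟩ := hn
      rw [hνg]; positivity
    · rw [hν0 n hn]
  · by_cases hn : n ∈ Set.range g
    · by_cases hm : m ∈ Set.range g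
      · obtain ⟨i, rfl⟩ := hn
        obtain ⟨j, rfl⟩ := hm
        rw [heg, heg]
        have := b.orthonormal.2 (i := i) (j := j) fun h => hnm (by rw [h])
        split_ifs <;> simp [this]
      · rw [he0 m hm, inner_zero_right]
    · rw [he0 n hn, inner_zero_left]
  · by_cases hn : n ∈ Set.range g
    · obtain ⟨i, rfl⟩ := hn
      simp only [hνg, heg, Real.sq_sqrt (hq i)]
      split_ifs with h0
      · simp [h0]
      · exact ⟨fun _ => b.orthonormal.1 i, fun h1 => (h0 h1).elim⟩
    · simp [hν0 n hn, he0 n hn]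
  · by_cases hn : n ∈ Set.range g
    · obtain ⟨i, rfl⟩ := hn
      simp only [hνg, heg, Real.sq_sqrt (hq i)]
      split_ifs with h0
      · simp
      · exact hb i
    · simp [hν0 n hn, he0 n hn]
  · have h1 : ∀ i, (inner ℂ (b i) (S x) : ℂ) = 0 := fun i => by
      rw [inner_eq_zero_of_qf hS, hb, inner_smul_left]
      have := hx (g i)
      rw [heg] at this
      split_ifs at this with h0
      · simp [h0]
      · rw [this, mul_zero]
    have h2 := parseval b (S x)
    simp only [ip, h1, enorm_zero, ne_eq, OfNat.ofNat_ne_zero, not_false_eq_true, zero_pow,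
      tsum_zero] at h2
    exact nsq_eq_zero.1 h2.symm
  · refine ne_top_of_le_ne_top ENNReal.one_ne_top ?_
    unfold expSum
    rw [← hg.tsum_eq (f := fun n => if ν n = 0 then 0
      else ENNReal.ofReal (Real.exp (-((C + 1) / ν n ^ 2)))) fun n hn => by
        by_contra h0; exact hn (by simp [hν0 n h0])]
    have h1 := h.tsum_le (e := fun i : {i // 0 < qf S (b i)} => b i)
      (b.orthonormal.comp _ Subtype.val_injective) (fun i j hij => by
        rw [hb, inner_smul_right, b.orthonormal.2 fun h => hij (Subtype.ext h), mul_zero])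
      (fun i => i.2)
    refine le_trans ?_ h1
    rw [← (Subtype.val_injective (p := fun i : s => 0 < qf S (b i))).tsum_eq]
    · refine ENNReal.tsum_le_tsum fun i => ?_
      have hi := i.2
      rw [hνg, Real.sq_sqrt hi.le, if_neg (Real.sqrt_pos.2 hi).ne']
      gcongr
      linarith
    · intro i hi
      by_contra h0
      have hle : qf S (b i) ≤ 0 := by simpa using h0
      exact hi (if_pos (by rw [hνg, Real.sqrt_eq_zero']; exact hle))

theorem lamStarFin_iff {V : E →L[ℂ] F} : LamStarFin V ↔ LamStarSqrtFin (adjoint V ∘L V) :=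
  ⟨fun ⟨ν, ⟨h0, h1⟩, h2⟩ => ⟨ν, h0, h1, h2⟩, fun ⟨ν, h0, h1, h2⟩ => ⟨ν, ⟨h0, h1⟩, h2⟩⟩

/-- Finiteness of `λ*(V)` gives a linear bound for the entropy of `V σ V*`. -/
theorem LamStarFin.exists_bound {V : E →L[ℂ] F} (h : LamStarFin V) : ∃ K : ℝ, 0 ≤ K ∧
    ∀ σ : E →L[ℂ] E, σ.IsPositive → traceENN σ ≠ ∞ →
      qEntropy (V ∘L σ ∘L adjoint V) ≤ ENNReal.ofReal K * traceENN σ := by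
  obtain ⟨ν, hν, l, hl, hZ⟩ := h
  set c := (expSum ν l).toReal with hc
  have hc0 : 0 ≤ c := ENNReal.toReal_nonneg
  refine ⟨l + c * ‖V‖ ^ 2, by positivity, fun σ hσ ht => ?_⟩
  have hZ' : expSum ν l ≤ ENNReal.ofReal (Real.exp c) := by
    rw [← ENNReal.ofReal_toReal hZ]
    exact ENNReal.ofReal_le_ofReal ((le_add_of_nonneg_right zero_le_one).trans
      (Real.add_one_le_exp c))
  refine (hν.qEntropy_conj_le hl.le hc0 hZ' hσ ht).trans ?_
  rw [ENNReal.ofReal_add hl.le (by positivity), add_mul, ENNReal.ofReal_mul hc0, mul_assoc]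
  gcongr
  exact trace_conj_le hσ V

end ExponentialSums

section Necessity

open ContinuousLinearMap (adjoint)

variable {E F ι : Type*}
variable [NormedAddCommGroup E] [InnerProductSpace ℂ E] [CompleteSpace E]
variable [NormedAddCommGroup F] [InnerProductSpace ℂ F] [CompleteSpace F]
variable {V : ℕ → E →L[ℂ] F} {S : E →L[ℂ] E}

theorem rep_sum_rankOne [Fintype ι] (y : ι → E) : Rep (∑ k, rankOne (y k)) y := by
  have hin : ∀ x, (inner ℂ ((∑ k, rankOne (y k)) x) x : ℂ) =
      ((∑ k, ‖(inner ℂ (y k) x : ℂ)‖ ^ 2 : ℝ) : ℂ) := fun x => by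
    rw [_root_.sum_apply, sum_inner]
    push_cast
    refine Finset.sum_congr rfl fun k _ => ?_
    rw [rankOne, ContinuousLinearMap.smulRight_apply, innerSL_apply_apply, inner_smul_left,
      ← Complex.normSq_eq_conj_mul_self, Complex.normSq_eq_norm_sq]
    push_cast; rfl
  have hqf : ∀ x, qf (∑ k, rankOne (y k)) x = ∑ k, ‖(inner ℂ (y k) x : ℂ)‖ ^ 2 := fun x => by
    unfold qf
    rw [← inner_conj_symm, hin, Complex.conj_ofReal, Complex.ofReal_re]
  refine ⟨?_, fun f => ?_⟩
  · rw [ContinuousLinearMap.isPositive_iff_complex]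
    intro x
    rw [hin]
    rw [RCLike.re_eq_complex_re, Complex.ofReal_re]
    refine ⟨rfl, ?_⟩
    positivity
  · rw [hqf, tsum_fintype, ENNReal.ofReal_sum_of_nonneg fun i _ => by positivity]
    exact Finset.sum_congr rfl fun k _ => (ip_eq _ _).symm

/-- `S` is the strong sum `∑ᵢ Vᵢ*Vᵢ`. -/
def KrausSum (V : ℕ → E →L[ℂ] F) (S : E →L[ℂ] E) : Prop :=
  ∀ x : E, HasSum (fun i => adjoint (V i) (V i x)) (S x)

theorem KrausSum.hasSum_inner (hS : KrausSum V S) (x : E) :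
    HasSum (fun i => ((‖V i x‖ ^ 2 : ℝ) : ℂ)) (inner ℂ x (S x)) := by
  refine ((hS x).mapL (innerSL ℂ x)).congr_fun fun i => ?_
  rw [innerSL_apply_apply, ContinuousLinearMap.adjoint_inner_right, inner_self_eq_norm_sq_to_K]
  simp

theorem KrausSum.hasSum_norm_sq (hS : KrausSum V S) (x : E) :
    HasSum (fun i => ‖V i x‖ ^ 2) (qf S x) := by
  simpa only [Complex.ofReal_re, qf] using Complex.hasSum_re (hS.hasSum_inner x)

theorem KrausSum.isPositive (hS : KrausSum V S) : S.IsPositive := by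
  rw [ContinuousLinearMap.isPositive_iff_complex]
  intro x
  have h1 : (inner ℂ x (S x) : ℂ) = qf S x :=
    (hS.hasSum_inner x).unique (Complex.hasSum_ofReal.2 (hS.hasSum_norm_sq x))
  rw [← inner_conj_symm, h1, Complex.conj_ofReal]
  exact ⟨rfl, (hS.hasSum_norm_sq x).nonneg fun i => by positivity⟩

theorem KrausSum.ofReal_qf (hS : KrausSum V S) (x : E) :
    ENNReal.ofReal (qf S x) = ∑' i, nsq (V i x) := by
  have h := hS.hasSum_norm_sq x
  rw [← h.tsum_eq, ENNReal.ofReal_tsum_of_nonneg (fun i => by positivity) h.summable]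
  simp_rw [nsq_eq]

theorem KrausSum.norm_sq_le (hS : KrausSum V S) (i : ℕ) (x : E) : ‖V i x‖ ^ 2 ≤ qf S x :=
  le_hasSum (hS.hasSum_norm_sq x) i fun _ _ => by positivity

theorem KrausSum.qf_le (hS : KrausSum V S) (hV : KrausTNI V) (x : E) : qf S x ≤ ‖x‖ ^ 2 := by
  have h := hV.tsum_nsq_le x
  rw [← hS.ofReal_qf, nsq_eq] at h
  exact (ENNReal.ofReal_le_ofReal_iff (by positivity)).1 h

/-- A linear entropy bound together with a bound on the column sums of the transition matrix
yields an exponential sum bound. -/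
theorem KrausSum.sum_exp_le_one (hS : KrausSum V S) (hV : KrausTNI V) {K M : ℝ} (hK0 : 0 ≤ K)
    (hK : ∀ σ : E →L[ℂ] E, σ.IsPositive → traceENN σ ≠ ∞ →
      qEntropy (krausMap V σ) ≤ ENNReal.ofReal K * traceENN σ) (hM : 1 ≤ M)
    [Fintype ι] {e : ι → E} (he : Orthonormal ℂ e) (hs : ∀ k, 0 < qf S (e k))
    (hcol : ∀ f : F, ‖f‖ = 1 →
      ∑ k, (∑' i, ip f (V i (e k))) / ENNReal.ofReal (qf S (e k)) ≤ ENNReal.ofReal M) :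
    ∑ k, Real.exp (-((K + Real.log M) / qf S (e k))) ≤ 1 := by
  refine sum_exp_le_one_of_ent_le hs (add_nonneg hK0 (Real.log_nonneg hM)) fun p hp0 hp1 => ?_
  set y : ι → E := fun k => (√(p k) : ℂ) • e k with hy
  have hrep := rep_sum_rankOne y
  set σ := ∑ k, rankOne (y k)
  have hc : ∀ k, ‖(√(p k) : ℂ)‖ ^ 2 = p k := fun k => by
    rw [Complex.norm_real, Real.norm_of_nonneg (Real.sqrt_nonneg _), Real.sq_sqrt (hp0 k)]
  have htr : traceENN σ = 1 := by
    rw [hrep.trace, tsum_fintype, ← ENNReal.ofReal_one, ← hp1,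
      ENNReal.ofReal_sum_of_nonneg fun k _ => hp0 k]
    refine Finset.sum_congr rfl fun k _ => ?_
    rw [hy, nsq_eq, norm_smul, mul_pow, hc, he.1, one_pow, mul_one]
  have ht : traceENN σ ≠ ∞ := by rw [htr]; exact ENNReal.one_ne_top
  have hs1 : ∀ k, qf S (e k) ≤ 1 := fun k => by
    have := hS.qf_le hV (e k)
    rwa [he.1, one_pow] at this
  have hsum : ∑' k, ENNReal.ofReal (p k * qf S (e k)) ≤ 1 := by
    rw [tsum_fintype, ← ENNReal.ofReal_one, ← hp1,
      ENNReal.ofReal_sum_of_nonneg fun k _ => hp0 k]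
    exact Finset.sum_le_sum fun k _ => ENNReal.ofReal_le_ofReal
      (mul_le_of_le_one_right (hp0 k) (hs1 k))
  have hs0 : ∀ k, ENNReal.ofReal (qf S (e k)) ≠ 0 := fun k => (ENNReal.ofReal_pos.2 (hs k)).ne'
  have key : ent (fun k => ENNReal.ofReal (p k * qf S (e k))) ≤
      qEntropy (krausMap V σ) + ENNReal.ofReal (Real.log M) := by
    by_cases htop : qEntropy (krausMap V σ) = ∞
    · simp [htop]
    rw [← tsub_le_iff_right]
    refine le_qEntropy (hV.pos hrep.pos ht) fun s b => ?_
    rw [tsub_le_iff_right]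
    refine (ent_le_of_stochastic (M := M)
      (D := fun k a => (∑' i, ip (b a) (V i (e k))) / ENNReal.ofReal (qf S (e k)))
      (y := fun a => ENNReal.ofReal (qf (krausMap V σ) (b a)))
      (ne_top_of_le_ne_top ENNReal.one_ne_top hsum) hM (fun k _ => ?_) (fun a => ?_)
      (fun a => ?_)).trans ?_
    · simp_rw [div_eq_mul_inv]
      rw [ENNReal.tsum_mul_right, ENNReal.tsum_comm]
      simp_rw [parseval]
      rw [← hS.ofReal_qf, ENNReal.mul_inv_cancel (hs0 k) ENNReal.ofReal_ne_top]
    · refine le_trans ?_ (hcol (b a) (b.orthonormal.1 a))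
      rw [tsum_fintype]
      refine Finset.sum_le_sum fun k _ => ?_
      split_ifs <;> simp
    · rw [(hV.rep hrep ht).eq, ENNReal.tsum_sigma', ENNReal.tsum_comm]
      refine tsum_congr fun k => ?_
      rw [ENNReal.ofReal_mul (hp0 k), mul_assoc,
        ENNReal.mul_div_cancel (hs0 k) ENNReal.ofReal_ne_top, ← ENNReal.tsum_mul_left]
      refine tsum_congr fun i => ?_
      rw [hy, map_smul, ip_comm, ip_smul_right, hc]
    · gcongr
      exact mul_le_of_le_one_right' hsum
  refine key.trans ?_
  rw [ENNReal.ofReal_add hK0 (Real.log_nonneg hM)]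
  gcongr
  simpa [htr] using hK σ hrep.pos ht

theorem sum_smul_inner_le (J : Finset ι) {W : E →L[ℂ] F} {e : ι → E} {f : F} (hf : ‖f‖ = 1)
    (c : ι → ℂ) :
    ‖∑ k ∈ J, c k * (inner ℂ f (W (e k)) : ℂ)‖ ^ 2 ≤ ‖W (∑ k ∈ J, c k • e k)‖ ^ 2 := by
  have : ∑ k ∈ J, c k * (inner ℂ f (W (e k)) : ℂ) = inner ℂ f (W (∑ k ∈ J, c k • e k)) := by
    rw [map_sum, inner_sum]
    simp_rw [map_smul, inner_smul_right]
  rw [this]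
  gcongr
  refine (norm_inner_le_norm _ _).trans_eq ?_
  rw [hf, one_mul]

/-- The exponential sum bound for finite Kraus families. -/
theorem KrausSum.expBound_of_finite (hS : KrausSum V S) (hV : KrausTNI V) {K : ℝ} (hK0 : 0 ≤ K)
    (hK : ∀ σ : E →L[ℂ] E, σ.IsPositive → traceENN σ ≠ ∞ →
      qEntropy (krausMap V σ) ≤ ENNReal.ofReal K * traceENN σ) {N : ℕ} (hN : ∀ i ≥ N, V i = 0) :
    ExpBound S (K + Real.log (N + 1)) := by
  intro n e he ho hs
  refine hS.sum_exp_le_one hV hK0 hK (by simp) he hs fun f hf => ?_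
  have h1 : ∀ k, ∑' i, ip f (V i (e k)) = ∑ i ∈ Finset.range N, ip f (V i (e k)) := fun k =>
    tsum_eq_sum fun i hi => by
      rw [hN i (by simpa using hi), _root_.zero_apply, ip, inner_zero_right]
      simp
  simp_rw [h1, div_eq_mul_inv, Finset.sum_mul]
  rw [Finset.sum_comm]
  have h2 : ∀ i ∈ Finset.range N,
      ∑ k, ip f (V i (e k)) * (ENNReal.ofReal (qf S (e k)))⁻¹ ≤ ENNReal.ofReal 1 := fun i _ => by
    have h3 := sum_sq_div_le_one Finset.univ (u := fun k => (inner ℂ f (V i (e k)) : ℂ))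
      (s := fun k => qf S (e k)) (fun k _ => hs k) fun c => by
        refine (sum_smul_inner_le _ hf c).trans ((hS.norm_sq_le i _).trans_eq ?_)
        rw [qf_sum_smul hS.isPositive ho]
    refine le_trans (le_of_eq ?_) (ENNReal.ofReal_le_ofReal h3)
    rw [ENNReal.ofReal_sum_of_nonneg fun k _ => div_nonneg (by positivity) (hs k).le]
    refine Finset.sum_congr rfl fun k _ => ?_
    rw [ENNReal.ofReal_div_of_pos (hs k), ip_eq, div_eq_mul_inv]
  refine (Finset.sum_le_sum h2).trans ?_
  rw [← ENNReal.ofReal_sum_of_nonneg fun _ _ => zero_le_one]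
  exact ENNReal.ofReal_le_ofReal (by simp)

/-- The exponential sum bound for Kraus operators with mutually orthogonal ranges. -/
theorem KrausSum.expBound_of_orthogonal (hS : KrausSum V S) (hV : KrausTNI V) {K : ℝ}
    (hK0 : 0 ≤ K) (hK : ∀ σ : E →L[ℂ] E, σ.IsPositive → traceENN σ ≠ ∞ →
      qEntropy (krausMap V σ) ≤ ENNReal.ofReal K * traceENN σ)
    (hO : ∀ i j, i ≠ j → adjoint (V i) ∘L V j = 0) : ExpBound S K := by
  intro n e he ho hs
  have hO' : ∀ i j x y, i ≠ j → (inner ℂ (V i x) (V j y) : ℂ) = 0 := fun i j x y hij => by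
    rw [← ContinuousLinearMap.adjoint_inner_right, ← ContinuousLinearMap.comp_apply, hO i j hij,
      _root_.zero_apply, inner_zero_right]
  have := hS.sum_exp_le_one hV hK0 hK le_rfl he hs fun f hf => ?_
  · simpa using this
  simp_rw [div_eq_mul_inv, ← ENNReal.tsum_mul_right]
  rw [← tsum_fintype (L := .unconditional _), ENNReal.tsum_comm]
  refine ENNReal.tsum_le_of_sum_range_le fun m => ?_
  have h3 := sum_sq_div_le_one (Finset.range m ×ˢ (Finset.univ : Finset (Fin n)))
    (u := fun q => (inner ℂ f (V q.1 (e q.2)) : ℂ)) (s := fun q => qf S (e q.2))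
    (fun q _ => hs q.2) fun c => by
      rw [Finset.sum_product, Finset.sum_product]
      have h4 : ∑ i ∈ Finset.range m, ∑ k, c (i, k) * (inner ℂ f (V i (e k)) : ℂ) =
          inner ℂ f (∑ i ∈ Finset.range m, (1 : ℂ) • V i (∑ k, c (i, k) • e k)) := by
        rw [inner_sum]
        refine Finset.sum_congr rfl fun i _ => ?_
        rw [one_smul, map_sum, inner_sum]
        simp_rw [map_smul, inner_smul_right]
      rw [h4]
      calc _ ≤ ‖∑ i ∈ Finset.range m, (1 : ℂ) • V i (∑ k, c (i, k) • e k)‖ ^ 2 := by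
            gcongr
            refine (norm_inner_le_norm _ _).trans_eq ?_
            rw [hf, one_mul]
        _ = ∑ i ∈ Finset.range m, ‖V i (∑ k, c (i, k) • e k)‖ ^ 2 := by
            rw [norm_sum_smul_sq fun i j hij => hO' i j _ _ hij]
            simp
        _ ≤ _ := by
            refine Finset.sum_le_sum fun i _ => (hS.norm_sq_le i _).trans_eq ?_
            rw [qf_sum_smul hS.isPositive ho]
  refine le_trans (le_of_eq ?_) (ENNReal.ofReal_le_ofReal h3)
  rw [ENNReal.ofReal_sum_of_nonneg fun k _ => div_nonneg (by positivity) (hs k.2).le,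
    Finset.sum_product]
  refine Finset.sum_congr rfl fun i _ => ?_
  rw [tsum_fintype]
  refine Finset.sum_congr rfl fun k _ => ?_
  rw [ENNReal.ofReal_div_of_pos (hs k), ip_eq, div_eq_mul_inv]

/-- A bounded operator satisfying a linear entropy bound has finite `λ*`. -/
theorem lamStarFin_of_bound [TopologicalSpace.SeparableSpace E] {W : E →L[ℂ] F}
    (hW : ∀ x, ‖W x‖ ≤ ‖x‖) {K : ℝ} (hK0 : 0 ≤ K)
    (hK : ∀ σ : E →L[ℂ] E, σ.IsPositive → traceENN σ ≠ ∞ →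
      qEntropy (W ∘L σ ∘L adjoint W) ≤ ENNReal.ofReal K * traceENN σ) : LamStarFin W := by
  set U : ℕ → E →L[ℂ] F := fun j => if j = 0 then W else 0 with hU
  have hU0 : U 0 = W := if_pos rfl
  have hU1 : ∀ j, j ≠ 0 → U j = 0 := fun j hj => if_neg hj
  have hS : KrausSum U (adjoint W ∘L W) := fun x => by
    have := hasSum_single (f := fun i => adjoint (U i) (U i x)) 0 fun j hj => by simp [hU1 j hj]
    simpa [hU0] using this
  have hUV : KrausTNI U := fun n => by
    refine isPositive_of_qf ?_ fun x => ?_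
    · rw [map_sub, map_sum]
      congr 1
      · exact ContinuousLinearMap.adjoint_id
      · refine Finset.sum_congr rfl fun i _ => ?_
        rw [ContinuousLinearMap.adjoint_comp, ContinuousLinearMap.adjoint_adjoint]
    · rw [qf_sub, qf_one]
      have h1 : qf (∑ i ∈ Finset.range n, adjoint (U i) ∘L U i) x =
          ∑ i ∈ Finset.range n, ‖U i x‖ ^ 2 := by
        simp_rw [← qf_adjoint_comp_self, qf, _root_.sum_apply, inner_sum, Complex.re_sum]
      have h2 : ∑ i ∈ Finset.range n, ‖U i x‖ ^ 2 ≤ qf (adjoint W ∘L W) x :=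
        sum_le_hasSum _ (fun i _ => by positivity) (hS.hasSum_norm_sq x)
      rw [qf_adjoint_comp_self] at h2
      have h3 : ‖W x‖ ^ 2 ≤ ‖x‖ ^ 2 := by gcongr; exact hW x
      linarith
  have hmap : ∀ σ, krausMap U σ = W ∘L σ ∘L adjoint W := fun σ => by
    unfold krausMap
    rw [tsum_eq_single 0 fun j hj => by rw [hU1 j hj, ContinuousLinearMap.zero_comp], hU0]
  have h := hS.expBound_of_finite hUV hK0 (fun σ hσ ht => by rw [hmap]; exact hK σ hσ ht) (N := 1)
    fun i hi => hU1 i (by lia)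
  rw [lamStarFin_iff]
  exact h.lamStarSqrtFin hS.isPositive (add_nonneg hK0 (Real.log_nonneg (by simp)))

end Necessity

section Sufficiency

open ContinuousLinearMap (adjoint)

variable {E F : Type*}
variable [NormedAddCommGroup E] [InnerProductSpace ℂ E] [CompleteSpace E]
variable [NormedAddCommGroup F] [InnerProductSpace ℂ F] [CompleteSpace F]
variable {V : ℕ → E →L[ℂ] F} {S σ : E →L[ℂ] E}

theorem KrausTNI.qEntropy_le (hV : KrausTNI V) (hσ : σ.IsPositive) (ht : traceENN σ ≠ ∞) :
    qEntropy (krausMap V σ) ≤ ent (fun i => traceENN (V i ∘L σ ∘L adjoint (V i))) +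
      ∑' i, qEntropy (V i ∘L σ ∘L adjoint (V i)) :=
  qEntropy_tsum_le (fun i => isPositive_conj hσ (V i)) (hV.pos hσ ht) (hV.qf_eq hσ ht)
    (hV.trace_ne_top hσ ht)

theorem traceENN_ne_top_of_mem_states (hσ : σ ∈ states E) : traceENN σ ≠ ∞ := by
  rw [hσ.2]; exact ENNReal.one_ne_top

theorem qEntropy_zero : qEntropy (0 : E →L[ℂ] E) = 0 := by
  obtain ⟨s, b, -⟩ := exists_hilbertBasis ℂ E
  have h0 : ∀ x : E, ENNReal.ofReal (qf (0 : E →L[ℂ] E) x) = 0 := fun x => by simp [qf]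
  refine le_antisymm ((QIT.qEntropy_le ContinuousLinearMap.isPositive_zero b).trans ?_) bot_le
  refine (ent_le_log_card (by simp [h0]) ∅ (n := 0) (by simp) (by simp [h0])).trans ?_
  simp

/-- The entropy of the distribution `{Tr Vᵢ σ Vᵢ*}` is finite for finite Kraus families. -/
theorem KrausTNI.ent_trace_ne_top (hV : KrausTNI V) {N : ℕ} (hN : ∀ i ≥ N, V i = 0)
    (hσ : σ.IsPositive) (ht : traceENN σ ≠ ∞) :
    ent (fun i => traceENN (V i ∘L σ ∘L adjoint (V i))) ≠ ∞ := by
  have hs := hV.tsum_trace_ne_top hσ ht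
  refine ne_top_of_le_ne_top (ENNReal.mul_ne_top ENNReal.ofReal_ne_top hs)
    (ent_le_log_card hs (Finset.range N) le_rfl fun i hi => ?_)
  rw [hN i (by simpa using hi), ContinuousLinearMap.zero_comp]
  simp [traceENN, qf]

theorem KrausTNI.contOn_of_finite (hV : KrausTNI V) {N : ℕ} (hN : ∀ i ≥ N, V i = 0)
    (h : ∀ i, LamStarFin (V i)) : ContOn (fun ρ => qEntropy (krausMap V ρ)) (states E) := by
  refine hV.contOn fun ρ hρ => ?_
  have ht := traceENN_ne_top_of_mem_states hρ
  refine ne_top_of_le_ne_top (ENNReal.add_ne_top.2 ⟨hV.ent_trace_ne_top hN hρ.1 ht, ?_⟩)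
    (hV.qEntropy_le hρ.1 ht)
  rw [tsum_eq_sum (s := Finset.range N) fun i hi => by
    rw [hN i (by simpa using hi), ContinuousLinearMap.zero_comp, qEntropy_zero]]
  refine ENNReal.sum_ne_top.2 fun i _ => ?_
  obtain ⟨K, -, hK⟩ := (h i).exists_bound
  exact ne_top_of_le_ne_top (ENNReal.mul_ne_top ENNReal.ofReal_ne_top ht) (hK ρ hρ.1 ht)

theorem KrausSum.qEntropy_le (hS : KrausSum V S) (hV : KrausTNI V) {R : E →L[ℂ] E}
    (hR : adjoint R = R) (hRS : R ∘L R = S) (hσ : σ.IsPositive) (ht : traceENN σ ≠ ∞) :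
    qEntropy (krausMap V σ) ≤ ent (fun i => traceENN (V i ∘L σ ∘L adjoint (V i))) +
      qEntropy (R ∘L σ ∘L adjoint R) := by
  obtain ⟨T, -, hTσ, hT⟩ := exists_sqrt hσ
  obtain ⟨s₀, b₀, -⟩ := exists_hilbertBasis ℂ E
  have hSp := hS.isPositive
  have hA := isPositive_conj hSp T
  have hnorm : ∀ x, qf (T ∘L S ∘L adjoint T) x = ‖R (T x)‖ ^ 2 := fun x => by
    rw [qf_conj, hT, ← hRS, qf_eq_norm_sqrt hR]
  have hnorm' : ∀ x, qf (R ∘L σ ∘L adjoint R) x = ‖T (R x)‖ ^ 2 := fun x => by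
    rw [qf_conj, hR, ← hTσ, qf_eq_norm_sqrt hT]
  have hRσ := isPositive_conj hσ R
  have hRt := trace_conj_ne_top hσ ht R
  have hAt : traceENN (T ∘L S ∘L adjoint T) ≠ ∞ := by
    have h1 : Rep (R ∘L R) fun i => R (b₀ i) := Rep.of_sqrt hR (by rw [hRS]; exact hSp) b₀
    rw [hRS] at h1
    have h2 := (h1.conj T).trace
    rw [h2]
    rw [trace_eq hRσ b₀] at hRt
    simpa only [hnorm', nsq_eq] using hRt
  obtain ⟨s, w, hw⟩ := exists_eigenbasis hA (isCompactOperator_of_trace hA hAt)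
  have hrep : Rep σ fun j => T (w j) := by
    have := Rep.of_sqrt hT (by rw [hTσ]; exact hσ) w
    rwa [hTσ] at this
  have hΦ := hV.rep hrep ht
  have hΦt := hV.trace_ne_top hσ ht
  refine (hΦ.qEntropy_le hΦt).trans ((ent_sigma_le ?_).trans (add_le_add (le_of_eq ?_) ?_))
  · rw [← hΦ.trace]; exact hΦt
  · congr 1
    funext i
    exact ((hrep.conj (V i)).trace).symm
  · refine le_trans (le_of_eq ?_) ((hrep.conj R).ent_le_qEntropy hRt fun i j hij => ?_)
    · congr 1
      funext j
      change ∑' i, nsq (V i (T (w j))) = _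
      rw [← hS.ofReal_qf, ← hRS, qf_eq_norm_sqrt hR, nsq_eq]
    · have h1 : (inner ℂ (R (T (w i))) (R (T (w j))) : ℂ) =
          inner ℂ (w i) ((T ∘L S ∘L adjoint T) (w j)) := by
        rw [← ContinuousLinearMap.adjoint_inner_right, hR, ← ContinuousLinearMap.comp_apply R R,
          hRS, ← ContinuousLinearMap.adjoint_inner_right, hT]
        rfl
      rw [h1, hw, inner_smul_right, w.orthonormal.2 hij, mul_zero]

theorem KrausSum.contOn (hS : KrausSum V S) (hV : KrausTNI V)
    (h : ∀ ρ ∈ states E, ent (fun i => traceENN (V i ∘L ρ ∘L adjoint (V i))) ≠ ∞)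
    (hl : LamStarSqrtFin S) : ContOn (fun ρ => qEntropy (krausMap V ρ)) (states E) := by
  obtain ⟨R, -, hRS, hR⟩ := exists_sqrt hS.isPositive
  have hl' : LamStarFin R := by rw [lamStarFin_iff, hR, hRS]; exact hl
  obtain ⟨K, -, hK⟩ := hl'.exists_bound
  refine hV.contOn fun ρ hρ => ?_
  have ht := traceENN_ne_top_of_mem_states hρ
  exact ne_top_of_le_ne_top (ENNReal.add_ne_top.2 ⟨h ρ hρ, ne_top_of_le_ne_top
    (ENNReal.mul_ne_top ENNReal.ofReal_ne_top ht) (hK ρ hρ.1 ht)⟩)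
    (hS.qEntropy_le hV hR hRS hρ.1 ht)

theorem nonneg_of_expSum_eq_one {ν : ℕ → ℝ} {l : ℝ} (h : expSum ν l = 1) : 0 ≤ l := by
  by_contra! hl
  have h0 : ∃ i, ν i ≠ 0 := by
    by_contra! h0
    simp [expSum, h0] at h
  obtain ⟨i, hi⟩ := h0
  have h1 : ENNReal.ofReal (Real.exp (-(l / ν i ^ 2))) ≤ expSum ν l := by
    have := ENNReal.le_tsum (f := fun i => if ν i = 0 then 0
      else ENNReal.ofReal (Real.exp (-(l / ν i ^ 2)))) i
    simpa [hi, expSum] using this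
  rw [h, ← ENNReal.ofReal_one, ENNReal.ofReal_le_ofReal_iff zero_le_one, Real.exp_le_one_iff,
    neg_nonpos] at h1
  exact absurd h1 (not_le.2 (div_neg_of_neg_of_pos hl (by positivity)))

/-- If `∑ e^{-l/ν²} = 1` has no solution, then the sum is at most one wherever it is finite. -/
theorem expSum_le_one {ν : ℕ → ℝ} (h : ¬ ∃ l : ℝ, expSum ν l = 1) {l : ℝ}
    (hf : expSum ν l ≠ ∞) : expSum ν l ≤ 1 := by
  by_contra! hcon
  set u : ℕ → ℝ → ℝ := fun i t => if ν i = 0 then 0 else Real.exp (-(t / ν i ^ 2)) with hu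
  have hu0 : ∀ i t, 0 ≤ u i t := fun i t => by
    rw [hu]; simp only; split_ifs <;> positivity
  have huc : ∀ i, Continuous (u i) := fun i => by
    rw [hu]; simp only; split_ifs <;> fun_prop
  have hexp : ∀ t, expSum ν t = ∑' i, ENNReal.ofReal (u i t) := fun t => by
    unfold expSum
    refine tsum_congr fun i => ?_
    rw [hu]; simp only; split_ifs <;> simp
  have hmono : ∀ i t, l ≤ t → u i t ≤ u i l := fun i t hlt => by
    rw [hu]; simp only
    split_ifs
    · exact le_rfl
    · gcongr
  have hsum : Summable fun i => u i l := by
    have h1 : ∑' i, ENNReal.ofReal (u i l) ≠ ∞ := by rw [← hexp]; exact hf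
    refine (ENNReal.summable_toReal h1).congr fun i => ENNReal.toReal_ofReal (hu0 i l)
  have hsum' : ∀ t, l ≤ t → Summable fun i => u i t := fun t hlt =>
    Summable.of_nonneg_of_le (fun i => hu0 i t) (fun i => hmono i t hlt) hsum
  have hexp' : ∀ t, l ≤ t → expSum ν t = ENNReal.ofReal (∑' i, u i t) := fun t hlt => by
    rw [hexp, ENNReal.ofReal_tsum_of_nonneg (fun i => hu0 i t) (hsum' t hlt)]
  have hcont : ContinuousOn (fun t => ∑' i, u i t) (Set.Ici l) :=
    continuousOn_tsum (fun i => (huc i).continuousOn) hsum fun i t hlt => by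
      rw [Real.norm_of_nonneg (hu0 i t)]; exact hmono i t hlt
  have hlim : Tendsto (fun t => ∑' i, u i t) atTop (𝓝 0) := by
    have := tendsto_tsum_of_dominated_convergence (f := fun t i => u i t)
      (g := fun _ : ℕ => (0 : ℝ)) (𝓕 := atTop) hsum (fun i => ?_) ?_
    · simpa using this
    · rw [hu]; simp only
      split_ifs with hi
      · exact tendsto_const_nhds
      · exact Real.tendsto_exp_atBot.comp (tendsto_neg_atTop_atBot.comp
          (tendsto_id.atTop_div_const (by positivity)))
    · filter_upwards [eventually_ge_atTop l] with t hlt i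
      rw [Real.norm_of_nonneg (hu0 i t)]; exact hmono i t hlt
  obtain ⟨b, hb1, hbl⟩ := ((hlim.eventually_lt_const one_pos).and (eventually_ge_atTop l)).exists
  have hl1 : 1 ≤ ∑' i, u i l := by
    rw [hexp' l le_rfl, ← ENNReal.ofReal_one] at hcon
    by_contra! hlt
    exact absurd hcon (not_lt.2 (ENNReal.ofReal_le_ofReal hlt.le))
  obtain ⟨t, ⟨hlt, -⟩, ht⟩ := intermediate_value_Icc' hbl (hcont.mono Set.Icc_subset_Ici_self)
    (show (1 : ℝ) ∈ Set.Icc (∑' i, u i b) (∑' i, u i l) from ⟨hb1.le, hl1⟩)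
  refine h ⟨t, ?_⟩
  rw [hexp' t hlt, ← ENNReal.ofReal_one]
  exact congrArg _ ht

theorem exists_expSum_le_one {W : E →L[ℂ] F} (h : lamStar W ≠ ∞) {ε : ℝ≥0∞} (hε : ε ≠ 0) :
    ∃ ν l, IsSingularValues W ν ∧ 0 ≤ l ∧ expSum ν l ≤ 1 ∧ ENNReal.ofReal l ≤ lamStar W + ε := by
  unfold lamStar at h ⊢
  split_ifs at h ⊢ with hν
  · refine ⟨hν.choose, ?_⟩
    unfold lamStarOf at h ⊢
    split_ifs at h ⊢ with hl
    · exact ⟨hl.choose, hν.choose_spec, nonneg_of_expSum_eq_one hl.choose_spec,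
        hl.choose_spec.le, le_self_add⟩
    · have h1 := ENNReal.lt_add_right h hε
      obtain ⟨l, h2⟩ := iInf_lt_iff.1 h1
      obtain ⟨h3, h4⟩ := iInf_lt_iff.1 h2
      exact ⟨l, hν.choose_spec, h3.1.le, expSum_le_one hl h3.2, h4.le⟩
  · exact (h rfl).elim

theorem KrausTNI.contOn_of_lamStar (hV : KrausTNI V)
    (h : ∀ ρ ∈ states E, ent (fun i => traceENN (V i ∘L ρ ∘L adjoint (V i))) ≠ ∞)
    (hl : ∑' i, lamStar (V i) ≠ ∞) : ContOn (fun ρ => qEntropy (krausMap V ρ)) (states E) := by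
  obtain ⟨ε, hε0, hε⟩ := ENNReal.exists_pos_sum_of_countable' one_ne_zero ℕ
  refine hV.contOn fun ρ hρ => ?_
  have ht := traceENN_ne_top_of_mem_states hρ
  refine ne_top_of_le_ne_top (ENNReal.add_ne_top.2 ⟨h ρ hρ, ?_⟩) (hV.qEntropy_le hρ.1 ht)
  have h1 : ∀ i, qEntropy (V i ∘L ρ ∘L adjoint (V i)) ≤ lamStar (V i) + ε i := fun i => by
    obtain ⟨ν, l, hν, hl0, hZ, hle⟩ :=
      exists_expSum_le_one (ENNReal.ne_top_of_tsum_ne_top hl i) (hε0 i).ne'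
    have := hν.qEntropy_conj_le hl0 le_rfl (by simpa using hZ) hρ.1 ht
    rw [hρ.2, mul_one, ENNReal.ofReal_zero, zero_mul, add_zero] at this
    exact this.trans hle
  refine ne_top_of_le_ne_top ?_ (ENNReal.tsum_le_tsum h1)
  rw [ENNReal.tsum_add]
  exact ENNReal.add_ne_top.2 ⟨hl, (hε.trans ENNReal.one_lt_top).ne⟩

theorem KrausTNI.contOn_of_rank (hV : KrausTNI V)
    (h : ∀ ρ ∈ states E, ent (fun i => traceENN (V i ∘L ρ ∘L adjoint (V i))) ≠ ∞)
    (hfd : ∀ i, FiniteDimensional ℂ (LinearMap.range ((V i : E →ₗ[ℂ] F))))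
    (hl : ∑' i, ENNReal.ofReal (Real.log (Module.finrank ℂ (LinearMap.range ((V i : E →ₗ[ℂ] F)))) *
      ‖V i‖ ^ 2) ≠ ∞) : ContOn (fun ρ => qEntropy (krausMap V ρ)) (states E) := by
  refine hV.contOn fun ρ hρ => ?_
  have ht := traceENN_ne_top_of_mem_states hρ
  refine ne_top_of_le_ne_top (ENNReal.add_ne_top.2 ⟨h ρ hρ, ?_⟩) (hV.qEntropy_le hρ.1 ht)
  refine ne_top_of_le_ne_top hl (ENNReal.tsum_le_tsum fun i => ?_)
  refine (qEntropy_conj_le_log_rank (V i) hρ.1 ht (hfd i)).trans ?_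
  rw [ENNReal.ofReal_mul (Real.log_natCast_nonneg _)]
  gcongr
  simpa [hρ.2] using trace_conj_le hρ.1 (V i)

theorem KrausTNI.tsum_mul_trace_le {h : ℕ → ℝ} (h0 : ∀ i, 0 ≤ h i) {C : ℝ}
    (hC : ∀ n : ℕ, ‖∑ i ∈ Finset.range n, h i • (adjoint (V i) ∘L V i)‖ ≤ C) (hσ : σ.IsPositive) :
    ∑' i, traceENN (V i ∘L σ ∘L adjoint (V i)) * ENNReal.ofReal (h i) ≤
      ENNReal.ofReal C * traceENN σ := by
  obtain ⟨s, x, hx⟩ := exists_rep hσ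
  simp_rw [(hx.conj (V _)).trace, hx.trace, ← ENNReal.tsum_mul_right, ← ENNReal.tsum_mul_left]
  rw [ENNReal.tsum_comm]
  refine ENNReal.tsum_le_tsum fun a => ENNReal.tsum_le_of_sum_range_le fun n => ?_
  have h1 : ∑ i ∈ Finset.range n, ‖V i (x a)‖ ^ 2 * h i ≤ C * ‖x a‖ ^ 2 := by
    have h2 := (QIT.qf_le (∑ i ∈ Finset.range n, h i • (adjoint (V i) ∘L V i)) (x a)).trans
      (mul_le_mul_of_nonneg_right (hC n) (by positivity))
    refine le_trans (le_of_eq ?_) h2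
    unfold qf
    rw [_root_.sum_apply, inner_sum, Complex.re_sum]
    refine Finset.sum_congr rfl fun i _ => ?_
    rw [← qf_adjoint_comp_self, ← Complex.coe_smul, mul_comm, ← qf_smul]
    rfl
  rw [nsq_eq, ← ENNReal.ofReal_mul ((norm_nonneg _).trans (hC 0))]
  refine le_trans (le_of_eq ?_) (ENNReal.ofReal_le_ofReal h1)
  rw [ENNReal.ofReal_sum_of_nonneg fun i _ => mul_nonneg (by positivity) (h0 i)]
  refine Finset.sum_congr rfl fun i _ => ?_
  rw [nsq_eq, ENNReal.ofReal_mul (by positivity)]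

theorem KrausTNI.contOn_of_exp (hV : KrausTNI V)
    (hfd : ∀ i, FiniteDimensional ℂ (LinearMap.range ((V i : E →ₗ[ℂ] F))))
    {h : ℕ → ℝ} (h0 : ∀ i, 0 ≤ h i) {C : ℝ}
    (hC : ∀ n : ℕ, ‖∑ i ∈ Finset.range n, h i • (adjoint (V i) ∘L V i)‖ ≤ C)
    (hZ : ∑' i, (Module.finrank ℂ (LinearMap.range ((V i : E →ₗ[ℂ] F))) : ℝ≥0∞) *
      ENNReal.ofReal (Real.exp (-(h i))) ≠ ∞) :
    ContOn (fun ρ => qEntropy (krausMap V ρ)) (states E) := by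
  refine hV.contOn fun ρ hρ => ?_
  have ht := traceENN_ne_top_of_mem_states hρ
  set d : ℕ → ℕ := fun i => Module.finrank ℂ (LinearMap.range ((V i : E →ₗ[ℂ] F))) with hd
  set t : ℕ → ℝ≥0∞ := fun i => traceENN (V i ∘L ρ ∘L adjoint (V i)) with htdef
  have hts : ∑' i, t i ≠ ∞ := hV.tsum_trace_ne_top hρ.1 ht
  set c := (∑' i, (d i : ℝ≥0∞) * ENNReal.ofReal (Real.exp (-(h i)))).toReal with hcdef
  have hc0 : 0 ≤ c := ENNReal.toReal_nonneg
  have hcexp : ∑' i, (d i : ℝ≥0∞) * ENNReal.ofReal (Real.exp (-(h i))) ≤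
      ENNReal.ofReal (Real.exp c) := by
    rw [← ENNReal.ofReal_toReal hZ]
    exact ENNReal.ofReal_le_ofReal ((le_add_of_nonneg_right zero_le_one).trans
      (Real.add_one_le_exp c))
  have hsum : ∑' i, t i * ENNReal.ofReal (h i) ≠ ∞ := ne_top_of_le_ne_top
    (ENNReal.mul_ne_top ENNReal.ofReal_ne_top ht) (KrausTNI.tsum_mul_trace_le h0 hC hρ.1)
  have hdpos : ∀ i, t i ≠ 0 → 1 ≤ d i := fun i hi => by
    by_contra! hlt
    have h1 : LinearMap.range ((V i : E →ₗ[ℂ] F)) = ⊥ := by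
      have := hfd i
      exact Submodule.finrank_eq_zero.1 (by lia)
    have h2 : V i = 0 := by
      ext x
      exact LinearMap.congr_fun (LinearMap.range_eq_bot.1 h1) x
    refine hi ?_
    rw [htdef]
    simp only
    rw [h2, ContinuousLinearMap.zero_comp]
    simp [traceENN, qf]
  refine ne_top_of_le_ne_top (ENNReal.add_ne_top.2 ⟨?_, ?_⟩) (hV.qEntropy_le hρ.1 ht)
  · refine ne_top_of_le_ne_top (ENNReal.add_ne_top.2 ⟨hsum,
      ENNReal.mul_ne_top ENNReal.ofReal_ne_top hts⟩)
      (ent_le_gibbs hts (fun i _ => h0 i) hc0 (le_trans ?_ hcexp))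
    refine ENNReal.tsum_le_tsum fun i => ?_
    split_ifs with hi
    · exact bot_le
    · exact le_mul_of_one_le_left' (by exact_mod_cast hdpos i hi)
  · have h1 : ∀ i, qEntropy (V i ∘L ρ ∘L adjoint (V i)) ≤
        t i * ENNReal.ofReal (h i) + t i * ENNReal.ofReal c := fun i => by
      refine (qEntropy_conj_le_log_rank (V i) hρ.1 ht (hfd i)).trans ?_
      rw [← mul_add, ← ENNReal.ofReal_add (h0 i) hc0, mul_comm]
      gcongr
      rcases Nat.eq_zero_or_pos (d i) with h2 | h2
      · change Real.log (d i) ≤ _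
        rw [h2, Nat.cast_zero, Real.log_zero]
        exact add_nonneg (h0 i) hc0
      · have h2' : (0 : ℝ) < d i := by exact_mod_cast h2
        rw [Real.log_le_iff_le_exp h2', Real.exp_add]
        have h3 : ENNReal.ofReal (d i * Real.exp (-(h i))) ≤ ENNReal.ofReal (Real.exp c) := by
          rw [ENNReal.ofReal_mul h2'.le, ENNReal.ofReal_natCast]
          exact (ENNReal.le_tsum (f := fun i => (d i : ℝ≥0∞) * ENNReal.ofReal (Real.exp (-(h i))))
            i).trans hcexp
        rw [ENNReal.ofReal_le_ofReal_iff (Real.exp_pos _).le, Real.exp_neg, ← div_eq_mul_inv,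
          div_le_iff₀ (Real.exp_pos _)] at h3
        rwa [mul_comm]
    refine ne_top_of_le_ne_top ?_ (ENNReal.tsum_le_tsum h1)
    rw [ENNReal.tsum_add, ENNReal.tsum_mul_right]
    exact ENNReal.add_ne_top.2 ⟨hsum, ENNReal.mul_ne_top hts ENNReal.ofReal_ne_top⟩

end Sufficiency

section Necessity

open ContinuousLinearMap (adjoint)

variable {E F : Type*}
variable [NormedAddCommGroup E] [InnerProductSpace ℂ E] [CompleteSpace E]
variable [NormedAddCommGroup F] [InnerProductSpace ℂ F] [CompleteSpace F]
variable {V : ℕ → E →L[ℂ] F} {S σ : E →L[ℂ] E}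

theorem KrausTNI.norm_le (hV : KrausTNI V) (i : ℕ) (x : E) : ‖V i x‖ ≤ ‖x‖ := by
  have h := (ENNReal.le_tsum (f := fun i => nsq (V i x)) i).trans (hV.tsum_nsq_le x)
  rw [nsq_eq, nsq_eq, ENNReal.ofReal_le_ofReal_iff (by positivity)] at h
  exact (sq_le_sq₀ (norm_nonneg _) (norm_nonneg x)).1 h

theorem KrausTNI.qEntropy_conj_le (hV : KrausTNI V) (hσ : σ.IsPositive) (ht : traceENN σ ≠ ∞)
    (i : ℕ) : qEntropy (V i ∘L σ ∘L adjoint (V i)) ≤ qEntropy (krausMap V σ) := by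
  refine QIT.qEntropy_mono (isPositive_conj hσ (V i)) (hV.pos hσ ht) (fun f => ?_)
    (hV.trace_ne_top hσ ht)
  refine (ENNReal.ofReal_le_ofReal_iff ((hV.pos hσ ht).re_inner_nonneg_right f)).1 ?_
  change _ ≤ ENNReal.ofReal (qf (krausMap V σ) f)
  rw [hV.qf_eq hσ ht]
  exact ENNReal.le_tsum (f := fun i => ENNReal.ofReal (qf (V i ∘L σ ∘L adjoint (V i)) f)) i

theorem KrausTNI.lamStarFin [TopologicalSpace.SeparableSpace E] (hV : KrausTNI V)
    (h : ∀ ρ ∈ states E, qEntropy (krausMap V ρ) ≠ ∞) (i : ℕ) : LamStarFin (V i) := by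
  obtain ⟨K, hK0, hK⟩ := hV.exists_bound h
  exact lamStarFin_of_bound (hV.norm_le i) hK0 fun σ hσ ht =>
    (hV.qEntropy_conj_le hσ ht i).trans (hK σ hσ ht)

theorem KrausTNI.ent_trace_le_of_orthogonal (hV : KrausTNI V)
    (hO : ∀ i j, i ≠ j → adjoint (V i) ∘L V j = 0) (hσ : σ.IsPositive) (ht : traceENN σ ≠ ∞) :
    ent (fun i => traceENN (V i ∘L σ ∘L adjoint (V i))) ≤ qEntropy (krausMap V σ) := by
  choose s y hrep horth _ hran using fun i =>
    exists_spectral_rep (isPositive_conj hσ (V i)) (trace_conj_ne_top hσ ht (V i))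
  have hΦ : Rep (krausMap V σ) fun p : Σ i, s i => y p.1 p.2 := by
    refine ⟨hV.pos hσ ht, fun f => ?_⟩
    rw [hV.qf_eq hσ ht, ENNReal.tsum_sigma']
    exact tsum_congr fun i => (hrep i).eq f
  have hΦt := hV.trace_ne_top hσ ht
  refine le_trans ?_ (hΦ.ent_le_qEntropy hΦt ?_)
  · rw [ent_sigma (x := fun p : Σ i, s i => nsq (y p.1 p.2)) (by rw [← hΦ.trace]; exact hΦt)]
    refine le_trans (le_of_eq ?_) le_self_add
    congr 1
    funext i
    exact (hrep i).trace
  · rintro ⟨i, a⟩ ⟨j, b⟩ hne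
    obtain rfl | hij := eq_or_ne i j
    · exact horth i a b fun h => hne (congrArg (Sigma.mk i) h)
    · obtain ⟨z, hz⟩ := hran i a
      obtain ⟨z', hz'⟩ := hran j b
      change inner ℂ (y i a) (y j b) = 0
      rw [hz, hz', ContinuousLinearMap.comp_apply, ContinuousLinearMap.comp_apply (V j),
        ← ContinuousLinearMap.adjoint_inner_right, ← ContinuousLinearMap.comp_apply _ (V j),
        hO i j hij, _root_.zero_apply, inner_zero_right]

/-- Orthonormal bases of the ranges of orthogonal projections on which `S` acts by the positive
scalars `c i` have `∑ dim(ran Qᵢ) e^{-K/cᵢ} ≤ 1`. -/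
theorem ExpBound.tsum_finrank_le {ι : Type*} {K : ℝ} (hE : ExpBound S K) {c : ι → ℝ}
    (hc : ∀ i, 0 < c i) {U : ι → Submodule ℂ E} [∀ i, CompleteSpace (U i)]
    (hU : ∀ i j, i ≠ j → ∀ x ∈ U i, ∀ y ∈ U j, inner ℂ x y = 0)
    (hSU : ∀ i, ∀ x ∈ U i, S x = (c i : ℂ) • x) :
    (∀ i, FiniteDimensional ℂ (U i)) ∧
      ∑' i, (Module.finrank ℂ (U i) : ℝ≥0∞) * ENNReal.ofReal (Real.exp (-(K / c i))) ≤ 1 := by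
  choose s b hb using fun i => exists_hilbertBasis ℂ (U i)
  have hn : ∀ i a, ‖(b i a : E)‖ = 1 := fun i a => (b i).orthonormal.1 a
  have ho : Orthonormal ℂ fun p : Σ i, s i => (b p.1 p.2 : E) := by
    refine ⟨fun p => hn p.1 p.2, ?_⟩
    rintro ⟨i, a⟩ ⟨j, a'⟩ hne
    obtain rfl | hij := eq_or_ne i j
    · exact (b i).orthonormal.2 fun h => hne (congrArg (Sigma.mk i) h)
    · exact hU i j hij _ (b i a).2 _ (b j a').2
  have hq : ∀ p : Σ i, s i, qf S (b p.1 p.2 : E) = c p.1 := fun p => by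
    unfold qf
    rw [hSU p.1 _ (b p.1 p.2).2, inner_smul_right, inner_self_eq_norm_sq_to_K, hn]
    simp
  have h1 := hE.tsum_le ho (fun p q hpq => by
    rw [hSU q.1 _ (b q.1 q.2).2, inner_smul_right, ho.2 hpq, mul_zero])
    (fun p => by rw [hq]; exact hc p.1)
  simp only [hq] at h1
  rw [ENNReal.tsum_sigma' (f := fun p : Σ i, s i =>
    ENNReal.ofReal (Real.exp (-(K / c p.1))))] at h1
  dsimp only at h1
  have hfin : ∀ i, Finite (s i) := fun i => by
    by_contra hinf
    rw [not_finite_iff_infinite] at hinf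
    refine absurd ((ENNReal.le_tsum i).trans h1) (not_le.2 ?_)
    rw [ENNReal.tsum_const_eq_top_of_ne_zero]
    · exact ENNReal.one_lt_top
    · simpa using Real.exp_pos _
  have hfd : ∀ i, FiniteDimensional ℂ (U i) := fun i => by
    have := Fintype.ofFinite (s i)
    exact (b i).toOrthonormalBasis.toBasis.finiteDimensional_of_finite
  refine ⟨hfd, le_trans (le_of_eq (tsum_congr fun i => ?_)) h1⟩
  have := Fintype.ofFinite (s i)
  rw [tsum_fintype, Finset.sum_const, nsmul_eq_mul, Finset.card_univ,
    Module.finrank_eq_card_basis (b i).toOrthonormalBasis.toBasis]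

theorem KrausSum.exists_exp_of_projections (hS : KrausSum V S) {K : ℝ} (hK0 : 0 ≤ K)
    (hE : ExpBound S K) {c : ℕ → ℝ} {Q : ℕ → E →L[ℂ] E} (hc : ∀ i, 0 ≤ c i)
    (hQ : ∀ i, IsSelfAdjoint (Q i) ∧ Q i * Q i = Q i) (hQO : ∀ i j, i ≠ j → Q i * Q j = 0)
    (hVQ : ∀ i, adjoint (V i) ∘L V i = (c i : ℂ) • Q i) :
    (∀ i, FiniteDimensional ℂ (LinearMap.range ((V i : E →ₗ[ℂ] F)))) ∧
    (∃ h : ℕ → ℝ, (∀ i, 0 ≤ h i) ∧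
      (∃ C : ℝ, ∀ n : ℕ, ‖∑ i ∈ Finset.range n, h i • (adjoint (V i) ∘L V i)‖ ≤ C) ∧
      (∑' i, (Module.finrank ℂ (LinearMap.range ((V i : E →ₗ[ℂ] F))) : ℝ≥0∞) *
          ENNReal.ofReal (Real.exp (-(h i)))) ≠ ∞) := by
  have hQQ : ∀ i x, Q i (Q i x) = Q i x := fun i x => by
    rw [← mul_apply_eq_comp, (hQ i).2]
  have hVV : ∀ i x, adjoint (V i) (V i x) = (c i : ℂ) • Q i x := fun i x => by
    rw [← ContinuousLinearMap.comp_apply, hVQ]; rfl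
  have hker : ∀ i x, (c i : ℂ) • Q i x = 0 → V i x = 0 := fun i x hx => by
    rw [← inner_self_eq_zero (𝕜 := ℂ), ← ContinuousLinearMap.adjoint_inner_right, hVV, hx,
      inner_zero_right]
  have hVQx : ∀ i x, V i (Q i x) = V i x := fun i x => by
    rw [← sub_eq_zero, ← map_sub]
    refine hker i _ ?_
    rw [map_sub, hQQ, sub_self, smul_zero]
  let U : {i // c i ≠ 0} → Submodule ℂ E := fun i =>
    LinearMap.ker ((1 - Q i : E →L[ℂ] E) : E →ₗ[ℂ] E)
  have hUQ : ∀ i, ∀ x ∈ U i, Q i x = x := fun i x hx => by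
    have : x - Q i x = 0 := hx
    rw [sub_eq_zero] at this
    exact this.symm
  have hUc : ∀ i, CompleteSpace (U i) := fun i =>
    (ContinuousLinearMap.isClosed_ker (1 - Q i : E →L[ℂ] E)).completeSpace_coe
  obtain ⟨hfd, hsum⟩ := hE.tsum_finrank_le (c := fun i : {i // c i ≠ 0} => c i) (U := U)
    (fun i => (hc i).lt_of_ne i.2.symm)
    (fun i j hij x hx y hy => by
      rw [← hUQ i x hx, ← hUQ j y hy, ← ContinuousLinearMap.adjoint_inner_right,
        (hQ i).1.adjoint_eq, ← mul_apply_eq_comp,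
        hQO i j fun h => hij (Subtype.ext h), _root_.zero_apply, inner_zero_right])
    (fun i x hx => by
      refine (hS x).unique ?_
      have h1 := hasSum_single (f := fun j => adjoint (V j) (V j x)) (i : ℕ) fun j hj => by
        rw [hVV, ← hUQ i x hx, ← mul_apply_eq_comp, hQO j i hj, _root_.zero_apply,
          smul_zero]
      rwa [hVV, hUQ i x hx] at h1)
  have hV0 : ∀ i, c i = 0 → LinearMap.range ((V i : E →ₗ[ℂ] F)) = ⊥ := fun i hi => by
    rw [LinearMap.range_eq_bot]
    ext x
    exact hker i x (by rw [hi, Complex.ofReal_zero, zero_smul])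
  have hVU : ∀ i : {i // c i ≠ 0}, LinearMap.range ((V i : E →ₗ[ℂ] F)) =
      (U i).map (V i : E →ₗ[ℂ] F) := fun i => by
    refine le_antisymm ?_ LinearMap.map_le_range
    rintro _ ⟨x, rfl⟩
    refine ⟨Q i x, ?_, hVQx i x⟩
    change Q i x - Q i (Q i x) = 0
    rw [hQQ, sub_self]
  refine ⟨fun i => ?_, fun i => K / c i, fun i => div_nonneg hK0 (hc i), ⟨K, fun n => ?_⟩, ?_⟩
  · by_cases hi : c i = 0
    · rw [hV0 i hi]; infer_instance
    · have := hfd ⟨i, hi⟩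
      rw [hVU ⟨i, hi⟩]; infer_instance
  · set P : ℕ → E →L[ℂ] E := fun i => if c i = 0 then 0 else Q i with hP
    have h1 : ∀ i, (K / c i) • (adjoint (V i) ∘L V i) = K • P i := fun i => by
      rw [hP, hVQ]
      simp only
      split_ifs with hi
      · simp [hi]
      · rw [Complex.coe_smul, smul_smul, div_mul_cancel₀ _ hi]
    have hPP : ∀ i j, P i * P j = if i = j then P i else 0 := fun i j => by
      rw [hP]
      simp only
      split_ifs with hi hj hij hij hij hij <;> simp_all
    have hPs : ∀ i, adjoint (P i) = P i := fun i => by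
      rw [hP]
      simp only
      split_ifs with hi
      · simp
      · exact (hQ i).1.adjoint_eq
    rw [Finset.sum_congr rfl fun i _ => h1 i, ← Finset.smul_sum, norm_smul,
      Real.norm_of_nonneg hK0]
    refine mul_le_of_le_one_right hK0 (norm_le_one_of_projection ?_ ?_)
    · rw [map_sum]; exact Finset.sum_congr rfl fun i _ => hPs i
    · change (∑ i ∈ Finset.range n, P i) * ∑ i ∈ Finset.range n, P i = _
      rw [Finset.sum_mul_sum]
      refine Finset.sum_congr rfl fun i hi => ?_
      simp only [hPP]
      rw [Finset.sum_ite_eq, if_pos hi]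
  · refine ne_top_of_le_ne_top ENNReal.one_ne_top (le_trans ?_ hsum)
    rw [← tsum_subtype_eq_of_support_subset (s := {i | c i ≠ 0})]
    · refine ENNReal.tsum_le_tsum fun i => ?_
      have := hfd i
      gcongr
      exact (congrArg (fun W : Submodule ℂ F => Module.finrank ℂ W) (hVU i)).le.trans
        (Submodule.finrank_map_le _ _)
    · intro i hi hci
      refine hi (mul_eq_zero.2 (Or.inl ?_))
      rw [Nat.cast_eq_zero, hV0 i hci, finrank_bot]

end Necessity

/-- Proposition 3 of the paper: continuity conditions for the output
entropy of a quantum operation `Φ(·) = ∑ᵢ Vᵢ(·)Vᵢ*` in terms of its Kraus operators.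
Here `S = ∑ᵢ Vᵢ*Vᵢ = Φ*(I)` is given via pointwise (strong) summation. -/
theorem statement7
    {E F : Type*}
    [NormedAddCommGroup E] [InnerProductSpace ℂ E] [CompleteSpace E]
    [TopologicalSpace.SeparableSpace E]
    [NormedAddCommGroup F] [InnerProductSpace ℂ F] [CompleteSpace F]
    [TopologicalSpace.SeparableSpace F]
    (V : ℕ → (E →L[ℂ] F)) (hV : KrausTNI V)
    (S : E →L[ℂ] E)
    (hS : ∀ x : E, HasSum (fun i => (ContinuousLinearMap.adjoint (V i)) (V i x)) (S x)) :
    -- (A) the case of a finite Kraus family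
    ((∃ N : ℕ, ∀ i ≥ N, V i = 0) →
      ((ContOn (fun ρ => qEntropy (krausMap V ρ)) (states E) ↔ ∀ i, LamStarFin (V i)) ∧
       (ContOn (fun ρ => qEntropy (krausMap V ρ)) (states E) ↔ LamStarSqrtFin S))) ∧
    -- (A) in the general case, (8) is necessary
    (ContOn (fun ρ => qEntropy (krausMap V ρ)) (states E) → ∀ i, LamStarFin (V i)) ∧
    -- (B) sufficiency of condition a)
    (((∀ i, FiniteDimensional ℂ (LinearMap.range ((V i : E →ₗ[ℂ] F)))) ∧
      (∃ h : ℕ → ℝ, (∀ i, 0 ≤ h i) ∧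
        (∃ C : ℝ, ∀ n : ℕ,
          ‖∑ i ∈ Finset.range n, h i • (ContinuousLinearMap.adjoint (V i) ∘L V i)‖ ≤ C) ∧
        (∑' i, (Module.finrank ℂ (LinearMap.range ((V i : E →ₗ[ℂ] F))) : ℝ≥0∞) *
            ENNReal.ofReal (Real.exp (-(h i)))) ≠ ∞)) →
      ContOn (fun ρ => qEntropy (krausMap V ρ)) (states E)) ∧
    -- (B) sufficiency of condition b)
    (((∀ ρ ∈ states E,
        clEntropy (fun i =>
          (traceENN (V i ∘L ρ ∘L ContinuousLinearMap.adjoint (V i))).toReal) ≠ ∞) ∧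
      LamStarSqrtFin S) →
      ContOn (fun ρ => qEntropy (krausMap V ρ)) (states E)) ∧
    -- (B) `λ*(√S) < ∞` in b) can be replaced by `∑ᵢ λ*(Vᵢ) < ∞`
    (((∀ ρ ∈ states E,
        clEntropy (fun i =>
          (traceENN (V i ∘L ρ ∘L ContinuousLinearMap.adjoint (V i))).toReal) ≠ ∞) ∧
      (∑' i, lamStar (V i)) ≠ ∞) →
      ContOn (fun ρ => qEntropy (krausMap V ρ)) (states E)) ∧
    -- (B) or by `∑ᵢ log(dᵢ)·‖Vᵢ‖² < ∞`
    (((∀ ρ ∈ states E,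
        clEntropy (fun i =>
          (traceENN (V i ∘L ρ ∘L ContinuousLinearMap.adjoint (V i))).toReal) ≠ ∞) ∧
      (∀ i, FiniteDimensional ℂ (LinearMap.range ((V i : E →ₗ[ℂ] F)))) ∧
      (∑' i, ENNReal.ofReal
          (Real.log (Module.finrank ℂ (LinearMap.range ((V i : E →ₗ[ℂ] F)))) *
            ‖V i‖ ^ 2)) ≠ ∞) →
      ContOn (fun ρ => qEntropy (krausMap V ρ)) (states E)) ∧
    -- necessity of a) when the `Vᵢ` are scalar multiples of mutually orthogonal projectors
    ((∃ (c : ℕ → ℝ) (Q : ℕ → (E →L[ℂ] E)),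
        (∀ i, 0 ≤ c i) ∧
        (∀ i, IsSelfAdjoint (Q i) ∧ Q i * Q i = Q i) ∧
        (∀ i j, i ≠ j → Q i * Q j = 0) ∧
        (∀ i, ContinuousLinearMap.adjoint (V i) ∘L V i = (c i : ℂ) • Q i) ∧
        (∀ i j, i ≠ j → ContinuousLinearMap.adjoint (V i) ∘L V j = 0)) →
      ContOn (fun ρ => qEntropy (krausMap V ρ)) (states E) →
      ((∀ i, FiniteDimensional ℂ (LinearMap.range ((V i : E →ₗ[ℂ] F)))) ∧
       (∃ h : ℕ → ℝ, (∀ i, 0 ≤ h i) ∧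
        (∃ C : ℝ, ∀ n : ℕ,
          ‖∑ i ∈ Finset.range n, h i • (ContinuousLinearMap.adjoint (V i) ∘L V i)‖ ≤ C) ∧
        (∑' i, (Module.finrank ℂ (LinearMap.range ((V i : E →ₗ[ℂ] F))) : ℝ≥0∞) *
            ENNReal.ofReal (Real.exp (-(h i)))) ≠ ∞))) ∧
    -- necessity of b) when the ranges of the `Vᵢ` are mutually orthogonal
    ((∀ i j, i ≠ j → ContinuousLinearMap.adjoint (V i) ∘L V j = 0) →
      ContOn (fun ρ => qEntropy (krausMap V ρ)) (states E) →
      ((∀ ρ ∈ states E,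
        clEntropy (fun i =>
          (traceENN (V i ∘L ρ ∘L ContinuousLinearMap.adjoint (V i))).toReal) ≠ ∞) ∧
      LamStarSqrtFin S)) := by
  have hS : KrausSum V S := hS
  refine ⟨?_, fun hc => hV.lamStarFin hc.1, ?_, ?_, ?_, ?_, ?_, ?_⟩
  · rintro ⟨N, hN⟩
    refine ⟨⟨fun hc => hV.lamStarFin hc.1, hV.contOn_of_finite hN⟩, fun hc => ?_, fun hl => ?_⟩
    · obtain ⟨K, hK0, hK⟩ := hV.exists_bound hc.1
      exact (hS.expBound_of_finite hV hK0 hK hN).lamStarSqrtFin hS.isPositive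
        (add_nonneg hK0 (Real.log_nonneg (by linarith [N.cast_nonneg (α := ℝ)])))
    · exact hS.contOn hV (fun ρ hρ =>
        hV.ent_trace_ne_top hN hρ.1 (traceENN_ne_top_of_mem_states hρ)) hl
  · rintro ⟨hfd, h, h0, ⟨C, hC⟩, hZ⟩
    exact hV.contOn_of_exp hfd h0 hC hZ
  · rintro ⟨h, hl⟩
    exact hS.contOn hV h hl
  · rintro ⟨h, hl⟩
    exact hV.contOn_of_lamStar h hl
  · rintro ⟨h, hfd, hl⟩
    exact hV.contOn_of_rank h hfd hl
  · rintro ⟨c, Q, hc, hQ, hQO, hVQ, hO⟩ hcont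
    obtain ⟨K, hK0, hK⟩ := hV.exists_bound hcont.1
    exact hS.exists_exp_of_projections hK0 (hS.expBound_of_orthogonal hV hK0 hK hO) hc hQ hQO hVQ
  · intro hO hcont
    obtain ⟨K, hK0, hK⟩ := hV.exists_bound hcont.1
    refine ⟨fun ρ hρ => ?_,
      (hS.expBound_of_orthogonal hV hK0 hK hO).lamStarSqrtFin hS.isPositive hK0⟩
    exact ne_top_of_le_ne_top (hcont.1 ρ hρ)
      (hV.ent_trace_le_of_orthogonal hO hρ.1 (traceENN_ne_top_of_mem_states hρ))

end QIT
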